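/- Let f be a dominant pseudo polynomial of degree θ > 3, set ρ = 1/(8θ² + 12θ + 10), and let 0 < ρ̃ < ρ/3 and δ > 0 be fixed and sufficiently small. Then for every ε > 0 there is a constant C > 0 such that for all sufficiently large X, every integer m with 2 ≤ m ≤ X^{ρ̃}, and Y = X^{1/3+δ}, one has |Σ_{n ≤ Y} Λ(n)·(1_J({f(n)/m}) − 1/m)| ≤ C·Y^{1−ρ+ε}, where J = [0, 1/m), {·} denotes the fractional part, and Λ is the von Mangoldt function. -/

import Mathlib

open Finset Filter

noncomputable section

/-- `f` is a dominant pseudo polynomial of degree `Θ`: it has the form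
`f x = ∑ j, α j * x ^ θ j` with positive coefficients, strictly increasing exponents
`1 ≤ θ 0 < θ 1 < ⋯`, and the largest exponent equals `Θ` and is not an integer. -/
def IsDominantPseudoPoly (f : ℝ → ℝ) (Θ : ℝ) : Prop :=
  ∃ (d : ℕ) (α θ : Fin (d + 1) → ℝ),
    (∀ j, 0 < α j) ∧ StrictMono θ ∧ 1 ≤ θ 0 ∧
    θ (Fin.last d) = Θ ∧ (∀ z : ℤ, (z : ℝ) ≠ Θ) ∧
    ∀ x : ℝ, f x = ∑ j, α j * x ^ θ j

namespace VinogradovMean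

/-- The additive character `x ↦ exp (2 π i x)` on the reals. -/
def e (x : ℝ) : ℂ := Complex.exp ((2 * Real.pi * x : ℝ) * Complex.I)

lemma norm_e (x : ℝ) : ‖e x‖ = 1 := by
  unfold e; exact Complex.norm_exp_ofReal_mul_I _

lemma e_add (x y : ℝ) : e (x + y) = e x * e y := by
  unfold e; rw [← Complex.exp_add]; congr 1; push_cast; ring

lemma e_zero : e 0 = 1 := by simp [e]

lemma e_int (z : ℤ) : e z = 1 := by
  unfold e
  rw [Complex.exp_eq_one_iff]
  exact ⟨z, by push_cast; ring⟩

lemma e_neg (x : ℝ) : e (-x) = (starRingEnd ℂ) (e x) := by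
  unfold e
  rw [← Complex.exp_conj]
  congr 1
  simp only [map_mul, Complex.conj_ofReal, Complex.conj_I]
  push_cast; ring

lemma e_eq_one_iff {x : ℝ} : e x = 1 ↔ ∃ z : ℤ, x = z := by
  constructor
  · intro h
    unfold e at h
    rw [Complex.exp_eq_one_iff] at h
    obtain ⟨n, hn⟩ := h
    refine ⟨n, ?_⟩
    have h2 := congrArg Complex.im hn
    simp at h2
    have : (2 * Real.pi) ≠ 0 := by positivity
    have h3 : (2 * Real.pi) * x = (2 * Real.pi) * n := by linarith
    exact mul_left_cancel₀ this h3
  · rintro ⟨z, rfl⟩; exact e_int z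

/-- The residue classes modulo `q` (read through `τ`) of the finite set `T`. -/
def cls (τ : ℤ → ℤ) (q : ℕ) (T : Finset ℤ) : Finset (Finset ℤ) :=
  T.image (fun t => T.filter (fun s => (q : ℤ) ∣ τ s - τ t))

lemma mem_cls {τ : ℤ → ℤ} {q : ℕ} {T U : Finset ℤ} :
    U ∈ cls τ q T ↔ ∃ t ∈ T, T.filter (fun s => (q : ℤ) ∣ τ s - τ t) = U := by
  simp [cls]

lemma cls_subset {τ : ℤ → ℤ} {q : ℕ} {T U : Finset ℤ} (h : U ∈ cls τ q T) : U ⊆ T := by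
  obtain ⟨t, -, rfl⟩ := mem_cls.1 h
  exact filter_subset _ _

lemma cls_nonempty {τ : ℤ → ℤ} {q : ℕ} {T U : Finset ℤ} (h : U ∈ cls τ q T) : U.Nonempty := by
  obtain ⟨t, ht, rfl⟩ := mem_cls.1 h
  exact ⟨t, by simp [ht]⟩

lemma cls_dvd {τ : ℤ → ℤ} {q : ℕ} {T U : Finset ℤ} (h : U ∈ cls τ q T) {s t : ℤ}
    (hs : s ∈ U) (ht : t ∈ U) : (q : ℤ) ∣ τ s - τ t := by
  obtain ⟨r, -, rfl⟩ := mem_cls.1 h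
  simp only [mem_filter] at hs ht
  have := dvd_sub hs.2 ht.2
  simpa using this

lemma cls_eq_filter {τ : ℤ → ℤ} {q : ℕ} {T U : Finset ℤ} (h : U ∈ cls τ q T) {t : ℤ}
    (ht : t ∈ U) : T.filter (fun s => (q : ℤ) ∣ τ s - τ t) = U := by
  obtain ⟨r, -, rfl⟩ := mem_cls.1 h
  simp only [mem_filter] at ht
  apply filter_congr
  intro s _
  constructor
  · intro h1; have := dvd_add h1 ht.2; simpa using this
  · intro h1; have := dvd_sub h1 ht.2; simpa using this

lemma cls_disjoint {τ : ℤ → ℤ} {q : ℕ} {T U V : Finset ℤ} (hU : U ∈ cls τ q T)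
    (hV : V ∈ cls τ q T) (hne : U ≠ V) : Disjoint U V := by
  rw [Finset.disjoint_left]
  intro t h1 h2
  exact hne ((cls_eq_filter hU h1).symm.trans (cls_eq_filter hV h2))

lemma cls_congr {τ τ' : ℤ → ℤ} {q q' : ℕ} {T : Finset ℤ}
    (h : ∀ s ∈ T, ∀ t ∈ T, (q : ℤ) ∣ τ s - τ t ↔ (q' : ℤ) ∣ τ' s - τ' t) :
    cls τ q T = cls τ' q' T := by
  unfold cls
  apply image_congr
  intro t ht
  exact filter_congr fun s hs => h s hs t ht

lemma self_mem_class {τ : ℤ → ℤ} {q : ℕ} {T : Finset ℤ} {t : ℤ} (ht : t ∈ T) :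
    ∃ U ∈ cls τ q T, t ∈ U :=
  ⟨_, mem_cls.2 ⟨t, ht, rfl⟩, by simp [ht]⟩

lemma biUnion_cls (τ : ℤ → ℤ) (q : ℕ) (T : Finset ℤ) : (cls τ q T).biUnion id = T := by
  ext t
  simp only [mem_biUnion, id]
  constructor
  · rintro ⟨U, hU, ht⟩; exact cls_subset hU ht
  · intro ht; exact self_mem_class ht

lemma sum_cls {M : Type*} [AddCommMonoid M] (τ : ℤ → ℤ) (q : ℕ) (T : Finset ℤ) (f : ℤ → M) :
    ∑ t ∈ T, f t = ∑ U ∈ cls τ q T, ∑ t ∈ U, f t := by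
  conv_lhs => rw [← biUnion_cls τ q T]
  rw [sum_biUnion]
  · rfl
  · intro U hU V hV hne
    exact cls_disjoint hU hV hne

lemma cls_cls {τ : ℤ → ℤ} {q q' : ℕ} (hq : q ∣ q') (T : Finset ℤ) :
    cls τ q' T = (cls τ q T).biUnion (cls τ q') := by
  have hq' : (q : ℤ) ∣ q' := by exact_mod_cast hq
  ext V
  simp only [mem_biUnion]
  constructor
  · intro hV
    obtain ⟨t, ht⟩ := cls_nonempty hV
    obtain ⟨U, hU, htU⟩ := self_mem_class (τ := τ) (q := q) (cls_subset hV ht)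
    refine ⟨U, hU, mem_cls.2 ⟨t, htU, ?_⟩⟩
    rw [← cls_eq_filter hV ht, ← cls_eq_filter hU htU]
    ext s
    simp only [mem_filter]
    constructor
    · rintro ⟨⟨h1, h2⟩, h3⟩; exact ⟨h1, h3⟩
    · rintro ⟨h1, h3⟩; exact ⟨⟨h1, hq'.trans h3⟩, h3⟩
  · rintro ⟨U, hU, hV⟩
    obtain ⟨t, ht⟩ := cls_nonempty hV
    refine mem_cls.2 ⟨t, cls_subset hU (cls_subset hV ht), ?_⟩
    rw [← cls_eq_filter hV ht, ← cls_eq_filter hU (cls_subset hV ht)]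
    ext s
    simp only [mem_filter]
    constructor
    · rintro ⟨h1, h3⟩; exact ⟨⟨h1, hq'.trans h3⟩, h3⟩
    · rintro ⟨⟨h1, h2⟩, h3⟩; exact ⟨h1, h3⟩

lemma sum_cls_cls {M : Type*} [AddCommMonoid M] {τ : ℤ → ℤ} {q q' : ℕ} (hq : q ∣ q')
    (T : Finset ℤ) (N : Finset ℤ → M) :
    ∑ V ∈ cls τ q' T, N V = ∑ U ∈ cls τ q T, ∑ V ∈ cls τ q' U, N V := by
  rw [cls_cls hq, sum_biUnion]
  intro U hU V hV hne
  rw [Function.onFun, Finset.disjoint_left]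
  intro W h1 h2
  obtain ⟨t, ht⟩ := cls_nonempty h1
  exact (Finset.disjoint_left.1 (cls_disjoint hU hV hne)) (cls_subset h1 ht) (cls_subset h2 ht)

lemma card_cls_le {τ : ℤ → ℤ} {q : ℕ} (hq : 0 < q) (T : Finset ℤ) : (cls τ q T).card ≤ q := by
  have hq' : (0 : ℤ) < q := by exact_mod_cast hq
  have h1 : (cls τ q T) ⊆ (Finset.Ico (0 : ℤ) q).image
      (fun j => T.filter (fun s => (q : ℤ) ∣ τ s - j)) := by
    intro U hU
    obtain ⟨t, ht, rfl⟩ := mem_cls.1 hU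
    simp only [mem_image, mem_Ico]
    refine ⟨τ t % q, ⟨Int.emod_nonneg _ hq'.ne', Int.emod_lt_of_pos _ hq'⟩, ?_⟩
    apply filter_congr
    intro s _
    have h2 : (q : ℤ) ∣ τ t - τ t % q := Int.dvd_self_sub_emod
    constructor
    · intro h; have := dvd_sub h h2; simpa using this
    · intro h; have := dvd_add h h2; simpa using this
  calc _ ≤ _ := card_le_card h1
    _ ≤ _ := card_image_le
    _ = q := by simp

/-- Weighted `P`-th moment of the partial sum over `T`. -/
def nrm {G : Type} [Fintype G] (w : G → ℝ) (F : ℤ → G → ℂ) (P : ℕ) (T : Finset ℤ) : ℝ :=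
  ∑ g, w g * ‖∑ t ∈ T, F t g‖ ^ P

/-- Sum over residue classes modulo `q` of the weighted `P`-th moments. -/
def dsum {G : Type} [Fintype G] (w : G → ℝ) (F : ℤ → G → ℂ) (P : ℕ) (τ : ℤ → ℤ) (q : ℕ)
    (T : Finset ℤ) : ℝ :=
  ∑ U ∈ cls τ q T, nrm w F P U

/-- The functions `F t`, `t ∈ T`, are equivariant under multiplication by all polynomial phases of
degree at most `k` and denominator `p ^ N`, via symmetries preserving the weight `w`. -/
def PhaseInv (p k N : ℕ) {G : Type} (w : G → ℝ) (F : ℤ → G → ℂ) (τ : ℤ → ℤ)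
    (T : Finset ℤ) : Prop :=
  ∀ ψ : Polynomial ℤ, ψ.natDegree ≤ k → ∃ (σ : Equiv.Perm G) (c : G → ℂ),
    (∀ g, ‖c g‖ = 1) ∧ (∀ g, w (σ g) = w g) ∧
    ∀ t ∈ T, ∀ g, F t (σ g) = c g * e ((ψ.eval (τ t) : ℤ) / (p : ℝ) ^ N) * F t g

/-- Half of the critical exponent `k (k + 1)`. -/
def hh (k : ℕ) : ℕ := k * (k + 1) / 2

lemma two_hh (k : ℕ) : 2 * hh k = k * (k + 1) := by
  unfold hh
  exact Nat.mul_div_cancel' (Nat.even_mul_succ_self k).two_dvd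

lemma hh_mono {l k : ℕ} (h : l ≤ k) : hh l ≤ hh k := by
  unfold hh; gcongr

lemma hh_pos {k : ℕ} (h : 1 ≤ k) : 1 ≤ hh k := by
  have := hh_mono h; simpa [hh] using this

/-- Decoupling inequality for degree `k` at scale `p ^ n` with constant `K`. -/
def Dec (p k n : ℕ) (K : ℝ) : Prop :=
  ∀ (G : Type) [Fintype G] (w : G → ℝ) (F : ℤ → G → ℂ) (τ : ℤ → ℤ) (T : Finset ℤ),
    (∀ g, 0 ≤ w g) → PhaseInv p k (k * n) w F τ T →
    nrm w F (2 * hh k) T ≤ K * (p : ℝ) ^ (n * (hh k - 1)) * dsum w F (2 * hh k) τ (p ^ n) T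

/-- Bilinear decoupling inequality. -/
def Bil (p k n l a b : ℕ) (K : ℝ) : Prop :=
  ∀ (G : Type) [Fintype G] (w : G → ℝ) (F : ℤ → G → ℂ) (τ : ℤ → ℤ) (T T' : Finset ℤ) (i i' : ℤ)
    (x y : ℝ), (∀ g, 0 ≤ w g) → PhaseInv p k (k * n) w F τ (T ∪ T') →
    (∀ t ∈ T, (p : ℤ) ^ a ∣ τ t - i) → (∀ t ∈ T', (p : ℤ) ^ b ∣ τ t - i') → ¬ (p : ℤ) ∣ i - i' →
    0 ≤ x → 0 ≤ y →
    (p : ℝ) ^ ((n - a) * (hh k - 1)) * dsum w F (2 * hh k) τ (p ^ n) T ≤ x ^ (2 * hh k) →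
    (p : ℝ) ^ ((n - b) * (hh k - 1)) * dsum w F (2 * hh k) τ (p ^ n) T' ≤ y ^ (2 * hh k) →
    ∑ g, w g * (‖∑ t ∈ T, F t g‖ ^ (2 * hh l) * ‖∑ t ∈ T', F t g‖ ^ (2 * hh k - 2 * hh l)) ≤
      K * (x ^ (2 * hh l) * y ^ (2 * hh k - 2 * hh l))

lemma nrm_nonneg {G : Type} [Fintype G] {w : G → ℝ} (hw : ∀ g, 0 ≤ w g) (F : ℤ → G → ℂ) (P : ℕ)
    (T : Finset ℤ) : 0 ≤ nrm w F P T :=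
  sum_nonneg fun g _ => mul_nonneg (hw g) (by positivity)

lemma dsum_nonneg {G : Type} [Fintype G] {w : G → ℝ} (hw : ∀ g, 0 ≤ w g) (F : ℤ → G → ℂ) (P : ℕ)
    (τ : ℤ → ℤ) (q : ℕ) (T : Finset ℤ) : 0 ≤ dsum w F P τ q T :=
  sum_nonneg fun _ _ => nrm_nonneg hw F P _

lemma dsum_dsum {G : Type} [Fintype G] (w : G → ℝ) (F : ℤ → G → ℂ) (P : ℕ)
    (τ : ℤ → ℤ) {q q' : ℕ} (hq : q ∣ q') (T : Finset ℤ) :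
    ∑ U ∈ cls τ q T, dsum w F P τ q' U = dsum w F P τ q' T := by
  unfold dsum; rw [sum_cls_cls hq]

lemma dsum_cls_le {G : Type} [Fintype G] {w : G → ℝ} (hw : ∀ g, 0 ≤ w g) (F : ℤ → G → ℂ) (P : ℕ)
    (τ : ℤ → ℤ) {q q' : ℕ} (hq : q ∣ q') {T U : Finset ℤ} (hU : U ∈ cls τ q T) :
    dsum w F P τ q' U ≤ dsum w F P τ q' T := by
  rw [← dsum_dsum w F P τ hq T]
  exact single_le_sum (f := fun U => dsum w F P τ q' U) (fun V _ => dsum_nonneg hw F P τ q' V) hU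

lemma PhaseInv.mono {p k N : ℕ} {G : Type} {w : G → ℝ} {F : ℤ → G → ℂ} {τ : ℤ → ℤ}
    {T U : Finset ℤ} (h : PhaseInv p k N w F τ T) (hU : U ⊆ T) : PhaseInv p k N w F τ U := by
  intro ψ hψ
  obtain ⟨σ, c, h1, h2, h3⟩ := h ψ hψ
  exact ⟨σ, c, h1, h2, fun t ht => h3 t (hU ht)⟩

lemma pow_sum_le_card {ι : Type*} (s : Finset ι) (f : ι → ℂ) {P : ℕ} (hP : 1 ≤ P) :
    ‖∑ i ∈ s, f i‖ ^ P ≤ (s.card : ℝ) ^ (P - 1) * ∑ i ∈ s, ‖f i‖ ^ P := by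
  obtain ⟨n, rfl⟩ : ∃ n, P = n + 1 := ⟨P - 1, by omega⟩
  calc ‖∑ i ∈ s, f i‖ ^ (n + 1) ≤ (∑ i ∈ s, ‖f i‖) ^ (n + 1) := by
        gcongr; exact norm_sum_le _ _
    _ ≤ _ := pow_sum_le_card_mul_sum_pow (fun i _ => norm_nonneg _) n

end VinogradovMean

namespace VinogradovMean

lemma Dec.mono {p k n : ℕ} {K K' : ℝ} (h : Dec p k n K) (hK : K ≤ K') : Dec p k n K' := by
  intro G _ w F τ T hw hi
  refine (h G w F τ T hw hi).trans ?_
  have := dsum_nonneg hw F (2 * hh k) τ (p ^ n) T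
  gcongr

lemma Bil.mono {p k n l a b : ℕ} {K K' : ℝ} (h : Bil p k n l a b K) (hK : K ≤ K') :
    Bil p k n l a b K' := by
  intro G _ w F τ T T' i i' x y hw hi h1 h2 h3 hx hy h4 h5
  refine (h G w F τ T T' i i' x y hw hi h1 h2 h3 hx hy h4 h5).trans ?_
  gcongr

lemma nrm_le_dsum {G : Type} [Fintype G] {w : G → ℝ} (hw : ∀ g, 0 ≤ w g) (F : ℤ → G → ℂ)
    {P : ℕ} (hP : 1 ≤ P) (τ : ℤ → ℤ) {q : ℕ} (hq : 0 < q) (T : Finset ℤ) :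
    nrm w F P T ≤ (q : ℝ) ^ (P - 1) * dsum w F P τ q T := by
  unfold dsum nrm
  rw [sum_comm, mul_sum]
  apply sum_le_sum
  intro g _
  rw [← mul_sum, mul_left_comm]
  gcongr
  · exact hw g
  rw [sum_cls τ q T]
  refine (pow_sum_le_card _ _ hP).trans ?_
  gcongr
  exact card_cls_le hq T

lemma dec_trivial {p k : ℕ} (hp : 1 ≤ p) (hk : 1 ≤ k) (n : ℕ) :
    Dec p k n ((p : ℝ) ^ (n * hh k)) := by
  intro G _ w F τ T hw _
  have hk' := hh_pos hk
  refine (nrm_le_dsum hw F (P := 2 * hh k) (by omega) τ (q := p ^ n) (by positivity) T).trans ?_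
  apply le_of_eq
  congr 1
  rw [← pow_add, Nat.cast_pow, ← pow_mul, ← mul_add]
  congr 2
  omega

/-- Orthogonality: the case of linear phases. -/
lemma dec_one {p : ℕ} (hp : 1 ≤ p) (n : ℕ) : Dec p 1 n 1 := by
  intro G _ w F τ T hw hi
  have e1 : hh 1 = 1 := rfl
  simp only [e1, mul_one, one_mul, tsub_self, mul_zero, pow_zero] at hi ⊢
  have orth : ∀ t ∈ T, ∀ t' ∈ T, ¬ ((p ^ n : ℕ) : ℤ) ∣ τ t' - τ t →
      ∑ g, (w g : ℂ) * (F t g * (starRingEnd ℂ) (F t' g)) = 0 := by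
    intro t ht t' ht' hd
    obtain ⟨σ, c, hc, hwσ, hF⟩ := hi Polynomial.X (by simp)
    set S := ∑ g, (w g : ℂ) * (F t g * (starRingEnd ℂ) (F t' g)) with hS
    set z := e (((τ t - τ t' : ℤ) : ℝ) / (p : ℝ) ^ n) with hz
    have h1 : S = z * S := by
      conv_lhs => rw [hS, ← Equiv.sum_comp σ]
      rw [hS, mul_sum]
      apply sum_congr rfl
      intro g _
      rw [hwσ, hF t ht, hF t' ht']
      simp only [Polynomial.eval_X, map_mul]
      rw [← e_neg, hz]
      have : ((τ t - τ t' : ℤ) : ℝ) / (p : ℝ) ^ n =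
          ((τ t : ℤ) : ℝ) / (p : ℝ) ^ n + -(((τ t' : ℤ) : ℝ) / (p : ℝ) ^ n) := by
        push_cast; ring
      rw [this, e_add]
      have hcc : c g * (starRingEnd ℂ) (c g) = 1 := by
        rw [Complex.mul_conj, Complex.normSq_eq_norm_sq, hc]; simp
      linear_combination ((w g : ℂ) * e (((τ t : ℤ) : ℝ) / (p : ℝ) ^ n) *
        e (-(((τ t' : ℤ) : ℝ) / (p : ℝ) ^ n)) * F t g * (starRingEnd ℂ) (F t' g)) * hcc
    by_contra hS0
    have h2 : z = 1 := by
      have : z * S = 1 * S := by rw [one_mul]; exact h1.symm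
      exact mul_right_cancel₀ hS0 this
    obtain ⟨m, hm⟩ := e_eq_one_iff.1 h2
    apply hd
    have hpp : (p : ℝ) ^ n ≠ 0 := by positivity
    rw [div_eq_iff hpp] at hm
    have hm' : τ t - τ t' = m * (p : ℤ) ^ n := by exact_mod_cast hm
    refine ⟨-m, ?_⟩
    push_cast
    linarith
  have expand : ∀ U : Finset ℤ, ((nrm w F 2 U : ℝ) : ℂ) =
      ∑ t ∈ U, ∑ t' ∈ U, ∑ g, (w g : ℂ) * (F t g * (starRingEnd ℂ) (F t' g)) := by
    intro U
    unfold nrm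
    push_cast
    rw [Finset.sum_congr rfl (fun t _ => Finset.sum_comm), Finset.sum_comm]
    apply sum_congr rfl
    intro g _
    rw [← Complex.mul_conj', map_sum, sum_mul_sum, mul_sum]
    simp only [mul_sum]
  apply le_of_eq
  have : ((nrm w F 2 T : ℝ) : ℂ) = ((dsum w F 2 τ (p ^ n) T : ℝ) : ℂ) := by
    unfold dsum
    rw [Complex.ofReal_sum, expand, sum_cls τ (p ^ n) T]
    apply sum_congr rfl
    intro U hU
    rw [expand]
    apply sum_congr rfl
    intro t ht
    conv_rhs => rw [← cls_eq_filter hU ht, sum_filter]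
    apply sum_congr rfl
    intro t' ht'
    split_ifs with h
    · rfl
    · exact orth t (cls_subset hU ht) t' ht' h
  exact_mod_cast this

lemma dsum_shift {G : Type} [Fintype G] (w : G → ℝ) (F : ℤ → G → ℂ) (P : ℕ)
    {p : ℕ} (hp : 1 ≤ p) (τ : ℤ → ℤ) (a n : ℕ) (i : ℤ) {T : Finset ℤ}
    (hT : ∀ t ∈ T, (p : ℤ) ^ a ∣ τ t - i) :
    dsum w F P (fun t => (τ t - i) / (p : ℤ) ^ a) (p ^ n) T = dsum w F P τ (p ^ (a + n)) T := by
  unfold dsum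
  rw [cls_congr]
  intro s hs t ht
  have hp0 : (p : ℤ) ^ a ≠ 0 := by positivity
  obtain ⟨u, hu⟩ := hT s hs
  obtain ⟨v, hv⟩ := hT t ht
  simp only [hu, hv, Int.mul_ediv_cancel_left _ hp0]
  have : τ s - τ t = (p : ℤ) ^ a * (u - v) := by linear_combination hu - hv
  rw [this]
  push_cast
  rw [pow_add, mul_dvd_mul_iff_left hp0]

/-- Decoupling on a residue class modulo `p ^ m`. -/
lemma Dec.rescale {p k n m : ℕ} {K : ℝ} (hp : 1 ≤ p) (hm : m ≤ n) (h : Dec p k (n - m) K)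
    {G : Type} [Fintype G] {w : G → ℝ} (hw : ∀ g, 0 ≤ w g) {F : ℤ → G → ℂ} {τ : ℤ → ℤ}
    {T : Finset ℤ} (hi : PhaseInv p k (k * n) w F τ T) {i : ℤ}
    (hT : ∀ t ∈ T, (p : ℤ) ^ m ∣ τ t - i) :
    nrm w F (2 * hh k) T ≤
      K * (p : ℝ) ^ ((n - m) * (hh k - 1)) * dsum w F (2 * hh k) τ (p ^ n) T := by
  have h1 := h G w F (fun t => (τ t - i) / (p : ℤ) ^ m) T hw ?_
  · rwa [dsum_shift w F _ hp τ m (n - m) i hT, Nat.add_sub_cancel' hm] at h1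
  intro ψ hψ
  obtain ⟨σ, c, h1, h2, h3⟩ := hi (∑ r ∈ range (k + 1),
    Polynomial.C (ψ.coeff r * (p : ℤ) ^ (k * m - m * r)) * (Polynomial.X - Polynomial.C i) ^ r) (by
      apply Polynomial.natDegree_sum_le_of_forall_le
      intro r hr
      refine (Polynomial.natDegree_C_mul_le _ _).trans ?_
      refine (Polynomial.natDegree_pow_le).trans ?_
      rw [Polynomial.natDegree_X_sub_C]
      simp at hr; omega)
  refine ⟨σ, c, h1, h2, fun t ht g => ?_⟩
  rw [h3 t ht g]
  congr 3
  have hp0 : (p : ℤ) ^ m ≠ 0 := by positivity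
  obtain ⟨u, hu⟩ := hT t ht
  simp only [hu, Int.mul_ediv_cancel_left _ hp0]
  have e1 : (∑ r ∈ range (k + 1), Polynomial.C (ψ.coeff r * (p : ℤ) ^ (k * m - m * r)) *
      (Polynomial.X - Polynomial.C i) ^ r).eval (τ t) = (p : ℤ) ^ (k * m) * ψ.eval u := by
    rw [Polynomial.eval_finsetSum, Polynomial.eval_eq_sum_range' (n := k + 1) (by omega), mul_sum]
    apply sum_congr rfl
    intro r hr
    simp only [Polynomial.eval_mul, Polynomial.eval_C, Polynomial.eval_pow, Polynomial.eval_sub,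
      Polynomial.eval_X, hu]
    have : k * m = (k * m - m * r) + m * r := by
      have : m * r ≤ m * k := Nat.mul_le_mul_left _ (by simp at hr; omega)
      rw [Nat.sub_add_cancel]; rwa [mul_comm k]
    conv_rhs => rw [this]
    rw [pow_add, mul_pow, ← pow_mul]
    ring
  rw [e1]
  have : k * n = k * m + k * (n - m) := by rw [← mul_add]; congr 1; omega
  rw [this, pow_add]
  push_cast
  have : (p : ℝ) ^ (k * m) ≠ 0 := by positivity
  have : (p : ℝ) ^ (k * (n - m)) ≠ 0 := by positivity
  field_simp

end VinogradovMean

namespace VinogradovMean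

/-- Hölder's inequality for weighted finite sums, with natural number exponents. -/
lemma holder_nat {ι : Type*} (s : Finset ι) (w U V Z : ι → ℝ) (hw : ∀ g ∈ s, 0 ≤ w g)
    (hU : ∀ g ∈ s, 0 ≤ U g) (hV : ∀ g ∈ s, 0 ≤ V g) (hZ : ∀ g ∈ s, 0 ≤ Z g) {A B : ℕ}
    (hA : 1 ≤ A) (hB : 1 ≤ B) (h : ∀ g ∈ s, Z g ^ (A + B) ≤ U g ^ A * V g ^ B) :
    (∑ g ∈ s, w g * Z g) ^ (A + B) ≤ (∑ g ∈ s, w g * U g) ^ A * (∑ g ∈ s, w g * V g) ^ B := by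
  have hA' : (0 : ℝ) < A := by exact_mod_cast hA
  have hB' : (0 : ℝ) < B := by exact_mod_cast hB
  have hAB : (0 : ℝ) < A + B := by positivity
  set a : ℝ := A / (A + B) with ha
  set b : ℝ := B / (A + B) with hb
  have hab : a + b = 1 := by rw [ha, hb]; field_simp
  have ha0 : 0 < a := by positivity
  have hb0 : 0 < b := by positivity
  have hUV : ∀ g ∈ s, w g * Z g ≤ (w g * U g) ^ a * (w g * V g) ^ b := by
    intro g hg
    have h1 : Z g ≤ U g ^ a * V g ^ b := by
      have h2 : (Z g ^ (A + B)) ^ ((1 : ℝ) / (A + B)) ≤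
          (U g ^ A * V g ^ B) ^ ((1 : ℝ) / (A + B)) :=
        Real.rpow_le_rpow (pow_nonneg (hZ g hg) _) (h g hg) (by positivity)
      rw [Real.mul_rpow (pow_nonneg (hU g hg) _) (pow_nonneg (hV g hg) _),
        ← Real.rpow_natCast, ← Real.rpow_natCast, ← Real.rpow_natCast,
        ← Real.rpow_mul (hZ g hg), ← Real.rpow_mul (hU g hg), ← Real.rpow_mul (hV g hg)] at h2
      have e1 : ((A + B : ℕ) : ℝ) * (1 / (A + B)) = 1 := by push_cast; field_simp
      have e2 : (A : ℝ) * (1 / (A + B)) = a := by rw [ha]; ring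
      have e3 : (B : ℝ) * (1 / (A + B)) = b := by rw [hb]; ring
      rwa [e1, e2, e3, Real.rpow_one] at h2
    rw [Real.mul_rpow (hw g hg) (hU g hg), Real.mul_rpow (hw g hg) (hV g hg)]
    have e4 : w g ^ a * w g ^ b = w g := by
      rw [← Real.rpow_add_of_nonneg (hw g hg) ha0.le hb0.le, hab, Real.rpow_one]
    calc w g * Z g ≤ w g * (U g ^ a * V g ^ b) := mul_le_mul_of_nonneg_left h1 (hw g hg)
      _ = (w g ^ a * w g ^ b) * (U g ^ a * V g ^ b) := by rw [e4]
      _ = _ := by ring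
  have hsU : 0 ≤ ∑ g ∈ s, w g * U g := sum_nonneg fun g hg => mul_nonneg (hw g hg) (hU g hg)
  have hsV : 0 ≤ ∑ g ∈ s, w g * V g := sum_nonneg fun g hg => mul_nonneg (hw g hg) (hV g hg)
  have hc : (1 / a).HolderConjugate (1 / b) := by
    rw [Real.holderConjugate_iff]
    refine ⟨?_, by simpa using hab⟩
    rw [lt_div_iff₀ ha0]; linarith
  have key : ∑ g ∈ s, w g * Z g ≤ (∑ g ∈ s, w g * U g) ^ a * (∑ g ∈ s, w g * V g) ^ b := by
    refine (sum_le_sum hUV).trans ?_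
    refine (Real.inner_le_Lp_mul_Lq_of_nonneg s hc
      (fun g hg => Real.rpow_nonneg (mul_nonneg (hw g hg) (hU g hg)) _)
      (fun g hg => Real.rpow_nonneg (mul_nonneg (hw g hg) (hV g hg)) _)).trans ?_
    simp only [one_div, inv_inv]
    apply le_of_eq
    congr 2
    · apply sum_congr rfl
      intro g hg
      rw [← Real.rpow_mul (mul_nonneg (hw g hg) (hU g hg)), mul_inv_cancel₀ ha0.ne', Real.rpow_one]
    · apply sum_congr rfl
      intro g hg
      rw [← Real.rpow_mul (mul_nonneg (hw g hg) (hV g hg)), mul_inv_cancel₀ hb0.ne', Real.rpow_one]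
  calc _ ≤ ((∑ g ∈ s, w g * U g) ^ a * (∑ g ∈ s, w g * V g) ^ b) ^ (A + B) := by
        gcongr
        exact sum_nonneg fun g hg => mul_nonneg (hw g hg) (hZ g hg)
    _ = _ := by
        rw [mul_pow, ← Real.rpow_natCast, ← Real.rpow_natCast, ← Real.rpow_mul hsU,
          ← Real.rpow_mul hsV]
        have e2 : a * ((A + B : ℕ) : ℝ) = A := by rw [ha]; push_cast; field_simp
        have e3 : b * ((A + B : ℕ) : ℝ) = B := by rw [hb]; push_cast; field_simp
        rw [e2, e3, Real.rpow_natCast, Real.rpow_natCast]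

lemma bil_zero {p k n a b : ℕ} {K : ℝ} (hp : 1 ≤ p) (hK : 0 ≤ K) (hb : b ≤ n)
    (h : Dec p k (n - b) K) : Bil p k n 0 a b K := by
  intro G _ w F τ T T' i i' x y hw hi _ h2 _ _ _ _ h5
  have e0 : hh 0 = 0 := rfl
  simp only [e0, mul_zero, pow_zero, one_mul, tsub_zero]
  refine (h.rescale hp hb hw (hi.mono subset_union_right) h2).trans ?_
  rw [mul_assoc]
  gcongr

lemma hh_lt {l k : ℕ} (h : l < k) : hh l < hh k := by
  have h1 := two_hh l
  have h2 := two_hh k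
  have : l * (l + 1) < k * (k + 1) := by nlinarith
  omega

lemma bil_trivial {p k n l a b : ℕ} {K : ℝ} (hp : 1 ≤ p) (hK : 0 ≤ K) (hl : 1 ≤ l) (hlk : l < k)
    (ha : a ≤ n) (hb : b ≤ n)
    (h : Dec p k (n - a) K) (h' : Dec p k (n - b) K) : Bil p k n l a b K := by
  intro G _ w F τ T T' i i' x y hw hi h1 h2 _ hx hy h4 h5
  have hl' := hh_pos hl
  have hlk' := hh_lt hlk
  have b1 : ∑ g, w g * ‖∑ t ∈ T, F t g‖ ^ (2 * hh k) ≤ K * x ^ (2 * hh k) := by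
    refine (h.rescale hp ha hw (hi.mono subset_union_left) h1).trans ?_
    rw [mul_assoc]
    gcongr
  have b2 : ∑ g, w g * ‖∑ t ∈ T', F t g‖ ^ (2 * hh k) ≤ K * y ^ (2 * hh k) := by
    refine (h'.rescale hp hb hw (hi.mono subset_union_right) h2).trans ?_
    rw [mul_assoc]
    gcongr
  have key := holder_nat (univ : Finset G) w (fun g => ‖∑ t ∈ T, F t g‖ ^ (2 * hh k))
    (fun g => ‖∑ t ∈ T', F t g‖ ^ (2 * hh k))
    (fun g => ‖∑ t ∈ T, F t g‖ ^ (2 * hh l) * ‖∑ t ∈ T', F t g‖ ^ (2 * hh k - 2 * hh l))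
    (fun g _ => hw g) (fun g _ => by positivity) (fun g _ => by positivity)
    (fun g _ => by positivity) (A := 2 * hh l) (B := 2 * hh k - 2 * hh l) (by omega) (by omega)
    (fun g _ => by
      rw [Nat.add_sub_cancel' (by omega), mul_pow, ← pow_mul, ← pow_mul, ← pow_mul, ← pow_mul,
        mul_comm (2 * hh l), mul_comm (2 * hh k - 2 * hh l)])
  refine le_of_pow_le_pow_left₀ (n := 2 * hh l + (2 * hh k - 2 * hh l)) (by omega) (by positivity)
    (key.trans ?_)
  calc _ ≤ (K * x ^ (2 * hh k)) ^ (2 * hh l) * (K * y ^ (2 * hh k)) ^ (2 * hh k - 2 * hh l) := by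
        have nn : ∀ U : Finset ℤ, 0 ≤ ∑ g, w g * ‖∑ t ∈ U, F t g‖ ^ (2 * hh k) :=
          fun U => sum_nonneg fun g _ => mul_nonneg (hw g) (by positivity)
        have := nn T
        have := nn T'
        gcongr
    _ = _ := by
        rw [mul_pow, mul_pow, mul_pow, mul_pow, ← pow_mul, ← pow_mul, ← pow_mul, ← pow_mul,
          Nat.add_sub_cancel' (by omega : 2 * hh l ≤ 2 * hh k), mul_comm (2 * hh k) (2 * hh l),
          mul_comm (2 * hh k) (2 * hh k - 2 * hh l)]
        have : K ^ (2 * hh k) = K ^ (2 * hh l) * K ^ (2 * hh k - 2 * hh l) := by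
          rw [← pow_add, Nat.add_sub_cancel' (by omega)]
        rw [this]; ring

lemma hh_identity {l k : ℕ} (hl : 1 ≤ l) (hlk : l < k) :
    (2 * hh k - 2 * hh (k - l)) + (k - l) * (2 * hh (l - 1)) = (k - l + 1) * (2 * hh l) ∧
    2 * hh (k - l) + (k - l) * (2 * hh k - 2 * hh (l - 1)) =
      (k - l + 1) * (2 * hh k - 2 * hh l) := by
  obtain ⟨j, rfl⟩ : ∃ j, k = l + j := ⟨k - l, by omega⟩
  obtain ⟨m, rfl⟩ : ∃ m, l = m + 1 := ⟨l - 1, by omega⟩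
  have a1 := hh_mono (show j ≤ m + 1 + j by omega)
  have a2 := hh_mono (show m ≤ m + 1 + j by omega)
  have a3 := hh_mono (show m + 1 ≤ m + 1 + j by omega)
  have b1 := two_hh (m + 1 + j)
  have b2 := two_hh j
  have b3 := two_hh m
  have b4 := two_hh (m + 1)
  simp only [Nat.add_sub_cancel_left, Nat.add_sub_cancel]
  zify [show 2 * hh j ≤ 2 * hh (m + 1 + j) by omega, show 2 * hh m ≤ 2 * hh (m + 1 + j) by omega,
    show 2 * hh (m + 1) ≤ 2 * hh (m + 1 + j) by omega] at b1 b2 b3 b4 ⊢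
  rw [b1, b2, b3, b4]
  constructor <;> ring

lemma bil_holder {p k n l a b : ℕ} {K K₁ K₂ : ℝ} (hK : 0 ≤ K) (hK1 : 0 ≤ K₁) (hl : 1 ≤ l)
    (hlk : l < k) (h1 : Bil p k n (k - l) b a K₁) (h2 : Bil p k n (l - 1) a b K₂)
    (h : K₁ * K₂ ^ (k - l) ≤ K ^ (k - l + 1)) : Bil p k n l a b K := by
  intro G _ w F τ T T' i i' x y hw hi hT hT' hd hx hy h4 h5
  have B1 := h1 G w F τ T' T i' i y x hw (by rwa [union_comm]) hT' hT
    (fun hc => hd (by simpa using (dvd_neg.2 hc))) hy hx h5 h4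
  have B2 := h2 G w F τ T T' i i' x y hw hi hT hT' hd hx hy h4 h5
  obtain ⟨i1, i2⟩ := hh_identity hl hlk
  have pw : ∀ X Y : ℝ, (Y ^ (2 * hh (k - l)) * X ^ (2 * hh k - 2 * hh (k - l))) *
      (X ^ (2 * hh (l - 1)) * Y ^ (2 * hh k - 2 * hh (l - 1))) ^ (k - l) =
      (X ^ (2 * hh l) * Y ^ (2 * hh k - 2 * hh l)) ^ (k - l + 1) := by
    intro X Y
    rw [mul_pow, mul_pow, ← pow_mul, ← pow_mul, ← pow_mul, ← pow_mul, mul_comm (2 * hh l),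
      mul_comm (2 * hh k - 2 * hh l), ← i1, ← i2, pow_add, pow_add, mul_comm (k - l),
      mul_comm (k - l)]
    ring
  have key := holder_nat (univ : Finset G) w
    (fun g => ‖∑ t ∈ T', F t g‖ ^ (2 * hh (k - l)) *
      ‖∑ t ∈ T, F t g‖ ^ (2 * hh k - 2 * hh (k - l)))
    (fun g => ‖∑ t ∈ T, F t g‖ ^ (2 * hh (l - 1)) *
      ‖∑ t ∈ T', F t g‖ ^ (2 * hh k - 2 * hh (l - 1)))
    (fun g => ‖∑ t ∈ T, F t g‖ ^ (2 * hh l) * ‖∑ t ∈ T', F t g‖ ^ (2 * hh k - 2 * hh l))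
    (fun g _ => hw g) (fun g _ => by positivity) (fun g _ => by positivity)
    (fun g _ => by positivity) (A := 1) (B := k - l) le_rfl (by omega)
    (fun g _ => by rw [pow_one, pw, add_comm 1])
  rw [pow_one, add_comm 1] at key
  refine le_of_pow_le_pow_left₀ (n := k - l + 1) (by omega) (by positivity) (key.trans ?_)
  have nn : 0 ≤ ∑ g, w g * (‖∑ t ∈ T, F t g‖ ^ (2 * hh (l - 1)) *
      ‖∑ t ∈ T', F t g‖ ^ (2 * hh k - 2 * hh (l - 1))) :=
    sum_nonneg fun g _ => mul_nonneg (hw g) (by positivity)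
  calc _ ≤ (K₁ * (y ^ (2 * hh (k - l)) * x ^ (2 * hh k - 2 * hh (k - l)))) *
        (K₂ * (x ^ (2 * hh (l - 1)) * y ^ (2 * hh k - 2 * hh (l - 1)))) ^ (k - l) := by
        gcongr
    _ = (K₁ * K₂ ^ (k - l)) * (x ^ (2 * hh l) * y ^ (2 * hh k - 2 * hh l)) ^ (k - l + 1) := by
        rw [← pw]; ring
    _ ≤ _ := by rw [mul_pow K]; gcongr

lemma bil_split_left {p k n l a a' b : ℕ} {K : ℝ} (hp : 1 ≤ p) (hK : 0 ≤ K) (hl : 1 ≤ l)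
    (ha0 : 1 ≤ a) (ha : a ≤ a') (han : a' ≤ n) (h : Bil p k n l a' b K) :
    Bil p k n l a b ((p : ℝ) ^ (a' * (2 * hh l)) * K) := by
  intro G _ w F τ T T' i i' x y hw hi hT hT' hd hx hy h4 h5
  have hl' := hh_pos hl
  have hp' : (1 : ℝ) ≤ p := by exact_mod_cast hp
  have hcl : ∀ U ∈ cls τ (p ^ a') T, ∑ g, w g * (‖∑ t ∈ U, F t g‖ ^ (2 * hh l) *
      ‖∑ t ∈ T', F t g‖ ^ (2 * hh k - 2 * hh l)) ≤
      K * (x ^ (2 * hh l) * y ^ (2 * hh k - 2 * hh l)) := by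
    intro U hU
    obtain ⟨t0, ht0⟩ := cls_nonempty hU
    have hUT : U ⊆ T := cls_subset hU
    have hcase : (p : ℤ) ∣ τ t0 - i :=
      (dvd_pow_self (p : ℤ) (by omega)).trans (hT t0 (hUT ht0))
    refine h G w F τ U T' (τ t0) i' x y hw (hi.mono (union_subset_union_left hUT))
      (fun t ht => by have := cls_dvd hU ht ht0; push_cast at this; exact this) hT'
      (fun hc => hd ?_) hx hy (le_trans ?_ h4) h5
    · have := dvd_sub hc hcase; simpa using this
    · have := dsum_cls_le hw F (2 * hh k) τ (pow_dvd_pow p han) hU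
      have := dsum_nonneg hw F (2 * hh k) τ (p ^ n) U
      gcongr
  have hcard : ((cls τ (p ^ a') T).card : ℝ) ≤ (p : ℝ) ^ a' := by
    exact_mod_cast card_cls_le (by positivity) T
  have hpt : ∀ g, ‖∑ t ∈ T, F t g‖ ^ (2 * hh l) ≤
      ((cls τ (p ^ a') T).card : ℝ) ^ (2 * hh l - 1) *
        ∑ U ∈ cls τ (p ^ a') T, ‖∑ t ∈ U, F t g‖ ^ (2 * hh l) := by
    intro g
    rw [sum_cls τ (p ^ a') T]
    exact pow_sum_le_card _ _ (by omega)
  calc _ ≤ ∑ g, w g * ((((cls τ (p ^ a') T).card : ℝ) ^ (2 * hh l - 1) *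
        ∑ U ∈ cls τ (p ^ a') T, ‖∑ t ∈ U, F t g‖ ^ (2 * hh l)) *
          ‖∑ t ∈ T', F t g‖ ^ (2 * hh k - 2 * hh l)) := by
        gcongr with g
        · exact hw g
        · exact hpt g
    _ = ((cls τ (p ^ a') T).card : ℝ) ^ (2 * hh l - 1) * ∑ U ∈ cls τ (p ^ a') T,
        ∑ g, w g * (‖∑ t ∈ U, F t g‖ ^ (2 * hh l) *
          ‖∑ t ∈ T', F t g‖ ^ (2 * hh k - 2 * hh l)) := by
        rw [sum_comm, mul_sum]
        apply sum_congr rfl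
        intro g _
        simp only [mul_sum, sum_mul]
        apply sum_congr rfl
        intro U _
        ring
    _ ≤ ((cls τ (p ^ a') T).card : ℝ) ^ (2 * hh l - 1) * ∑ U ∈ cls τ (p ^ a') T,
        (K * (x ^ (2 * hh l) * y ^ (2 * hh k - 2 * hh l))) := by
        gcongr with U hU
        exact hcl U hU
    _ = ((cls τ (p ^ a') T).card : ℝ) ^ (2 * hh l) *
          (K * (x ^ (2 * hh l) * y ^ (2 * hh k - 2 * hh l))) := by
        rw [sum_const, nsmul_eq_mul, ← mul_assoc, ← pow_succ, Nat.sub_add_cancel (by omega)]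
    _ ≤ _ := by
        rw [pow_mul (p : ℝ) a' (2 * hh l), mul_assoc]
        gcongr

lemma bil_split_right {p k n l a b b' : ℕ} {K : ℝ} (hp : 1 ≤ p) (hK : 0 ≤ K) (hlk : l < k)
    (hb0 : 1 ≤ b) (hb : b ≤ b') (hbn : b' ≤ n) (h : Bil p k n l a b' K) :
    Bil p k n l a b ((p : ℝ) ^ (b' * (2 * hh k - 2 * hh l)) * K) := by
  intro G _ w F τ T T' i i' x y hw hi hT hT' hd hx hy h4 h5
  have hlk' := hh_lt hlk
  have hp' : (1 : ℝ) ≤ p := by exact_mod_cast hp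
  have hcl : ∀ U ∈ cls τ (p ^ b') T', ∑ g, w g * (‖∑ t ∈ T, F t g‖ ^ (2 * hh l) *
      ‖∑ t ∈ U, F t g‖ ^ (2 * hh k - 2 * hh l)) ≤
      K * (x ^ (2 * hh l) * y ^ (2 * hh k - 2 * hh l)) := by
    intro U hU
    obtain ⟨t0, ht0⟩ := cls_nonempty hU
    have hUT : U ⊆ T' := cls_subset hU
    have hcase : (p : ℤ) ∣ τ t0 - i' :=
      (dvd_pow_self (p : ℤ) (by omega)).trans (hT' t0 (hUT ht0))
    refine h G w F τ T U i (τ t0) x y hw (hi.mono (union_subset_union_right hUT)) hT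
      (fun t ht => by have := cls_dvd hU ht ht0; push_cast at this; exact this)
      (fun hc => hd ?_) hx hy h4 (le_trans ?_ h5)
    · have := dvd_add hc hcase; simpa using this
    · have := dsum_cls_le hw F (2 * hh k) τ (pow_dvd_pow p hbn) hU
      have := dsum_nonneg hw F (2 * hh k) τ (p ^ n) U
      gcongr
  have hcard : ((cls τ (p ^ b') T').card : ℝ) ≤ (p : ℝ) ^ b' := by
    exact_mod_cast card_cls_le (by positivity) T'
  have hpt : ∀ g, ‖∑ t ∈ T', F t g‖ ^ (2 * hh k - 2 * hh l) ≤
      ((cls τ (p ^ b') T').card : ℝ) ^ (2 * hh k - 2 * hh l - 1) *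
        ∑ U ∈ cls τ (p ^ b') T', ‖∑ t ∈ U, F t g‖ ^ (2 * hh k - 2 * hh l) := by
    intro g
    rw [sum_cls τ (p ^ b') T']
    exact pow_sum_le_card _ _ (by omega)
  calc _ ≤ ∑ g, w g * (‖∑ t ∈ T, F t g‖ ^ (2 * hh l) *
        (((cls τ (p ^ b') T').card : ℝ) ^ (2 * hh k - 2 * hh l - 1) *
        ∑ U ∈ cls τ (p ^ b') T', ‖∑ t ∈ U, F t g‖ ^ (2 * hh k - 2 * hh l))) := by
        gcongr with g
        · exact hw g
        · exact hpt g
    _ = ((cls τ (p ^ b') T').card : ℝ) ^ (2 * hh k - 2 * hh l - 1) * ∑ U ∈ cls τ (p ^ b') T',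
        ∑ g, w g * (‖∑ t ∈ T, F t g‖ ^ (2 * hh l) *
          ‖∑ t ∈ U, F t g‖ ^ (2 * hh k - 2 * hh l)) := by
        rw [sum_comm, mul_sum]
        apply sum_congr rfl
        intro g _
        simp only [mul_sum]
        apply sum_congr rfl
        intro U _
        ring
    _ ≤ ((cls τ (p ^ b') T').card : ℝ) ^ (2 * hh k - 2 * hh l - 1) * ∑ U ∈ cls τ (p ^ b') T',
        (K * (x ^ (2 * hh l) * y ^ (2 * hh k - 2 * hh l))) := by
        gcongr with U hU
        exact hcl U hU
    _ = ((cls τ (p ^ b') T').card : ℝ) ^ (2 * hh k - 2 * hh l) *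
          (K * (x ^ (2 * hh l) * y ^ (2 * hh k - 2 * hh l))) := by
        rw [sum_const, nsmul_eq_mul, ← mul_assoc, ← pow_succ, Nat.sub_add_cancel (by omega)]
    _ ≤ _ := by
        rw [pow_mul (p : ℝ) b' (2 * hh k - 2 * hh l), mul_assoc]
        gcongr

end VinogradovMean

namespace VinogradovMean
open Polynomial

/-- A polynomial of prescribed derivative over a ring where `1, …, k` are units. -/
lemma exists_antideriv {A : Type*} [CommRing A] {k : ℕ}
    (hu : ∀ j : ℕ, 1 ≤ j → j ≤ k → IsUnit (j : A)) (W : A[X]) (hW : W.natDegree < k) :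
    ∃ Q : A[X], Q.natDegree ≤ k ∧ derivative Q = W := by
  choose! v hv using fun (j : ℕ) (h1 : 1 ≤ j) (h2 : j ≤ k) => (hu j h1 h2).exists_right_inv
  refine ⟨∑ j ∈ range k, C (W.coeff j * v (j + 1)) * X ^ (j + 1), ?_, ?_⟩
  · apply natDegree_sum_le_of_forall_le
    intro j hj
    refine (natDegree_C_mul_X_pow_le _ _).trans ?_
    simp at hj; omega
  · rw [derivative_sum]
    conv_rhs => rw [W.as_sum_range_C_mul_X_pow' hW]
    apply sum_congr rfl
    intro j hj
    simp at hj
    rw [derivative_C_mul_X_pow]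
    congr 2
    have := hv (j + 1) (by omega) (by omega)
    rw [mul_assoc, mul_comm (v _), this, mul_one]

/-- If the derivative of `Q` is `D` modulo `(X - i) ^ r`, then the Taylor coefficients of `Q`
of orders `1, …, r` at `i` are determined. -/
lemma taylor_of_derivative {A : Type*} [CommRing A] {k r : ℕ}
    (hu : ∀ j : ℕ, 1 ≤ j → j ≤ k → IsUnit (j : A)) (hrk : r ≤ k) (Q R : A[X]) (i : A)
    (hQ : (X - C i) ^ r ∣ derivative Q - derivative R) :
    ∃ (c : A) (H : A[X]), Q = R + C c + (X - C i) ^ (r + 1) * H := by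
  set Z := Q - R with hZ
  rw [← derivative_sub, ← hZ] at hQ
  have h1 : X ^ (r + 1) ∣ taylor i Z - C ((taylor i Z).coeff 0) := by
    rw [X_pow_dvd_iff]
    intro d hd
    rcases Nat.eq_zero_or_pos d with rfl | hd0
    · simp
    obtain ⟨m, rfl⟩ : ∃ m, d = m + 1 := ⟨d - 1, by omega⟩
    rw [coeff_sub, coeff_C_succ, sub_zero]
    have h2 : X ^ r ∣ derivative (taylor i Z) := by
      obtain ⟨H, hH⟩ := hQ
      have : derivative (taylor i Z) = taylor i (derivative Z) := by
        simp [taylor_apply, derivative_comp]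
      rw [this, hH]
      refine ⟨taylor i H, ?_⟩
      simp [taylor_mul, taylor_pow]
    rw [X_pow_dvd_iff] at h2
    have h3 := h2 m (by omega)
    rw [coeff_derivative] at h3
    have h4 := hu (m + 1) (by omega) (by omega)
    push_cast at h4
    exact (h4.mul_left_eq_zero).1 h3
  obtain ⟨H, hH⟩ := h1
  refine ⟨(taylor i Z).coeff 0, taylor (-i) H, ?_⟩
  have h5 : taylor (-i) (taylor i Z) = Z := by
    simp [taylor_taylor]
  have h6 : taylor i Z = C ((taylor i Z).coeff 0) + X ^ (r + 1) * H := by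
    rw [← hH]; ring
  have h7 := h5
  rw [h6] at h7
  simp [taylor_mul, taylor_pow] at h7
  have : Q = R + Z := by rw [hZ]; ring
  rw [this, ← h7]
  simp [sub_eq_add_neg, add_assoc]

lemma exists_interp_zmod {N k l : ℕ} [NeZero N] (hu : ∀ j : ℕ, 1 ≤ j → j ≤ k → IsUnit (j : ZMod N))
    (hl : 1 ≤ l) (hlk : l < k) (i i' : ZMod N) (hii : IsUnit (i - i')) (R : (ZMod N)[X]) :
    ∃ (Q : (ZMod N)[X]) (c c' : ZMod N) (H H' : (ZMod N)[X]), Q.natDegree ≤ k ∧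
      Q = R + C c + (X - C i) ^ (l + 1) * H ∧ Q = C c' + (X - C i') ^ (k - l + 1) * H' := by
  rcases subsingleton_or_nontrivial (ZMod N) with hs | hn
  · refine ⟨0, 0, 0, 0, 0, by simp, Subsingleton.elim _ _, Subsingleton.elim _ _⟩
  have hco : IsCoprime ((X - C i) ^ l) ((X - C i') ^ (k - l)) :=
    (isCoprime_X_sub_C_of_isUnit_sub hii).pow
  obtain ⟨u, v, huv⟩ := hco
  set M := (X - C i) ^ l * (X - C i') ^ (k - l) with hM
  have hMm : M.Monic := ((monic_X_sub_C i).pow l).mul ((monic_X_sub_C i').pow (k - l))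
  have hMd : M.natDegree = k := by
    rw [hM, Monic.natDegree_mul ((monic_X_sub_C i).pow l) ((monic_X_sub_C i').pow (k - l)),
      Monic.natDegree_pow (monic_X_sub_C i), Monic.natDegree_pow (monic_X_sub_C i'),
      natDegree_X_sub_C, natDegree_X_sub_C]
    omega
  set W0 := derivative R * (v * (X - C i') ^ (k - l)) with hW0
  set W := W0 %ₘ M with hW
  have hdiv : W + M * (W0 /ₘ M) = W0 := modByMonic_add_div W0 M
  have hWd : W.natDegree < k := by
    rw [← hMd]
    exact natDegree_modByMonic_lt _ hMm (by intro h; rw [h] at hMd; simp at hMd; omega)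
  obtain ⟨Q, hQd, hQ⟩ := exists_antideriv hu W hWd
  have d1 : (X - C i) ^ l ∣ derivative Q - derivative R := by
    refine ⟨-derivative R * u - (X - C i') ^ (k - l) * (W0 /ₘ M), ?_⟩
    rw [hQ]
    have : W = W0 - M * (W0 /ₘ M) := eq_sub_of_add_eq hdiv
    rw [this]
    linear_combination derivative R * huv
  have d2 : (X - C i') ^ (k - l) ∣ derivative Q - derivative 0 := by
    refine ⟨derivative R * v - (X - C i) ^ l * (W0 /ₘ M), ?_⟩
    rw [hQ]
    have : W = W0 - M * (W0 /ₘ M) := eq_sub_of_add_eq hdiv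
    rw [this, derivative_zero, sub_zero]
    ring
  obtain ⟨c, H, h1⟩ := taylor_of_derivative hu hlk.le Q R i d1
  obtain ⟨c', H', h2⟩ := taylor_of_derivative hu (by omega : k - l ≤ k) Q 0 i' d2
  exact ⟨Q, c, c', H, H', hQd, h1, by rw [zero_add] at h2; exact h2⟩

/-- Hermite interpolation modulo `N`: an integer polynomial of degree `≤ k` which is `(x - i) ^ r`
to order `l` at `i` and constant to order `k - l` at `i'`, up to constants and modulo `N`. -/
lemma exists_interp {N k l : ℕ} [NeZero N] (hu : ∀ j : ℕ, 1 ≤ j → j ≤ k → IsUnit (j : ZMod N))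
    (hl : 1 ≤ l) (hlk : l < k) (i i' : ℤ) (hii : IsUnit ((i : ZMod N) - (i' : ZMod N))) (r : ℕ) :
    ∃ (Q : ℤ[X]) (c c' : ℤ), Q.natDegree ≤ k ∧
      (∀ x, ∃ h : ℤ, (N : ℤ) ∣ Q.eval x - ((x - i) ^ r + c + (x - i) ^ (l + 1) * h)) ∧
      (∀ x, ∃ h : ℤ, (N : ℤ) ∣ Q.eval x - (c' + (x - i') ^ (k - l + 1) * h)) := by
  obtain ⟨Q, c, c', H, H', hd, h1, h2⟩ := exists_interp_zmod
    hu hl hlk i i' hii ((X - C (i : ZMod N)) ^ r)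
  have hsurj : Function.Surjective (Int.castRingHom (ZMod N)) := ZMod.intCast_surjective
  have lift : ∀ P : (ZMod N)[X], ∃ P' : ℤ[X], P'.map (Int.castRingHom (ZMod N)) = P ∧
      P'.natDegree ≤ P.natDegree := by
    intro P
    obtain ⟨q, hq, hq'⟩ := exists_natDegree_eq_of_mem_lifts
      ((mem_lifts P).2 (map_surjective _ hsurj P))
    exact ⟨q, hq, hq'.le⟩
  obtain ⟨Q', hQ', hQd⟩ := lift Q
  obtain ⟨H1, hH1, -⟩ := lift H
  obtain ⟨H2, hH2, -⟩ := lift H'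
  obtain ⟨c1, hc1⟩ := hsurj c
  obtain ⟨c2, hc2⟩ := hsurj c'
  have ev : ∀ (P : ℤ[X]) (x : ℤ), ((P.eval x : ℤ) : ZMod N) =
      (P.map (Int.castRingHom (ZMod N))).eval (x : ZMod N) := by
    intro P x
    simp
  refine ⟨Q', c1, c2, hQd.trans hd, fun x => ⟨H1.eval x, ?_⟩, fun x => ⟨H2.eval x, ?_⟩⟩
  · rw [← ZMod.intCast_zmod_eq_zero_iff_dvd]
    push_cast
    rw [ev, ev, hQ', hH1, h1]
    simp at hc1
    simp [hc1]
  · rw [← ZMod.intCast_zmod_eq_zero_iff_dvd]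
    push_cast
    rw [ev, ev, hQ', hH2, h2]
    simp at hc2
    simp [hc2]

lemma nrm_mul_weight {G : Type} [Fintype G] (w : G → ℝ) (F : ℤ → G → ℂ) (T' : Finset ℤ) (P Q : ℕ)
    (U : Finset ℤ) :
    nrm (fun g => w g * ‖∑ t ∈ T', F t g‖ ^ Q) F P U =
      ∑ g, w g * (‖∑ t ∈ U, F t g‖ ^ P * ‖∑ t ∈ T', F t g‖ ^ Q) := by
  unfold nrm
  apply sum_congr rfl
  intro g _
  ring

/-- The lower degree phases available on a residue class modulo `p ^ a` that leave the
modulus of the sum over a residue class modulo `p ^ b` invariant. -/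
lemma PhaseInv.lower {p k n l a b m : ℕ} (hp : p.Prime) (hpk : k < p) (hl : 1 ≤ l) (hlk : l < k)
    (ham : a ≤ m) (hmn : m ≤ n) (h1 : l * m ≤ a * (l + 1)) (h2 : l * m ≤ b * (k - l + 1))
    {G : Type} [Fintype G] {w : G → ℝ} {F : ℤ → G → ℂ} {τ : ℤ → ℤ} {T T' : Finset ℤ}
    (hi : PhaseInv p k (k * n) w F τ (T ∪ T')) {i i' : ℤ}
    (hT : ∀ t ∈ T, (p : ℤ) ^ a ∣ τ t - i) (hT' : ∀ t ∈ T', (p : ℤ) ^ b ∣ τ t - i')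
    (hd : ¬ (p : ℤ) ∣ i - i') (Q : ℕ) :
    PhaseInv p l (l * (m - a)) (fun g => w g * ‖∑ t ∈ T', F t g‖ ^ Q) F
      (fun t => (τ t - i) / (p : ℤ) ^ a) T := by
  intro ψ hψ
  have hp0 : 0 < p := hp.pos
  have : NeZero (p ^ (k * n)) := ⟨by positivity⟩
  have hu : ∀ j : ℕ, 1 ≤ j → j ≤ k → IsUnit (j : ZMod (p ^ (k * n))) := by
    intro j hj hjk
    rw [ZMod.isUnit_iff_coprime]
    apply Nat.Coprime.pow_right
    rw [Nat.coprime_comm, hp.coprime_iff_not_dvd]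
    intro h
    have := Nat.le_of_dvd (by omega) h
    omega
  have hii : IsUnit ((i : ZMod (p ^ (k * n))) - (i' : ZMod (p ^ (k * n)))) := by
    rw [← Int.cast_sub]
    have hco : IsCoprime (i - i') ((p ^ (k * n) : ℕ) : ℤ) := by
      push_cast
      apply IsCoprime.pow_right
      rw [isCoprime_comm]
      exact (Prime.coprime_iff_not_dvd (Nat.prime_iff_prime_int.1 hp)).2 hd
    obtain ⟨u, v, huv⟩ := hco
    refine IsUnit.of_mul_eq_one (u : ZMod (p ^ (k * n))) ?_
    have := congrArg (Int.cast : ℤ → ZMod (p ^ (k * n))) huv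
    rw [Int.cast_add, Int.cast_mul, Int.cast_mul, Int.cast_natCast, ZMod.natCast_self] at this
    simp only [mul_zero, add_zero, Int.cast_one] at this
    linear_combination this
  choose Q0 c0 c0' hQd hQ1 hQ2 using exists_interp (N := p ^ (k * n)) hu hl hlk i i' hii
  choose g1 hg1 using hQ1
  choose g2 hg2 using hQ2
  set E : ℕ → ℕ := fun r => k * n - (l * (m - a) + a * r) with hE
  have hEr : ∀ r ≤ l, E r + (l * (m - a) + a * r) = k * n := by
    intro r hr
    apply Nat.sub_add_cancel
    obtain ⟨j, rfl⟩ : ∃ j, m = a + j := ⟨m - a, by omega⟩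
    rw [Nat.add_sub_cancel_left]
    nlinarith [Nat.mul_le_mul hlk.le hmn, Nat.mul_le_mul_left a hr]
  set Ψ : ℤ[X] := ∑ r ∈ range (l + 1), C (ψ.coeff r * (p : ℤ) ^ E r) * Q0 r with hΨ
  have hΨe : ∀ x, Ψ.eval x = ∑ r ∈ range (l + 1), ψ.coeff r * (p : ℤ) ^ E r * (Q0 r).eval x := by
    intro x
    rw [hΨ, eval_finsetSum]
    simp
  obtain ⟨σ, c, hc, hw, hF⟩ := hi Ψ (by
    apply natDegree_sum_le_of_forall_le
    intro r _
    exact (natDegree_C_mul_le _ _).trans (hQd r))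
  set K1 : ℤ := ∑ r ∈ range (l + 1), ψ.coeff r * (p : ℤ) ^ E r * c0 r with hK1
  set K2 : ℤ := ∑ r ∈ range (l + 1), ψ.coeff r * (p : ℤ) ^ E r * c0' r with hK2
  have hpr : (p : ℝ) ≠ 0 := by positivity
  have red : ∀ x y : ℤ, (p : ℤ) ^ (k * n) ∣ x - y →
      e ((x : ℝ) / (p : ℝ) ^ (k * n)) = e ((y : ℝ) / (p : ℝ) ^ (k * n)) := by
    rintro x y ⟨z, hz⟩
    have : (x : ℝ) = y + (p : ℝ) ^ (k * n) * z := by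
      have h3 : x = y + (p : ℤ) ^ (k * n) * z := by linarith
      exact_mod_cast congrArg (Int.cast : ℤ → ℝ) h3
    rw [this, add_div, mul_div_cancel_left₀ _ (by positivity), e_add, e_int, mul_one]
  have hS' : ∀ g, ‖∑ t ∈ T', F t (σ g)‖ = ‖∑ t ∈ T', F t g‖ := by
    intro g
    have : ∑ t ∈ T', F t (σ g) =
        (c g * e ((K2 : ℝ) / (p : ℝ) ^ (k * n))) * ∑ t ∈ T', F t g := by
      rw [mul_sum]
      apply sum_congr rfl
      intro t ht
      rw [hF t (mem_union_right _ ht) g, red (Ψ.eval (τ t)) K2]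
      rw [hΨe, hK2, ← sum_sub_distrib]
      apply dvd_sum
      intro r hr
      have hr' : r ≤ l := by simp at hr; omega
      have q1 := hg2 r (τ t)
      push_cast at q1
      have q2 : (p : ℤ) ^ (k * n) ∣ (p : ℤ) ^ E r * (τ t - i') ^ (k - l + 1) := by
        obtain ⟨u, hu'⟩ := hT' t ht
        rw [hu', mul_pow, ← pow_mul, ← mul_assoc, ← pow_add]
        refine Dvd.dvd.mul_right (pow_dvd_pow _ ?_) _
        have := hEr r hr'
        obtain ⟨j, rfl⟩ : ∃ j, m = a + j := ⟨m - a, by omega⟩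
        rw [Nat.add_sub_cancel_left] at this
        nlinarith [Nat.mul_le_mul_left a hr']
      obtain ⟨z1, hz1⟩ := q1
      obtain ⟨z2, hz2⟩ := q2
      refine ⟨ψ.coeff r * (p : ℤ) ^ E r * z1 + ψ.coeff r * g2 r (τ t) * z2, ?_⟩
      linear_combination ψ.coeff r * (p : ℤ) ^ E r * hz1 + ψ.coeff r * g2 r (τ t) * hz2
    rw [this, norm_mul, norm_mul, hc, norm_e, one_mul, one_mul]
  refine ⟨σ, fun g => c g * e ((K1 : ℝ) / (p : ℝ) ^ (k * n)), ?_, ?_, ?_⟩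
  · intro g; rw [norm_mul, hc, norm_e, one_mul]
  · intro g; simp only [hw, hS']
  intro t ht g
  rw [hF t (mem_union_left _ ht) g]
  congr 1
  rw [mul_assoc, ← e_add]
  congr 1
  have hpa : (p : ℤ) ^ a ≠ 0 := by positivity
  obtain ⟨u, hu'⟩ := hT t ht
  simp only [hu', Int.mul_ediv_cancel_left _ hpa]
  have : (K1 : ℝ) / (p : ℝ) ^ (k * n) + ((ψ.eval u : ℤ) : ℝ) / (p : ℝ) ^ (l * (m - a)) =
      ((K1 + (p : ℤ) ^ (k * n - l * (m - a)) * ψ.eval u : ℤ) : ℝ) / (p : ℝ) ^ (k * n) := by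
    have h0 := hEr 0 (by omega)
    have h3 : k * n = (k * n - l * (m - a)) + l * (m - a) := by omega
    have h4 : (p : ℝ) ^ (k * n) = (p : ℝ) ^ (k * n - l * (m - a)) * (p : ℝ) ^ (l * (m - a)) := by
      rw [← pow_add, ← h3]
    have : (p : ℝ) ^ (k * n - l * (m - a)) ≠ 0 := by positivity
    have : (p : ℝ) ^ (l * (m - a)) ≠ 0 := by positivity
    push_cast
    rw [h4]
    field_simp
  rw [this]
  apply red
  rw [hΨe, hK1, eval_eq_sum_range' (n := l + 1) (by omega), mul_sum, ← sum_add_distrib,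
    ← sum_sub_distrib]
  apply dvd_sum
  intro r hr
  have hr' : r ≤ l := by simp at hr; omega
  have q1 := hg1 r (τ t)
  push_cast at q1
  rw [hu'] at q1
  have q2 : (p : ℤ) ^ (k * n) ∣ (p : ℤ) ^ E r * ((p : ℤ) ^ a * u) ^ (l + 1) := by
    rw [mul_pow, ← pow_mul, ← mul_assoc, ← pow_add]
    refine Dvd.dvd.mul_right (pow_dvd_pow _ ?_) _
    have := hEr r hr'
    obtain ⟨j, rfl⟩ : ∃ j, m = a + j := ⟨m - a, by omega⟩
    rw [Nat.add_sub_cancel_left] at this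
    nlinarith [Nat.mul_le_mul_left a hr']
  have q3 : (p : ℤ) ^ (k * n - l * (m - a)) * u ^ r = (p : ℤ) ^ E r * ((p : ℤ) ^ a * u) ^ r := by
    rw [mul_pow, ← pow_mul, ← mul_assoc, ← pow_add]
    congr 2
    have := hEr r hr'
    omega
  obtain ⟨z1, hz1⟩ := q1
  obtain ⟨z2, hz2⟩ := q2
  refine ⟨ψ.coeff r * (p : ℤ) ^ E r * z1 + ψ.coeff r * g1 r (τ t) * z2, ?_⟩
  linear_combination ψ.coeff r * (p : ℤ) ^ E r * hz1 + ψ.coeff r * g1 r (τ t) * hz2 -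
    ψ.coeff r * q3

end VinogradovMean

namespace VinogradovMean

lemma power_mean_aux {ι : Type*} (s : Finset ι) (z : ι → ℝ) (hz : ∀ U ∈ s, 0 ≤ z U) {N : ℝ}
    (hN : 1 ≤ N) (hs : (s.card : ℝ) ≤ N) {h m : ℕ} (hm : 1 ≤ m) (hmh : m < h) {x : ℝ} (hx : 0 ≤ x)
    (hsum : N ^ (h - 1) * ∑ U ∈ s, z U ^ h ≤ x ^ h) :
    N ^ (m - 1) * ∑ U ∈ s, z U ^ m ≤ x ^ m := by
  have key := holder_nat s (fun _ => 1) (fun U => z U ^ h) (fun _ => 1) (fun U => z U ^ m)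
    (fun _ _ => by norm_num) (fun U hU => pow_nonneg (hz U hU) _) (fun _ _ => by norm_num)
    (fun U hU => pow_nonneg (hz U hU) _) (A := m) (B := h - m) hm (by omega) (fun U hU => by
      rw [Nat.add_sub_cancel' hmh.le, one_pow, mul_one, ← pow_mul, ← pow_mul, mul_comm])
  simp only [one_mul, Nat.add_sub_cancel' hmh.le, sum_const, nsmul_eq_mul, mul_one] at key
  have hS : 0 ≤ ∑ U ∈ s, z U ^ h := sum_nonneg fun U hU => pow_nonneg (hz U hU) _
  refine le_of_pow_le_pow_left₀ (n := h) (by omega) (by positivity) ?_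
  calc _ = (N ^ (m - 1)) ^ h * (∑ U ∈ s, z U ^ m) ^ h := by rw [mul_pow]
    _ ≤ (N ^ (m - 1)) ^ h * ((∑ U ∈ s, z U ^ h) ^ m * N ^ (h - m)) := by
        refine mul_le_mul_of_nonneg_left (key.trans ?_) (by positivity)
        gcongr
    _ = (N ^ (h - 1) * ∑ U ∈ s, z U ^ h) ^ m := by
        rw [mul_pow, ← pow_mul, ← pow_mul]
        have : (h - 1) * m = (m - 1) * h + (h - m) := by
          obtain ⟨j, rfl⟩ : ∃ j, m = j + 1 := ⟨m - 1, by omega⟩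
          obtain ⟨i, rfl⟩ : ∃ i, h = j + 1 + i := ⟨h - (j + 1), by omega⟩
          have e1 : j + 1 + i - 1 = j + i := by omega
          have e2 : j + 1 + i - (j + 1) = i := by omega
          rw [e1, e2, Nat.add_sub_cancel]
          ring
        rw [this, pow_add]
        ring
    _ ≤ (x ^ h) ^ m := by gcongr
    _ = _ := by rw [← pow_mul, ← pow_mul, mul_comm]

lemma bil_lower {p k n l a b m : ℕ} {K K₁ : ℝ} (hp : p.Prime) (hpk : k < p) (hK : 0 ≤ K)
    (hK1 : 0 ≤ K₁) (hl : 1 ≤ l) (hlk : l < k) (ha : 1 ≤ a)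
    (ham : a ≤ m) (hmn : m ≤ n) (h1 : l * m ≤ a * (l + 1)) (h2 : l * m ≤ b * (k - l + 1))
    (hD : Dec p l (m - a) K₁) (hB : Bil p k n l m b K) : Bil p k n l a b (K₁ * K) := by
  intro G _ w F τ T T' i i' x y hw hi hT hT' hd hx hy h4 h5
  have hp1 : 1 ≤ p := hp.one_lt.le
  have hpr : (1 : ℝ) ≤ p := by exact_mod_cast hp1
  have hl' := hh_pos hl
  have hlk' := hh_lt hlk
  have hw' : ∀ g, 0 ≤ w g * ‖∑ t ∈ T', F t g‖ ^ (2 * hh k - 2 * hh l) :=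
    fun g => mul_nonneg (hw g) (by positivity)
  have main := hD G _ F _ T hw' (hi.lower hp hpk hl hlk ham hmn h1 h2 hT hT' hd
    (2 * hh k - 2 * hh l))
  rw [dsum_shift _ F _ hp1 τ a (m - a) i hT, Nat.add_sub_cancel' ham, nrm_mul_weight] at main
  refine main.trans ?_
  have hpm : (p ^ m : ℕ) ∣ p ^ n := pow_dvd_pow p hmn
  set z : Finset ℤ → ℝ := fun U =>
    ((p : ℝ) ^ ((n - m) * (hh k - 1)) * dsum w F (2 * hh k) τ (p ^ n) U) ^ ((hh k : ℝ)⁻¹) with hz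
  have hd0 : ∀ U, 0 ≤ (p : ℝ) ^ ((n - m) * (hh k - 1)) * dsum w F (2 * hh k) τ (p ^ n) U :=
    fun U => mul_nonneg (by positivity) (dsum_nonneg hw _ _ _ _ _)
  have hz0 : ∀ U, 0 ≤ z U := fun U => Real.rpow_nonneg (hd0 U) _
  have hzp : ∀ U, z U ^ hh k =
      (p : ℝ) ^ ((n - m) * (hh k - 1)) * dsum w F (2 * hh k) τ (p ^ n) U := by
    intro U
    exact Real.rpow_inv_natCast_pow (hd0 U) (by omega)
  have hU : ∀ U ∈ cls τ (p ^ m) T,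
      nrm (fun g => w g * ‖∑ t ∈ T', F t g‖ ^ (2 * hh k - 2 * hh l)) F (2 * hh l) U ≤
        K * (z U ^ hh l * y ^ (2 * hh k - 2 * hh l)) := by
    intro U hU
    rw [nrm_mul_weight]
    obtain ⟨t0, ht0⟩ := cls_nonempty hU
    have hUT : U ⊆ T := cls_subset hU
    have hcase : (p : ℤ) ∣ τ t0 - i :=
      (dvd_pow_self (p : ℤ) (by omega)).trans (hT t0 (hUT ht0))
    have h3 := hB G w F τ U T' (τ t0) i' (Real.sqrt (z U)) y hw
      (hi.mono (union_subset_union_left hUT))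
      (fun t ht => by have := cls_dvd hU ht ht0; push_cast at this; exact this) hT'
      (fun hc => hd (by have := dvd_sub hc hcase; simpa using this)) (Real.sqrt_nonneg _) hy
      (by rw [pow_mul (Real.sqrt (z U)), Real.sq_sqrt (hz0 U), hzp]) h5
    rwa [pow_mul (Real.sqrt (z U)), Real.sq_sqrt (hz0 U)] at h3
  have hcard : ((cls τ (p ^ m) T).card : ℝ) ≤ (p : ℝ) ^ (m - a) := by
    have e1 : cls (fun t => (τ t - i) / (p : ℤ) ^ a) (p ^ (m - a)) T = cls τ (p ^ m) T := by
      apply cls_congr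
      intro s hs t ht
      have hp0 : (p : ℤ) ^ a ≠ 0 := by positivity
      obtain ⟨u, hu⟩ := hT s hs
      obtain ⟨v, hv⟩ := hT t ht
      simp only [hu, hv, Int.mul_ediv_cancel_left _ hp0]
      have : τ s - τ t = (p : ℤ) ^ a * (u - v) := by linear_combination hu - hv
      rw [this]
      push_cast
      rw [show m = a + (m - a) by omega, pow_add, mul_dvd_mul_iff_left hp0,
        Nat.add_sub_cancel_left]
    rw [← e1]
    exact_mod_cast card_cls_le (by positivity) T
  have pm := power_mean_aux (cls τ (p ^ m) T) z (fun U _ => hz0 U) (one_le_pow₀ hpr) hcard hl'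
    hlk' (x := x ^ 2) (by positivity) (by
      simp only [hzp]
      rw [← mul_sum, dsum_dsum w F _ τ hpm, ← pow_mul (p : ℝ), ← mul_assoc, ← pow_add, ← add_mul,
        ← pow_mul]
      rwa [show m - a + (n - m) = n - a by omega])
  have s1 : dsum (fun g => w g * ‖∑ t ∈ T', F t g‖ ^ (2 * hh k - 2 * hh l)) F (2 * hh l) τ (p ^ m) T
      ≤ ∑ U ∈ cls τ (p ^ m) T, K * (z U ^ hh l * y ^ (2 * hh k - 2 * hh l)) := sum_le_sum hU
  calc _ ≤ K₁ * (p : ℝ) ^ ((m - a) * (hh l - 1)) *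
        ∑ U ∈ cls τ (p ^ m) T, K * (z U ^ hh l * y ^ (2 * hh k - 2 * hh l)) := by gcongr
    _ = K₁ * K * y ^ (2 * hh k - 2 * hh l) *
        (((p : ℝ) ^ (m - a)) ^ (hh l - 1) * ∑ U ∈ cls τ (p ^ m) T, z U ^ hh l) := by
        rw [← mul_sum, ← sum_mul, pow_mul]; ring
    _ ≤ K₁ * K * y ^ (2 * hh k - 2 * hh l) * (x ^ 2) ^ hh l := by gcongr
    _ = _ := by rw [← pow_mul]; ring

/-- Broad–narrow decomposition. -/
lemma broad_narrow {ι : Type*} [DecidableEq ι] (s : Finset ι) (f : ι → ℂ) {P A : ℕ}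
    (hA : A ≤ P) (hP : 1 ≤ P) :
    ‖∑ i ∈ s, f i‖ ^ P ≤ 2 ^ P * ∑ i ∈ s, ‖f i‖ ^ P +
      (s.card : ℝ) ^ (2 * P) * ∑ i ∈ s, ∑ j ∈ s.erase i, ‖f i‖ ^ A * ‖f j‖ ^ (P - A) := by
  rcases s.eq_empty_or_nonempty with rfl | hs
  · simp only [sum_empty, norm_zero, card_empty, mul_zero, add_zero]
    rw [zero_pow (by omega)]
  obtain ⟨i, hi, hmax⟩ := s.exists_max_image (fun i => ‖f i‖) hs
  have hc : (1 : ℝ) ≤ s.card := by exact_mod_cast hs.card_pos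
  have p1 : 0 ≤ ∑ i ∈ s, ∑ j ∈ s.erase i, ‖f i‖ ^ A * ‖f j‖ ^ (P - A) :=
    sum_nonneg fun i _ => sum_nonneg fun j _ => by positivity
  have p2 : 0 ≤ ∑ i ∈ s, ‖f i‖ ^ P := sum_nonneg fun i _ => by positivity
  by_cases hcase : ∀ j ∈ s.erase i, s.card * ‖f j‖ ≤ ‖f i‖
  · have h1 : ‖∑ i ∈ s, f i‖ ≤ 2 * ‖f i‖ := by
      rw [← add_sum_erase s f hi]
      refine (norm_add_le _ _).trans ?_
      rw [two_mul]
      gcongr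
      refine (norm_sum_le _ _).trans ?_
      have : ∑ j ∈ s.erase i, ‖f j‖ ≤ ∑ j ∈ s.erase i, ‖f i‖ / s.card :=
        sum_le_sum fun j hj => by
          rw [le_div_iff₀ (by positivity), mul_comm]; exact hcase j hj
      refine this.trans ?_
      rw [sum_const, nsmul_eq_mul, mul_div_assoc', div_le_iff₀ (by positivity), mul_comm]
      gcongr
      exact erase_subset _ _
    calc _ ≤ (2 * ‖f i‖) ^ P := by gcongr
      _ = 2 ^ P * ‖f i‖ ^ P := by rw [mul_pow]
      _ ≤ 2 ^ P * ∑ i ∈ s, ‖f i‖ ^ P := by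
          gcongr
          exact single_le_sum (f := fun i => ‖f i‖ ^ P) (fun j _ => by positivity) hi
      _ ≤ _ := by have : 0 ≤ (s.card : ℝ) ^ (2 * P) := by positivity
                  nlinarith
  · push Not at hcase
    obtain ⟨j, hj, hji⟩ := hcase
    have h1 : ‖∑ i ∈ s, f i‖ ≤ s.card * ‖f i‖ := by
      refine (norm_sum_le _ _).trans ?_
      rw [← nsmul_eq_mul]
      exact sum_le_card_nsmul _ _ _ hmax
    calc _ ≤ (s.card * ‖f i‖) ^ P := by gcongr
      _ = (s.card : ℝ) ^ P * (‖f i‖ ^ A * ‖f i‖ ^ (P - A)) := by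
          rw [mul_pow, ← pow_add, Nat.add_sub_cancel' hA]
      _ ≤ (s.card : ℝ) ^ P * (‖f i‖ ^ A * (s.card * ‖f j‖) ^ (P - A)) := by gcongr
      _ = (s.card : ℝ) ^ (P + (P - A)) * (‖f i‖ ^ A * ‖f j‖ ^ (P - A)) := by
          rw [mul_pow, pow_add]; ring
      _ ≤ (s.card : ℝ) ^ (2 * P) * (‖f i‖ ^ A * ‖f j‖ ^ (P - A)) := by
          refine mul_le_mul_of_nonneg_right (pow_le_pow_right₀ hc (by omega)) (by positivity)
      _ ≤ (s.card : ℝ) ^ (2 * P) *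
          ∑ i ∈ s, ∑ j ∈ s.erase i, ‖f i‖ ^ A * ‖f j‖ ^ (P - A) := by
          gcongr
          refine le_trans ?_ (single_le_sum
            (f := fun i => ∑ j ∈ s.erase i, ‖f i‖ ^ A * ‖f j‖ ^ (P - A))
            (fun i _ => sum_nonneg fun j _ => by positivity) hi)
          exact single_le_sum (f := fun j => ‖f i‖ ^ A * ‖f j‖ ^ (P - A))
            (fun j _ => by positivity) hj
      _ ≤ _ := by have : 0 ≤ 2 ^ P * ∑ i ∈ s, ‖f i‖ ^ P := by positivity
                  linarith

/-- The linear decoupling constant is controlled by the bilinear one. -/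
lemma dec_of_bil {p k n l : ℕ} {K B : ℝ} (hp : p.Prime) (hk : 2 ≤ k) (hl : l < k)
    (hn : 1 ≤ n) (hp2 : 2 ^ (2 * hh k) * 2 ≤ p) (hK : 0 ≤ K) (hB0 : 0 ≤ B)
    (hD : Dec p k (n - 1) K) (hB : Bil p k n l 1 1 B) :
    Dec p k n (K / 2 + (p : ℝ) ^ (2 * (2 * hh k) + 2) * B) := by
  intro G _ w F τ T hw hi
  have hp1 : 1 ≤ p := hp.one_lt.le
  have hpr : (1 : ℝ) ≤ p := by exact_mod_cast hp1
  have hlk' := hh_lt hl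
  have hk3 : 3 ≤ hh k := hh_mono hk
  set s := cls τ (p ^ 1) T with hs
  set D := dsum w F (2 * hh k) τ (p ^ n) T with hDdef
  have hD0 : 0 ≤ D := dsum_nonneg hw _ _ _ _ _
  set W := (p : ℝ) ^ ((n - 1) * (hh k - 1)) * D with hW
  have hW0 : 0 ≤ W := by positivity
  set x := W ^ (((2 * hh k : ℕ) : ℝ)⁻¹) with hx
  have hx0 : 0 ≤ x := Real.rpow_nonneg hW0 _
  have hxp : x ^ (2 * hh k) = W := Real.rpow_inv_natCast_pow hW0 (by omega)
  have hcard : (s.card : ℝ) ≤ p := by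
    have := card_cls_le (τ := τ) (q := p ^ 1) (by positivity) T
    rw [pow_one] at this
    rw [hs, pow_one]
    exact_mod_cast this
  have hsub : ∀ U ∈ s, (p : ℝ) ^ ((n - 1) * (hh k - 1)) * dsum w F (2 * hh k) τ (p ^ n) U ≤ W := by
    intro U hU
    have := dsum_cls_le hw F (2 * hh k) τ (pow_dvd_pow p hn) hU
    rw [hW]
    exact mul_le_mul_of_nonneg_left this (by positivity)
  have narrow : ∑ U ∈ s, nrm w F (2 * hh k) U ≤ K * W := by
    calc _ ≤ ∑ U ∈ s, K * (p : ℝ) ^ ((n - 1) * (hh k - 1)) *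
          dsum w F (2 * hh k) τ (p ^ n) U := by
          apply sum_le_sum
          intro U hU
          obtain ⟨t0, ht0⟩ := cls_nonempty hU
          exact hD.rescale hp1 hn hw (hi.mono (cls_subset hU)) (i := τ t0)
            (fun t ht => by have := cls_dvd hU ht ht0; push_cast at this; exact this)
      _ = _ := by
          rw [← mul_sum, dsum_dsum w F _ τ (pow_dvd_pow p hn), hW, mul_assoc]
  have broad : ∀ U ∈ s, ∀ V ∈ s.erase U,
      ∑ g, w g * (‖∑ t ∈ U, F t g‖ ^ (2 * hh l) * ‖∑ t ∈ V, F t g‖ ^ (2 * hh k - 2 * hh l)) ≤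
        B * W := by
    intro U hU V hV
    have hV' := mem_of_mem_erase hV
    obtain ⟨t0, ht0⟩ := cls_nonempty hU
    obtain ⟨t1, ht1⟩ := cls_nonempty hV'
    have h := hB G w F τ U V (τ t0) (τ t1) x x hw
      (hi.mono (union_subset (cls_subset hU) (cls_subset hV')))
      (fun t ht => by have := cls_dvd hU ht ht0; push_cast at this; exact this)
      (fun t ht => by have := cls_dvd hV' ht ht1; push_cast at this; exact this)
      (fun hd => by
        apply ne_of_mem_erase hV
        rw [← cls_eq_filter hU ht0, ← cls_eq_filter hV' ht1]
        apply filter_congr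
        intro r _
        rw [pow_one]
        constructor
        · intro h; have := dvd_sub h hd; simpa using this
        · intro h; have := dvd_add h hd; simpa using this)
      hx0 hx0 (by rw [hxp]; exact hsub U hU) (by rw [hxp]; exact hsub V hV')
    rwa [← pow_add, Nat.add_sub_cancel' (by omega), hxp] at h
  have pt : ∀ g, ‖∑ t ∈ T, F t g‖ ^ (2 * hh k) ≤
      2 ^ (2 * hh k) * ∑ U ∈ s, ‖∑ t ∈ U, F t g‖ ^ (2 * hh k) +
      (p : ℝ) ^ (2 * (2 * hh k)) * ∑ U ∈ s, ∑ V ∈ s.erase U,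
        ‖∑ t ∈ U, F t g‖ ^ (2 * hh l) * ‖∑ t ∈ V, F t g‖ ^ (2 * hh k - 2 * hh l) := by
    intro g
    rw [sum_cls τ (p ^ 1) T]
    refine (broad_narrow s (fun U => ∑ t ∈ U, F t g) (P := 2 * hh k) (A := 2 * hh l)
      (by omega) (by omega)).trans ?_
    gcongr
  have hBW : 0 ≤ B * W := by positivity
  calc nrm w F (2 * hh k) T ≤ ∑ g, w g * (2 ^ (2 * hh k) * ∑ U ∈ s, ‖∑ t ∈ U, F t g‖ ^ (2 * hh k) +
      (p : ℝ) ^ (2 * (2 * hh k)) * ∑ U ∈ s, ∑ V ∈ s.erase U,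
        ‖∑ t ∈ U, F t g‖ ^ (2 * hh l) * ‖∑ t ∈ V, F t g‖ ^ (2 * hh k - 2 * hh l)) :=
        sum_le_sum fun g _ => mul_le_mul_of_nonneg_left (pt g) (hw g)
    _ = 2 ^ (2 * hh k) * ∑ U ∈ s, nrm w F (2 * hh k) U +
        (p : ℝ) ^ (2 * (2 * hh k)) * ∑ U ∈ s, ∑ V ∈ s.erase U, ∑ g, w g *
        (‖∑ t ∈ U, F t g‖ ^ (2 * hh l) * ‖∑ t ∈ V, F t g‖ ^ (2 * hh k - 2 * hh l)) := by
        unfold nrm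
        rw [sum_congr rfl (fun U _ => sum_comm), sum_comm (s := s), sum_comm (s := s), mul_sum,
          mul_sum, ← sum_add_distrib]
        apply sum_congr rfl
        intro g _
        simp only [← mul_sum]
        ring
    _ ≤ 2 ^ (2 * hh k) * (K * W) + (p : ℝ) ^ (2 * (2 * hh k)) *
        ∑ U ∈ s, ∑ V ∈ s.erase U, B * W := by
        gcongr with U hU V hV
        exact broad U hU V hV
    _ ≤ 2 ^ (2 * hh k) * (K * W) + (p : ℝ) ^ (2 * (2 * hh k)) * (p * (p * (B * W))) := by
        gcongr
        calc _ ≤ ∑ U ∈ s, p * (B * W) := by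
              apply sum_le_sum
              intro U hU
              rw [sum_const, nsmul_eq_mul]
              have : ((s.erase U).card : ℝ) ≤ p := le_trans
                (by exact_mod_cast card_le_card (erase_subset _ _)) hcard
              gcongr
          _ ≤ _ := by
              rw [sum_const, nsmul_eq_mul]
              gcongr
    _ = (2 ^ (2 * hh k) * K + (p : ℝ) ^ (2 * (2 * hh k) + 2) * B) * W := by ring
    _ ≤ (p * (K / 2) + p * ((p : ℝ) ^ (2 * (2 * hh k) + 2) * B)) * W := by
        have hp3 : (2 : ℝ) ^ (2 * hh k) * 2 ≤ p := by exact_mod_cast hp2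
        have : 0 ≤ (p : ℝ) ^ (2 * (2 * hh k) + 2) * B := by positivity
        refine mul_le_mul_of_nonneg_right (add_le_add ?_ ?_) hW0 <;> nlinarith
    _ = (K / 2 + (p : ℝ) ^ (2 * (2 * hh k) + 2) * B) * (p * W) := by ring
    _ ≤ (K / 2 + (p : ℝ) ^ (2 * (2 * hh k) + 2) * B) * ((p : ℝ) ^ (n * (hh k - 1)) * D) := by
        refine mul_le_mul_of_nonneg_left ?_ (by positivity)
        rw [hW, ← mul_assoc, ← pow_succ']
        refine mul_le_mul_of_nonneg_right (pow_le_pow_right₀ hpr ?_) hD0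
        obtain ⟨j, rfl⟩ : ∃ j, n = j + 1 := ⟨n - 1, by omega⟩
        rw [Nat.add_sub_cancel, add_mul]
        omega
    _ = _ := by ring

end VinogradovMean

namespace VinogradovMean

/-- The decoupling constant grows at most like `p ^ (κ n)`. -/
def DecExp (p k : ℕ) (κ : ℝ) : Prop :=
  ∃ C > (0 : ℝ), ∀ n : ℕ, Dec p k n (C * (p : ℝ) ^ (κ * n))

/-- The bilinear constants gain `p ^ (κ A b)` over the linear exponent `κ`, for scales `b` with
`b k ^ J ≤ n`. -/
def BilExp (p k : ℕ) (κ : ℝ) (A : ℕ → ℝ) (J : ℕ) : Prop :=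
  ∀ l < k, ∀ ε > (0 : ℝ), ∃ C > (0 : ℝ), ∀ n a b : ℕ, 1 ≤ a → a ≤ n → 1 ≤ b →
    l * a ≤ b * (k - l + 1) → b * k ^ J ≤ n →
    Bil p k n l a b (C * (p : ℝ) ^ (κ * n - κ * A l * b + ε * n))

lemma bil_raise {p k l : ℕ} (hp : p.Prime) (hpk : k < p) (hl : 1 ≤ l) (hlk : l < k)
    (hD : ∀ ε > (0 : ℝ), DecExp p l ε) {ε : ℝ} (hε : 0 < ε) :
    ∃ C > (0 : ℝ), ∀ (n a b m : ℕ) (K : ℝ), 1 ≤ a → a ≤ m → m ≤ n → l * m ≤ b * (k - l + 1) →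
      0 ≤ K → Bil p k n l m b K → Bil p k n l a b (C * (p : ℝ) ^ (ε * m) * K) := by
  obtain ⟨C₁, hC₁, hD⟩ := hD (ε / 2) (by positivity)
  have hpr : (1 : ℝ) < p := by exact_mod_cast hp.one_lt
  have hp0 : (0 : ℝ) < p := by linarith
  have hlr : (0 : ℝ) < l := by exact_mod_cast hl
  obtain ⟨d₀, hd₀⟩ : ∃ d₀ : ℕ, ∀ d ≥ d₀, C₁ ≤ (p : ℝ) ^ (ε / 2 * (d : ℝ)) := by
    have h1 : Tendsto (fun d : ℕ => ((p : ℝ) ^ (ε / 2)) ^ d) atTop atTop :=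
      tendsto_pow_atTop_atTop_of_one_lt (Real.one_lt_rpow hpr (by positivity))
    obtain ⟨d₀, h⟩ := (h1.eventually_ge_atTop C₁).exists_forall_of_atTop
    refine ⟨d₀, fun d hd => ?_⟩
    rw [Real.rpow_mul hp0.le, Real.rpow_natCast]
    exact h d hd
  set a₀ := l * (d₀ + 1) with ha₀
  have key : ∀ (N n a b m : ℕ) (K : ℝ), m - a ≤ N → a₀ ≤ a → a ≤ m → m ≤ n →
      l * m ≤ b * (k - l + 1) → 0 ≤ K → Bil p k n l m b K →
      Bil p k n l a b (C₁ * (p : ℝ) ^ (ε * ((m : ℝ) - a)) * K) := by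
    intro N
    induction N with
    | zero =>
      intro n a b m K hN ha ham hmn h2 hK hB
      obtain rfl : a = m := by omega
      refine (bil_lower hp hpk hK (K₁ := C₁ * (p : ℝ) ^ (ε / 2 * ((a - a : ℕ) : ℝ)))
        (by positivity) hl hlk (by nlinarith) le_rfl hmn (by nlinarith) h2 (hD _) hB).mono ?_
      simp
    | succ N ih =>
      intro n a b m K hN ha ham hmn h2 hK hB
      have ha1 : 1 ≤ a := by nlinarith
      have cast1 : ((m - a : ℕ) : ℝ) = (m : ℝ) - a := by push_cast [ham]; ring
      have hma : (a : ℝ) ≤ m := by exact_mod_cast ham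
      by_cases h1 : l * m ≤ a * (l + 1)
      · refine (bil_lower hp hpk hK (K₁ := C₁ * (p : ℝ) ^ (ε / 2 * ((m - a : ℕ) : ℝ)))
          (by positivity) hl hlk ha1 ham hmn h1 h2 (hD _) hB).mono ?_
        rw [cast1]
        gcongr
        · exact hpr.le
        · linarith
      · push Not at h1
        set d := a / l with hd
        have hdl : l * d ≤ a := Nat.mul_div_le a l
        have hd1 : d₀ + 1 ≤ d := by
          rw [hd, Nat.le_div_iff_mul_le (by omega)]; nlinarith
        have hm' : a + d < m := by
          have : l * (a + d) < l * m := by nlinarith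
          exact lt_of_mul_lt_mul_left this (by omega)
        have h3 := ih n (a + d) b m K (by omega) (by omega) hm'.le hmn h2 hK hB
        have cast2 : ((a + d - a : ℕ) : ℝ) = d := by simp
        refine (bil_lower hp hpk (by positivity)
          (K₁ := C₁ * (p : ℝ) ^ (ε / 2 * ((a + d - a : ℕ) : ℝ)))
          (by positivity) hl hlk ha1 (by omega) (by omega) (by nlinarith)
          (le_trans (Nat.mul_le_mul_left l hm'.le) h2) (hD _) h3).mono ?_
        rw [cast2]
        have e1 : (p : ℝ) ^ (ε * ((m : ℝ) - a)) = (p : ℝ) ^ (ε / 2 * (d : ℝ)) *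
            (p : ℝ) ^ (ε / 2 * (d : ℝ)) * (p : ℝ) ^ (ε * ((m : ℝ) - (a + d : ℕ))) := by
          rw [← Real.rpow_add hp0, ← Real.rpow_add hp0]
          congr 1; push_cast; ring
        have h4 := hd₀ d (by omega)
        calc _ ≤ (p : ℝ) ^ (ε / 2 * (d : ℝ)) * (p : ℝ) ^ (ε / 2 * (d : ℝ)) *
              (C₁ * (p : ℝ) ^ (ε * ((m : ℝ) - (a + d : ℕ))) * K) := by gcongr
          _ = _ := by rw [e1]; ring
  refine ⟨(p : ℝ) ^ (a₀ * (2 * hh l)) * (C₁ + 1), by positivity, ?_⟩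
  intro n a b m K ha ham hmn h2 hK hB
  have hX : (1 : ℝ) ≤ (p : ℝ) ^ (a₀ * (2 * hh l)) := one_le_pow₀ hpr.le
  by_cases h : a₀ ≤ a
  · refine (key (m - a) n a b m K le_rfl h ham hmn h2 hK hB).mono ?_
    have : (p : ℝ) ^ (ε * ((m : ℝ) - a)) ≤ (p : ℝ) ^ (ε * (m : ℝ)) :=
      Real.rpow_le_rpow_of_exponent_le hpr.le (by
        have : (0 : ℝ) ≤ a := by positivity
        nlinarith)
    gcongr
    nlinarith
  · push Not at h
    by_cases h' : a₀ ≤ m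
    · refine (bil_split_left hp.one_lt.le (by positivity) hl ha h.le (by omega)
        (key (m - a₀) n a₀ b m K le_rfl le_rfl h' hmn h2 hK hB)).mono ?_
      have : (p : ℝ) ^ (ε * ((m : ℝ) - a₀)) ≤ (p : ℝ) ^ (ε * (m : ℝ)) :=
        Real.rpow_le_rpow_of_exponent_le hpr.le (by
          have : (0 : ℝ) ≤ a₀ := by positivity
          nlinarith)
      rw [← mul_assoc, ← mul_assoc]
      gcongr
      linarith
    · refine (bil_split_left hp.one_lt.le hK hl ha ham hmn hB).mono ?_
      have h5 : (p : ℝ) ^ (m * (2 * hh l)) ≤ (p : ℝ) ^ (a₀ * (2 * hh l)) := by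
        gcongr
        · exact hpr.le
        · omega
      have h6 : 1 ≤ (p : ℝ) ^ (ε * (m : ℝ)) := Real.one_le_rpow hpr.le (by positivity)
      calc _ ≤ (p : ℝ) ^ (a₀ * (2 * hh l)) * 1 * 1 * K := by
            rw [mul_one, mul_one]; gcongr
        _ ≤ _ := by gcongr; linarith

lemma bilExp_zero {p k : ℕ} {κ : ℝ} (hp : 1 ≤ p) (hκ : 0 ≤ κ)
    (hD : ∀ ε > (0 : ℝ), DecExp p k (κ + ε)) :
    BilExp p k κ (fun l => if l = 0 then 1 else 0) 0 := by
  intro l hl ε hε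
  obtain ⟨C, hC, hD⟩ := hD ε hε
  refine ⟨C, hC, fun n a b ha han hb _ hbn => ?_⟩
  have hpr : (1 : ℝ) ≤ p := by exact_mod_cast hp
  rw [pow_zero, mul_one] at hbn
  have mono : ∀ c : ℕ, c ≤ n → (p : ℝ) ^ ((κ + ε) * ((n - c : ℕ) : ℝ)) ≤
      (p : ℝ) ^ (κ * n - κ * c + ε * n) := fun c hc => by
    apply Real.rpow_le_rpow_of_exponent_le hpr
    push_cast [hc]
    have : (0 : ℝ) ≤ c := by positivity
    nlinarith
  by_cases h0 : l = 0
  · subst h0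
    simp only [if_true, mul_one]
    refine bil_zero hp (by positivity) hbn ((hD _).mono ?_)
    have := mono b hbn
    gcongr
  · simp only [h0, if_false, mul_zero, zero_mul, sub_zero]
    have mono' : ∀ c : ℕ, c ≤ n → (p : ℝ) ^ ((κ + ε) * ((n - c : ℕ) : ℝ)) ≤
      (p : ℝ) ^ (κ * n + ε * n) := fun c hc => (mono c hc).trans (by
        apply Real.rpow_le_rpow_of_exponent_le hpr
        have : (0 : ℝ) ≤ c := by positivity
        nlinarith)
    have h1 := mono' a han
    have h2 := mono' b hbn
    refine bil_trivial hp (by positivity) (by omega) hl han hbn ((hD _).mono ?_)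
      ((hD _).mono ?_) <;> gcongr

/-- One step of the iteration on the gains. -/
def gainStep (k : ℕ) (A : ℕ → ℝ) (l : ℕ) : ℝ :=
  if l = 0 then 1 else A (k - l) / l + ((k - l : ℕ) : ℝ) / ((k - l + 1 : ℕ) : ℝ) * A (l - 1)

lemma swapped_scale_le {l q b m : ℕ} (hl : 1 ≤ l) (hb : l + 1 ≤ b)
    (hm : b * (q + 1) < l * (m + 1)) : q * b ≤ m * (l + 1) := by
  have h1 : (b * (q + 1)) * (l + 1) ≤ (l * (m + 1)) * (l + 1) := Nat.mul_le_mul_right _ hm.le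
  have h2 : l * (l + 1) ≤ l * b := Nat.mul_le_mul_left _ hb
  have h3 : l * (q * b) ≤ l * (m * (l + 1)) := by
    have h4 : 0 ≤ q * b := Nat.zero_le _
    nlinarith
  exact le_of_mul_le_mul_left h3 (by omega)

set_option maxHeartbeats 1000000 in
lemma bilExp_step {p k J : ℕ} {κ : ℝ} {A : ℕ → ℝ} (hp : p.Prime) (hpk : k < p) (hκ : 0 ≤ κ)
    (hA : ∀ l, 0 ≤ A l)
    (hD : ∀ ε > (0 : ℝ), DecExp p k (κ + ε))
    (hI : ∀ l, 1 ≤ l → l < k → ∀ ε > (0 : ℝ), DecExp p l ε)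
    (h : BilExp p k κ A J) : BilExp p k κ (gainStep k A) (J + 1) := by
  have hpr : (1 : ℝ) < p := by exact_mod_cast hp.one_lt
  have hp0 : (0 : ℝ) < p := by linarith
  intro l hlk ε hε
  have hD0 := bilExp_zero hp.one_lt.le hκ hD l hlk ε hε
  by_cases h0 : l = 0
  · subst h0
    obtain ⟨C, hC, hB⟩ := hD0
    refine ⟨C, hC, fun n a b ha han hb hab hbn => ?_⟩
    have hk1 : 1 ≤ k ^ (J + 1) := Nat.one_le_pow _ _ (by omega)
    have := hB n a b ha han hb hab (by nlinarith)
    simpa [gainStep] using this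
  have hl : 1 ≤ l := by omega
  have hlr : (0 : ℝ) < l := by exact_mod_cast hl
  obtain ⟨C₀, hC₀, hT⟩ := hD0
  simp only [h0, if_false, mul_zero, zero_mul, sub_zero] at hT
  obtain ⟨C₁, hC₁, hB₁⟩ := h (k - l) (by omega) (ε / 2) (by positivity)
  obtain ⟨C₂, hC₂, hB₂⟩ := h (l - 1) (by omega) (ε / 2) (by positivity)
  obtain ⟨C₃, hC₃, hR⟩ := bil_raise hp hpk hl hlk (hI l hl hlk) (ε := ε / 2) (by positivity)
  set q := k - l with hq
  have hq1 : 1 ≤ q := by omega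
  have hG : gainStep k A l = A q / l + (q : ℝ) / ((q + 1 : ℕ) : ℝ) * A (l - 1) := by
    simp [gainStep, h0, hq]
  have hG0 : 0 ≤ gainStep k A l := by
    have := hA q; have := hA (l - 1)
    rw [hG]; positivity
  set X := (p : ℝ) ^ (κ * A q) with hX
  have hX0 : 0 < X := by positivity
  set M := max (C₁ * X) C₂ with hM
  have hM0 : 0 < M := lt_max_of_lt_right hC₂
  refine ⟨C₀ * (p : ℝ) ^ (κ * gainStep k A l * k) + C₃ * M, by positivity,
    fun n a b ha han hb hab hbn => ?_⟩
  have hk1 : 1 ≤ k ^ J := Nat.one_le_pow _ _ (by omega)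
  have hkb : k * b * k ^ J ≤ n := by rw [pow_succ] at hbn; nlinarith
  have hkbn : k * b ≤ n := by nlinarith
  have hbn' : b ≤ n := by nlinarith
  by_cases hbk : b < k
  · refine (hT n a b ha han hb hab (by simpa using hbn')).mono ?_
    have : (p : ℝ) ^ (κ * n + ε * n) ≤ (p : ℝ) ^ (κ * gainStep k A l * k) *
        (p : ℝ) ^ (κ * n - κ * gainStep k A l * b + ε * n) := by
      rw [← Real.rpow_add hp0]
      apply Real.rpow_le_rpow_of_exponent_le hpr.le
      have h1 : (b : ℝ) ≤ k := by exact_mod_cast hbk.le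
      have h2 : 0 ≤ κ * gainStep k A l := by positivity
      nlinarith
    calc _ ≤ C₀ * ((p : ℝ) ^ (κ * gainStep k A l * k) *
        (p : ℝ) ^ (κ * n - κ * gainStep k A l * b + ε * n)) := by gcongr
      _ ≤ _ := by
        rw [add_mul, mul_assoc C₀]
        have : 0 ≤ C₃ * M * (p : ℝ) ^ (κ * n - κ * gainStep k A l * b + ε * n) := by positivity
        linarith
  push Not at hbk
  set m := b * (q + 1) / l with hm
  have hm1 : l * m ≤ b * (q + 1) := Nat.mul_div_le _ _
  have hm2 : b * (q + 1) < l * (m + 1) := by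
    exact Nat.lt_mul_div_succ _ (by omega)
  have ham : a ≤ m := by
    rw [hm, Nat.le_div_iff_mul_le (by omega)]
    rw [mul_comm]; exact hab
  have hmk : m ≤ k * b := by
    have : l * m ≤ l * (k * b) := by
      refine hm1.trans ?_
      have h5 : q + 1 ≤ k := by omega
      calc b * (q + 1) ≤ b * k := Nat.mul_le_mul_left _ h5
        _ = k * b := mul_comm _ _
        _ ≤ l * (k * b) := Nat.le_mul_of_pos_left _ hl
    exact le_of_mul_le_mul_left this (by omega)
  have hmn : m ≤ n := by omega
  have hmJ : m * k ^ J ≤ n := le_trans (Nat.mul_le_mul_right _ hmk) hkb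
  have hkl : k - q = l := by omega
  have c1 := hB₁ n b m hb hbn' (by omega) (by
    rw [hkl]
    exact swapped_scale_le hl (by omega) hm2) hmJ
  have c2 := hB₂ n m b (by omega) hmn hb (by
    have h5 : (l - 1) * m ≤ l * m := Nat.mul_le_mul_right _ (by omega)
    have h6 : b * (q + 1) ≤ b * (k - (l - 1) + 1) := Nat.mul_le_mul_left _ (by omega)
    omega) (by nlinarith)
  set E := κ * n - κ * gainStep k A l * b + ε / 2 * n with hE
  have c3 : Bil p k n l m b (M * (p : ℝ) ^ E) := by
    refine bil_holder (by positivity) (by positivity) hl hlk c1 c2 ?_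
    rw [← hq, mul_pow, mul_pow]
    have e1 : (p : ℝ) ^ (κ * n - κ * A q * m + ε / 2 * n) ≤
        X * (p : ℝ) ^ (κ * n - κ * A q * (b * (q + 1) / l) + ε / 2 * n) := by
      rw [hX, ← Real.rpow_add hp0]
      apply Real.rpow_le_rpow_of_exponent_le hpr.le
      have h1 : (b : ℝ) * (q + 1) / l ≤ m + 1 := by
        rw [div_le_iff₀ hlr]
        have : ((b * (q + 1) : ℕ) : ℝ) ≤ ((l * (m + 1) : ℕ) : ℝ) := by exact_mod_cast hm2.le
        push_cast at this; linarith
      have h2 : 0 ≤ κ * A q := mul_nonneg hκ (hA q)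
      nlinarith
    have e2 : (p : ℝ) ^ (κ * n - κ * A q * (b * (q + 1) / l) + ε / 2 * n) *
        ((p : ℝ) ^ (κ * n - κ * A (l - 1) * b + ε / 2 * n)) ^ q = ((p : ℝ) ^ E) ^ (q + 1) := by
      rw [← Real.rpow_natCast, ← Real.rpow_natCast, ← Real.rpow_mul hp0.le,
        ← Real.rpow_mul hp0.le, ← Real.rpow_add hp0, hE, hG]
      congr 1
      push_cast
      field_simp
      ring
    calc _ ≤ C₁ * (X * (p : ℝ) ^ (κ * n - κ * A q * (b * (q + 1) / l) + ε / 2 * n)) *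
          (C₂ ^ q * ((p : ℝ) ^ (κ * n - κ * A (l - 1) * b + ε / 2 * n)) ^ q) := by gcongr
      _ = (C₁ * X) * C₂ ^ q * ((p : ℝ) ^ E) ^ (q + 1) := by rw [← e2]; ring
      _ ≤ M * M ^ q * ((p : ℝ) ^ E) ^ (q + 1) := by
        have := le_max_left (C₁ * X) C₂
        have := le_max_right (C₁ * X) C₂
        gcongr
      _ = _ := by ring
  refine (hR n a b m _ ha ham hmn hm1 (by positivity) c3).mono ?_
  have e3 : (p : ℝ) ^ (ε / 2 * m) * (p : ℝ) ^ E ≤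
      (p : ℝ) ^ (κ * n - κ * gainStep k A l * b + ε * n) := by
    rw [← Real.rpow_add hp0]
    apply Real.rpow_le_rpow_of_exponent_le hpr.le
    have : (m : ℝ) ≤ n := by exact_mod_cast hmn
    rw [hE]; nlinarith
  calc _ = C₃ * M * ((p : ℝ) ^ (ε / 2 * m) * (p : ℝ) ^ E) := by ring
    _ ≤ C₃ * M * (p : ℝ) ^ (κ * n - κ * gainStep k A l * b + ε * n) := by gcongr
    _ ≤ _ := by
        gcongr
        have : 0 ≤ C₀ * (p : ℝ) ^ (κ * gainStep k A l * k) := by positivity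
        linarith

/-- The iterated gains. -/
def gain (k : ℕ) : ℕ → ℕ → ℝ
  | 0 => fun l => if l = 0 then 1 else 0
  | J + 1 => gainStep k (gain k J)

lemma gain_nonneg (k J l : ℕ) : 0 ≤ gain k J l := by
  induction J generalizing l with
  | zero => simp only [gain]; split_ifs <;> norm_num
  | succ J ih =>
    simp only [gain, gainStep]
    split_ifs
    · norm_num
    · have := ih (k - l); have := ih (l - 1); positivity

lemma gain_zero (k J : ℕ) : gain k J 0 = 1 := by
  cases J <;> simp [gain, gainStep]

lemma sum_gain (N J : ℕ) :
    ∑ i ∈ range N, gain (N + 1) J (i + 1) = J * ((N : ℝ) / (N + 1)) := by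
  induction J with
  | zero => simp [gain]
  | succ J ih =>
    set A := gain (N + 1) J with hA
    have e1 : ∑ i ∈ range N, gain (N + 1) (J + 1) (i + 1) =
        ∑ i ∈ range N, A (N - i) / ((i : ℝ) + 1) +
        ∑ i ∈ range N, ((N : ℝ) - i) / (N - i + 1) * A i := by
      rw [← sum_add_distrib]
      apply sum_congr rfl
      intro i hi
      have hi' : i ≤ N := (mem_range.1 hi).le
      simp only [gain, gainStep, Nat.add_eq_zero_iff, one_ne_zero, and_false, if_false,
        Nat.add_sub_cancel, Nat.add_sub_add_right]
      push_cast [hi']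
      rfl
    have e2 : ∑ i ∈ range N, A (N - i) / ((i : ℝ) + 1) =
        ∑ i ∈ range N, A (i + 1) / ((N : ℝ) - i) := by
      rw [← sum_range_reflect]
      apply sum_congr rfl
      intro i hi
      have hi' := mem_range.1 hi
      have c : ((N - 1 - i : ℕ) : ℝ) + 1 = N - i := by
        have : N - 1 - i + 1 = N - i := by omega
        rw [← Nat.cast_one (R := ℝ), ← Nat.cast_add, this]; push_cast [hi'.le]; rfl
      rw [c, show N - (N - 1 - i) = i + 1 by omega]
    have e3 : ∑ i ∈ range N, ((N : ℝ) - i) / (N - i + 1) * A i =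
        ∑ i ∈ range N, ((N : ℝ) - i - 1) / (N - i) * A (i + 1) + N / (N + 1) := by
      have h1 := sum_range_succ (fun i : ℕ => ((N : ℝ) - i) / (N - i + 1) * A i) N
      have h2 := sum_range_succ' (fun i : ℕ => ((N : ℝ) - i) / (N - i + 1) * A i) N
      rw [h1] at h2
      simp only [sub_self, zero_div, zero_mul, add_zero, CharP.cast_eq_zero, sub_zero] at h2
      rw [h2, hA, gain_zero, mul_one]
      congr 1
      apply sum_congr rfl
      intro i _
      push_cast
      congr 2 <;> ring
    rw [e1, e2, e3, ← add_assoc, ← sum_add_distrib]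
    have e4 : ∑ i ∈ range N, (A (i + 1) / ((N : ℝ) - i) +
        ((N : ℝ) - i - 1) / (N - i) * A (i + 1)) = ∑ i ∈ range N, A (i + 1) := by
      apply sum_congr rfl
      intro i hi
      have hi' : (i : ℝ) < N := by exact_mod_cast mem_range.1 hi
      have : (N : ℝ) - i ≠ 0 := by linarith
      field_simp
      ring
    rw [e4, ih]
    push_cast
    ring

lemma exists_gain_ge {k : ℕ} (hk : 2 ≤ k) (R : ℝ) :
    ∃ J l, 1 ≤ l ∧ l < k ∧ R ≤ gain k J l := by
  obtain ⟨N, rfl⟩ : ∃ N, k = N + 1 := ⟨k - 1, by omega⟩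
  obtain ⟨J, hJ⟩ := exists_nat_ge (R * (N + 1))
  by_contra! hc
  have hN : (0 : ℝ) < N := by exact_mod_cast (by omega : 0 < N)
  have h1 := sum_gain N J
  have h2 : ∑ i ∈ range N, gain (N + 1) J (i + 1) < ∑ i ∈ range N, R := by
    apply sum_lt_sum_of_nonempty (by simp; omega)
    intro i hi
    exact hc J (i + 1) (by omega) (by have := mem_range.1 hi; omega)
  rw [h1, sum_const, card_range, nsmul_eq_mul, mul_div_assoc', div_lt_iff₀ (by positivity)] at h2
  nlinarith

lemma bilExp_gain {p k : ℕ} {κ : ℝ} (hp : p.Prime) (hpk : k < p) (hκ : 0 ≤ κ)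
    (hD : ∀ ε > (0 : ℝ), DecExp p k (κ + ε))
    (hI : ∀ l, 1 ≤ l → l < k → ∀ ε > (0 : ℝ), DecExp p l ε) (J : ℕ) :
    BilExp p k κ (gain k J) J := by
  induction J with
  | zero => exact bilExp_zero hp.one_lt.le hκ hD
  | succ J ih => exact bilExp_step hp hpk hκ (gain_nonneg k J) hD hI ih

lemma dec_improve {p k : ℕ} {κ : ℝ} (hp : p.Prime) (hk : 2 ≤ k) (hpk : k < p)
    (hp2 : 2 ^ (2 * hh k) * 2 ≤ p) (hκ : 0 < κ)
    (hD : ∀ ε > (0 : ℝ), DecExp p k (κ + ε))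
    (hI : ∀ l, 1 ≤ l → l < k → ∀ ε > (0 : ℝ), DecExp p l ε) :
    ∃ κ' ≥ 0, κ' < κ ∧ DecExp p k κ' := by
  have hpr : (1 : ℝ) < p := by exact_mod_cast hp.one_lt
  have hp0 : (0 : ℝ) < p := by linarith
  obtain ⟨J, l, hl, hlk, hg⟩ := exists_gain_ge hk ((2 * hh k + 1) / κ)
  rw [div_le_iff₀ hκ] at hg
  set η : ℝ := 1 / (2 * k ^ J) with hη
  have hkJ : (0 : ℝ) < (k : ℝ) ^ J := by positivity
  have hη0 : 0 < η := by positivity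
  set κ' := max (κ - η) 0 with hκ'
  have hκ'0 : 0 ≤ κ' := le_max_right _ _
  have hκ'1 : κ - η ≤ κ' := le_max_left _ _
  refine ⟨κ', hκ'0, max_lt (by linarith) hκ, ?_⟩
  obtain ⟨C₁, hC₁, hB⟩ := bilExp_gain hp hpk hκ.le hD hI J l hlk η hη0
  obtain ⟨C₀, hC₀, hT⟩ := hD 1 one_pos
  set n₀ := k ^ J * k with hn₀
  set C' := C₀ * (p : ℝ) ^ ((κ + 1) * n₀) + C₁ * p with hC'
  have hC'0 : 0 < C' := by positivity
  have hBil : ∀ n, 1 ≤ n → Bil p k n l 1 1 (C' * (p : ℝ) ^ (κ' * n)) := by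
    intro n hn
    by_cases hnn : n < n₀
    · have hK : C₀ * (p : ℝ) ^ ((κ + 1) * ((n - 1 : ℕ) : ℝ)) ≤ C' * (p : ℝ) ^ (κ' * n) := by
        have h1 : (1 : ℝ) ≤ (p : ℝ) ^ (κ' * n) := Real.one_le_rpow hpr.le (by positivity)
        have h2 : (p : ℝ) ^ ((κ + 1) * ((n - 1 : ℕ) : ℝ)) ≤ (p : ℝ) ^ ((κ + 1) * (n₀ : ℝ)) := by
          apply Real.rpow_le_rpow_of_exponent_le hpr.le
          have : ((n - 1 : ℕ) : ℝ) ≤ n₀ := by exact_mod_cast (by omega)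
          gcongr
        calc _ ≤ C₀ * (p : ℝ) ^ ((κ + 1) * (n₀ : ℝ)) := by gcongr
          _ ≤ C' * 1 := by rw [hC', mul_one]; have : 0 < C₁ * p := by positivity
                           linarith
          _ ≤ _ := by gcongr
      exact bil_trivial hp.one_lt.le (by positivity) hl hlk hn hn ((hT _).mono hK)
        ((hT _).mono hK)
    · push Not at hnn
      set b := n / k ^ J with hb
      have hkJ' : 0 < k ^ J := by positivity
      have hbk : k ≤ b := by
        rw [hb, Nat.le_div_iff_mul_le hkJ', mul_comm]; exact hnn
      have hbn : b * k ^ J ≤ n := Nat.div_mul_le_self _ _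
      have hbn2 : n < (b + 1) * k ^ J := by
        rw [mul_comm]; exact Nat.lt_mul_div_succ _ hkJ'
      have h1 := hB n 1 b le_rfl hn (by omega) (by nlinarith [Nat.zero_le (k - l)]) hbn
      have h2 := bil_split_right hp.one_lt.le (by positivity) hlk le_rfl (by omega : 1 ≤ b)
        (by nlinarith) h1
      refine h2.mono ?_
      rw [← Real.rpow_natCast]
      have h3 : (p : ℝ) ^ ((b * (2 * hh k - 2 * hh l) : ℕ) : ℝ) *
          (p : ℝ) ^ (κ * n - κ * gain k J l * b + η * n) ≤ p * (p : ℝ) ^ (κ' * n) := by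
        rw [← Real.rpow_add hp0]
        nth_rewrite 2 [← Real.rpow_one (p : ℝ)]
        rw [← Real.rpow_add hp0]
        apply Real.rpow_le_rpow_of_exponent_le hpr.le
        have i1 : ((b * (2 * hh k - 2 * hh l) : ℕ) : ℝ) ≤ b * (2 * hh k) := by
          exact_mod_cast Nat.mul_le_mul_left b (Nat.sub_le _ _)
        have i2 : (b : ℝ) * (2 * hh k + 1) ≤ b * (gain k J l * κ) := by gcongr
        have i3 : (n : ℝ) ≤ (b + 1) * k ^ J := by exact_mod_cast hbn2.le
        have i4 : 2 * η * n ≤ b + 1 := by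
          have : 2 * η * n = n / k ^ J := by rw [hη]; field_simp
          rw [this, div_le_iff₀ hkJ]; exact i3
        have i5 : (κ - η) * n ≤ κ' * n := by gcongr
        nlinarith
      calc _ = C₁ * ((p : ℝ) ^ ((b * (2 * hh k - 2 * hh l) : ℕ) : ℝ) *
          (p : ℝ) ^ (κ * n - κ * gain k J l * b + η * n)) := by ring
        _ ≤ C₁ * (p * (p : ℝ) ^ (κ' * n)) := by gcongr
        _ ≤ _ := by
          rw [hC', add_mul]
          have : 0 ≤ C₀ * (p : ℝ) ^ ((κ + 1) * n₀) * (p : ℝ) ^ (κ' * n) := by positivity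
          linarith
  set E := (p : ℝ) ^ (2 * (2 * hh k) + 2) with hE
  have hE0 : 0 < E := by positivity
  refine ⟨1 + 2 * E * C', by positivity, fun n => ?_⟩
  induction n with
  | zero =>
    refine (dec_trivial hp.one_lt.le (by omega) 0).mono ?_
    have : 0 < E * C' := by positivity
    simp; nlinarith
  | succ n ih =>
    refine (dec_of_bil (K := (1 + 2 * E * C') * (p : ℝ) ^ (κ' * n)) hp hk hlk
      (by omega : 1 ≤ n + 1) hp2 (by positivity) (by positivity)
      (by rw [Nat.add_sub_cancel]; exact ih) (hBil (n + 1) (by omega))).mono ?_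
    have h1 : (p : ℝ) ^ (κ' * n) ≤ (p : ℝ) ^ (κ' * ((n + 1 : ℕ) : ℝ)) := by
      apply Real.rpow_le_rpow_of_exponent_le hpr.le
      push_cast; nlinarith
    calc _ ≤ (1 + 2 * E * C') * (p : ℝ) ^ (κ' * ((n + 1 : ℕ) : ℝ)) / 2 +
          E * (C' * (p : ℝ) ^ (κ' * ((n + 1 : ℕ) : ℝ))) := by gcongr
      _ ≤ _ := by
        have : 0 < (p : ℝ) ^ (κ' * ((n + 1 : ℕ) : ℝ)) := by positivity
        nlinarith

/-- Sharp decoupling: the constants have exponent zero. -/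
theorem decExp_of_pos {p K : ℕ} (hp : p.Prime) (hpK : K < p) (hp2 : 2 ^ (2 * hh K) * 2 ≤ p)
    {k : ℕ} (hk : 1 ≤ k) (hkK : k ≤ K) {ε : ℝ} (hε : 0 < ε) : DecExp p k ε := by
  have hpr : (1 : ℝ) < p := by exact_mod_cast hp.one_lt
  induction k using Nat.strong_induction_on generalizing ε with
  | _ k ih =>
    have mono : ∀ {x y : ℝ}, x ≤ y → DecExp p k x → DecExp p k y := by
      rintro x y hxy ⟨C, hC, h⟩
      refine ⟨C, hC, fun n => (h n).mono ?_⟩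
      have : (p : ℝ) ^ (x * n) ≤ (p : ℝ) ^ (y * n) := by
        apply Real.rpow_le_rpow_of_exponent_le hpr.le
        gcongr
      gcongr
    rcases Nat.lt_or_ge 1 k with h1 | h1
    · set S := {κ : ℝ | 0 ≤ κ ∧ DecExp p k κ} with hS
      have hne : S.Nonempty := by
        refine ⟨hh k, by positivity, 1, one_pos, fun n => ?_⟩
        refine (dec_trivial hp.one_lt.le hk n).mono ?_
        rw [one_mul, ← Real.rpow_natCast]
        push_cast
        rw [mul_comm]
      have hbdd : BddBelow S := ⟨0, fun x hx => hx.1⟩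
      have hinf : ∀ δ > (0 : ℝ), DecExp p k (sInf S + δ) := by
        intro δ hδ
        obtain ⟨x, hx, hxl⟩ := exists_lt_of_csInf_lt hne (by linarith : sInf S < sInf S + δ)
        exact mono hxl.le hx.2
      have h0 : 0 ≤ sInf S := le_csInf hne fun x hx => hx.1
      have hz : sInf S = 0 := by
        by_contra hc
        obtain ⟨κ', h2, h3, h4⟩ := dec_improve hp h1 (by omega) (le_trans (Nat.mul_le_mul_right _
          (Nat.pow_le_pow_right (by norm_num) (by have := hh_mono hkK; omega))) hp2)
          (lt_of_le_of_ne h0 (Ne.symm hc)) hinf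
          (fun l hl hlk ε hε => ih l hlk hl (by omega) hε)
        exact absurd (csInf_le hbdd ⟨h2, h4⟩) (not_le.2 h3)
      simpa [hz] using hinf ε hε
    · obtain rfl : k = 1 := by omega
      refine ⟨1, one_pos, fun n => (dec_one hp.one_lt.le n).mono ?_⟩
      rw [one_mul]
      exact Real.one_le_rpow hpr.le (by positivity)

end VinogradovMean

namespace VinogradovMean

/-- The vector of power sums of degrees `1, …, k`. -/
def powerSums (k : ℕ) {s : ℕ} (x : Fin s → ℤ) (j : Fin k) : ℤ := ∑ i, x i ^ (j.1 + 1)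

/-- The box `{1, …, L} ^ s`. -/
def box (s L : ℕ) : Finset (Fin s → ℤ) := Fintype.piFinset fun _ => Icc 1 (L : ℤ)

/-- The number of solutions of Vinogradov's system. -/
def vinogradovCount (s k L : ℕ) : ℕ :=
  ((box s L ×ˢ box s L).filter fun z => powerSums k z.1 = powerSums k z.2).card

lemma e_div_eq_stdAddChar (M : ℕ) [NeZero M] (z : ℤ) :
    e ((z : ℝ) / M) = ZMod.stdAddChar (z : ZMod M) := by
  rw [ZMod.stdAddChar_coe]
  unfold e
  congr 1
  push_cast
  ring

/-- The character `g ↦ χ (∑ j, g j * v j)`. -/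
def dotChar (M : ℕ) [NeZero M] {k : ℕ} (v : Fin (k + 1) → ZMod M) :
    AddChar (Fin (k + 1) → ZMod M) ℂ where
  toFun g := ZMod.stdAddChar (∑ j, g j * v j)
  map_zero_eq_one' := by simp
  map_add_eq_mul' g g' := by
    simp only [Pi.add_apply, add_mul, sum_add_distrib, AddChar.map_add_eq_mul]

lemma dotChar_apply (M : ℕ) [NeZero M] {k : ℕ} (v g : Fin (k + 1) → ZMod M) :
    dotChar M v g = ZMod.stdAddChar (∑ j, g j * v j) := rfl

lemma stdAddChar_sum {M : ℕ} [NeZero M] {ι : Type*} (s : Finset ι) (f : ι → ZMod M) :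
    ZMod.stdAddChar (∑ i ∈ s, f i) = ∏ i ∈ s, ZMod.stdAddChar (f i) := by
  induction s using Finset.cons_induction with
  | empty => simp
  | cons i s hi ih => rw [sum_cons, prod_cons, AddChar.map_add_eq_mul, ih]

lemma vinogradovCount_le_moment (M : ℕ) [NeZero M] (s k L : ℕ) :
    (vinogradovCount s k L : ℝ) * Fintype.card (Fin (k + 1) → ZMod M) ≤
      ∑ g, ‖∑ t ∈ Icc 1 (L : ℤ), dotChar M (fun j : Fin (k + 1) => ((t ^ j.1 : ℤ) : ZMod M)) g‖
        ^ (2 * s) := by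
  set V : (Fin s → ℤ) → Fin (k + 1) → ZMod M := fun x j => ((∑ i, x i ^ j.1 : ℤ) : ZMod M) with hV
  have hpow : ∀ g, (∑ t ∈ Icc 1 (L : ℤ), dotChar M (fun j : Fin (k + 1) =>
      ((t ^ j.1 : ℤ) : ZMod M)) g) ^ s = ∑ x ∈ box s L, dotChar M (V x) g := by
    intro g
    have h1 := prod_univ_sum (fun _ : Fin s => Icc 1 (L : ℤ)) (fun _ t => dotChar M
      (fun j : Fin (k + 1) => ((t ^ j.1 : ℤ) : ZMod M)) g)
    rw [prod_const, card_univ, Fintype.card_fin] at h1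
    rw [h1]
    apply sum_congr rfl
    intro x _
    simp only [dotChar_apply, hV]
    rw [← stdAddChar_sum]
    congr 1
    rw [sum_comm]
    apply sum_congr rfl
    intro j _
    rw [← mul_sum]
    push_cast
    rfl
  have hpair : ∀ x y : Fin s → ℤ, ∀ g, dotChar M (V x) g * (starRingEnd ℂ) (dotChar M (V y) g) =
      dotChar M (fun j => V x j - V y j) g := by
    intro x y g
    simp only [dotChar_apply]
    rw [← AddChar.map_neg_eq_conj, ← AddChar.map_add_eq_mul]
    congr 1
    rw [← sub_eq_add_neg, ← sum_sub_distrib]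
    apply sum_congr rfl
    intro j _
    ring
  have hc : ((∑ g, ‖∑ t ∈ Icc 1 (L : ℤ), dotChar M (fun j : Fin (k + 1) =>
      ((t ^ j.1 : ℤ) : ZMod M)) g‖ ^ (2 * s) : ℝ) : ℂ) =
      ∑ z ∈ box s L ×ˢ box s L, ∑ g, dotChar M (fun j => V z.1 j - V z.2 j) g := by
    rw [sum_comm]
    rw [Complex.ofReal_sum]
    apply sum_congr rfl
    intro g _
    rw [Complex.ofReal_pow, mul_comm 2 s, pow_mul, ← Complex.ofReal_pow, ← norm_pow, hpow,
      ← Complex.mul_conj',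
      map_sum, sum_mul_sum, sum_product]
    apply sum_congr rfl
    intro x _
    apply sum_congr rfl
    intro y _
    exact hpair x y g
  have hc2 : ∀ z : (Fin s → ℤ) × (Fin s → ℤ),
      ∑ g, dotChar M (fun j => V z.1 j - V z.2 j) g =
      (((if dotChar M (fun j => V z.1 j - V z.2 j) = 0 then
        (Fintype.card (Fin (k + 1) → ZMod M) : ℝ) else 0 : ℝ)) : ℂ) := by
    classical
    intro z
    rw [AddChar.sum_eq_ite]
    split_ifs <;> simp
  simp only [hc2] at hc
  rw [← Complex.ofReal_sum] at hc
  rw [Complex.ofReal_injective hc, vinogradovCount, card_eq_sum_ones, Nat.cast_sum, sum_mul]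
  rw [sum_filter]
  apply sum_le_sum
  intro z _
  by_cases h : powerSums k z.1 = powerSums k z.2
  · rw [if_pos h, if_pos]
    · simp
    · have : (fun j => V z.1 j - V z.2 j) = 0 := by
        funext j
        simp only [hV, Pi.zero_apply, sub_eq_zero]
        congr 1
        refine Fin.cases ?_ (fun i => ?_) j
        · simp
        · exact congrFun h i
      rw [this]
      ext g
      simp [dotChar_apply]
  · rw [if_neg h]
    split_ifs <;> positivity

lemma phaseInv_dotChar (p k N : ℕ) [NeZero (p ^ N)] (T : Finset ℤ) :
    PhaseInv p k N (fun _ : Fin (k + 1) → ZMod (p ^ N) => (1 : ℝ))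
      (fun t g => dotChar (p ^ N) (fun j : Fin (k + 1) =>
        ((t ^ j.1 : ℤ) : ZMod (p ^ N))) g) id T := by
  intro ψ hψ
  refine ⟨Equiv.addRight (fun j : Fin (k + 1) => ((ψ.coeff j : ℤ) : ZMod (p ^ N))), fun _ => 1,
    by simp, by simp, fun t _ g => ?_⟩
  have h1 : e ((ψ.eval (id t) : ℤ) / (p : ℝ) ^ N) = dotChar (p ^ N)
      (fun j : Fin (k + 1) => ((t ^ j.1 : ℤ) : ZMod (p ^ N)))
      (fun j : Fin (k + 1) => ((ψ.coeff j : ℤ) : ZMod (p ^ N))) := by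
    have := e_div_eq_stdAddChar (p ^ N) (ψ.eval t)
    push_cast at this
    rw [id, this, dotChar_apply, Polynomial.eval_eq_sum_range' (Nat.lt_succ_of_le hψ),
      ← Fin.sum_univ_eq_sum_range (fun j => ψ.coeff j * t ^ j)]
    push_cast
    rfl
  simp only [Equiv.coe_addRight]
  rw [h1, AddChar.map_add_eq_mul]
  ring

/-- **Vinogradov's mean value theorem** at the critical exponent. -/
theorem vinogradovCount_le {k : ℕ} (hk : 1 ≤ k) {ε : ℝ} (hε : 0 < ε) :
    ∃ C > (0 : ℝ), ∀ L : ℕ, 1 ≤ L →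
      (vinogradovCount (hh k) k L : ℝ) ≤ C * (L : ℝ) ^ ((hh k : ℝ) + ε) := by
  obtain ⟨p, hpge, hp⟩ := Nat.exists_infinite_primes (2 ^ (2 * hh k) * 2 + k + 1)
  have hpr : (1 : ℝ) < p := by exact_mod_cast hp.one_lt
  have hp0 : (0 : ℝ) < p := by linarith
  have hk' := hh_pos hk
  obtain ⟨C, hC, hD⟩ := decExp_of_pos hp (K := k) (by omega) (by omega) hk le_rfl hε
  refine ⟨C * (p : ℝ) ^ ((hh k : ℝ) - 1 + ε), by positivity, fun L hL => ?_⟩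
  have hL0 : (0 : ℝ) < L := by exact_mod_cast hL
  set n := Nat.clog p L with hn
  have h1 : L ≤ p ^ n := Nat.le_pow_clog hp.one_lt L
  have h2 : ((p ^ n : ℕ) : ℝ) ≤ p * L := by
    rcases Nat.eq_zero_or_pos n with h0 | h0
    · rw [h0, pow_zero, Nat.cast_one]
      have : (1 : ℝ) ≤ L := by exact_mod_cast hL
      nlinarith
    · have h3 : p ^ (n - 1) < L := by
        rw [← Nat.lt_clog_iff_pow_lt hp.one_lt]; omega
      have h4 : p ^ n ≤ p * L := by
        rw [show n = n - 1 + 1 by omega, pow_succ']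
        exact Nat.mul_le_mul_left _ h3.le
      exact_mod_cast h4
  set N := k * n with hN
  have : NeZero (p ^ N) := ⟨by have := hp.pos; positivity⟩
  have h3 := hD n _ _ _ _ (Icc 1 (L : ℤ)) (fun _ => zero_le_one) (phaseInv_dotChar p k N _)
  have h4 := vinogradovCount_le_moment (p ^ N) (hh k) k L
  set Q := ((Fintype.card (Fin (k + 1) → ZMod (p ^ N)) : ℕ) : ℝ) with hQ
  have hQ0 : 0 < Q := by rw [hQ]; exact_mod_cast Fintype.card_pos
  have h5 : ∀ U ∈ cls id (p ^ n) (Icc 1 (L : ℤ)), U.card = 1 := by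
    intro U hU
    obtain ⟨t, ht⟩ := cls_nonempty hU
    rw [card_eq_one]
    refine ⟨t, eq_singleton_iff_unique_mem.2 ⟨ht, fun u hu => ?_⟩⟩
    have h6 := cls_dvd hU hu ht
    have h7 := mem_Icc.1 (cls_subset hU hu)
    have h8 := mem_Icc.1 (cls_subset hU ht)
    have h9 : (L : ℤ) ≤ (p ^ n : ℕ) := by exact_mod_cast h1
    have := Int.eq_zero_of_abs_lt_dvd h6 (by rw [abs_lt]; simp only [id]; constructor <;> linarith)
    simpa [sub_eq_zero] using this
  have h6 : dsum (fun _ : Fin (k + 1) → ZMod (p ^ N) => (1 : ℝ))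
      (fun t g => dotChar (p ^ N) (fun j : Fin (k + 1) => ((t ^ j.1 : ℤ) : ZMod (p ^ N))) g)
      (2 * hh k) id (p ^ n) (Icc 1 (L : ℤ)) = L * Q := by
    have h7 : ∀ U ∈ cls id (p ^ n) (Icc 1 (L : ℤ)),
        nrm (fun _ : Fin (k + 1) → ZMod (p ^ N) => (1 : ℝ))
        (fun t g => dotChar (p ^ N) (fun j : Fin (k + 1) => ((t ^ j.1 : ℤ) : ZMod (p ^ N))) g)
        (2 * hh k) U = ∑ t ∈ U, Q := by
      intro U hU
      obtain ⟨t, rfl⟩ := card_eq_one.1 (h5 U hU)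
      simp only [nrm, sum_singleton, one_mul]
      rw [sum_congr rfl (fun g _ => by rw [AddChar.norm_apply, one_pow])]
      simp [hQ]
    unfold dsum
    rw [sum_congr rfl h7, ← sum_cls]
    simp
  rw [h6] at h3
  have h7 : (vinogradovCount (hh k) k L : ℝ) * Q ≤
      (C * (p : ℝ) ^ (ε * n) * (p : ℝ) ^ (n * (hh k - 1)) * L) * Q := by
    refine h4.trans ?_
    simp only [nrm, one_mul] at h3
    calc _ ≤ _ := h3
      _ = _ := by ring
  refine (le_of_mul_le_mul_right h7 hQ0).trans ?_
  have h8 : (p : ℝ) ^ (ε * n) * (p : ℝ) ^ (n * (hh k - 1)) ≤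
      (p * L : ℝ) ^ ((hh k : ℝ) - 1 + ε) := by
    calc _ = ((p ^ n : ℕ) : ℝ) ^ ((hh k : ℝ) - 1 + ε) := by
          rw [← Real.rpow_natCast, ← Real.rpow_add hp0, Nat.cast_pow, ← Real.rpow_natCast,
            ← Real.rpow_mul hp0.le]
          congr 1
          push_cast [hk']
          ring
      _ ≤ _ := by
          apply Real.rpow_le_rpow (by positivity) h2
          have : (1 : ℝ) ≤ hh k := by exact_mod_cast hk'
          linarith
  calc _ = C * ((p : ℝ) ^ (ε * n) * (p : ℝ) ^ (n * (hh k - 1))) * L := by ring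
    _ ≤ C * (p * L : ℝ) ^ ((hh k : ℝ) - 1 + ε) * L := by gcongr
    _ = C * (p : ℝ) ^ ((hh k : ℝ) - 1 + ε) * ((L : ℝ) ^ ((hh k : ℝ) - 1 + ε) * L) := by
        rw [Real.mul_rpow hp0.le hL0.le]; ring
    _ = _ := by
        congr 1
        nth_rewrite 2 [← Real.rpow_one (L : ℝ)]
        rw [← Real.rpow_add hL0]
        congr 1; ring

end VinogradovMean

namespace VinogradovMean

lemma e_sum {ι : Type*} (s : Finset ι) (f : ι → ℝ) : e (∑ i ∈ s, f i) = ∏ i ∈ s, e (f i) := by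
  induction s using Finset.cons_induction with
  | empty => simp [e_zero]
  | cons i s hi ih => rw [sum_cons, prod_cons, e_add, ih]

lemma e_nat_mul (u : ℕ) (x : ℝ) : e (u * x) = e x ^ u := by
  induction u with
  | zero => simp [e_zero]
  | succ u ih => rw [pow_succ, ← ih, ← e_add]; congr 1; push_cast; ring

/-- The Fejér kernel, normalized to have value `1` at the origin. -/
def fejer (H : ℕ) (x : ℝ) : ℝ := ‖∑ u ∈ range H, e (u * x)‖ ^ 2 / (H : ℝ) ^ 2

lemma fejer_nonneg (H : ℕ) (x : ℝ) : 0 ≤ fejer H x := by unfold fejer; positivity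

lemma fejer_le_one (H : ℕ) (x : ℝ) : fejer H x ≤ 1 := by
  unfold fejer
  apply div_le_one_of_le₀ _ (by positivity)
  gcongr
  refine (norm_sum_le _ _).trans ?_
  simp [norm_e]

lemma fejer_neg (H : ℕ) (x : ℝ) : fejer H (-x) = fejer H x := by
  unfold fejer
  congr 2
  rw [← Complex.norm_conj, map_sum]
  congr 1
  apply sum_congr rfl
  intro u _
  rw [← e_neg]
  congr 1; ring

lemma four_mul_abs_le_norm_e_sub_one {x : ℝ} (hx : |x| ≤ 1 / 2) : 4 * |x| ≤ ‖e x - 1‖ := by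
  have h1 : e x = Complex.exp (Complex.I * ((2 * Real.pi * x : ℝ) : ℂ)) := by
    unfold e; rw [mul_comm]
  rw [h1, Complex.norm_exp_I_mul_ofReal_sub_one, norm_mul]
  have hpi := Real.pi_pos
  have h2 := Real.mul_abs_le_abs_sin (x := Real.pi * x) (by
    rw [abs_mul, abs_of_pos hpi]; nlinarith)
  rw [abs_mul, abs_of_pos hpi] at h2
  have h3 : 2 / Real.pi * (Real.pi * |x|) = 2 * |x| := by field_simp
  rw [h3] at h2
  rw [show 2 * Real.pi * x / 2 = Real.pi * x by ring]
  simp only [Real.norm_eq_abs, Nat.abs_ofNat]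
  linarith

lemma fejer_le {H : ℕ} (hH : 0 < H) {x : ℝ} (hx : |x| ≤ 1 / 2) (hx0 : x ≠ 0) :
    fejer H x ≤ 1 / (2 * H * |x|) ^ 2 := by
  have h1 := four_mul_abs_le_norm_e_sub_one hx
  have hx' : 0 < |x| := abs_pos.2 hx0
  have h2 : ‖∑ u ∈ range H, e (u * x)‖ * ‖e x - 1‖ ≤ 2 := by
    rw [← norm_mul]
    simp only [e_nat_mul]
    rw [geom_sum_mul]
    refine (norm_sub_le _ _).trans ?_
    rw [norm_pow, norm_e, norm_one]; norm_num
  have h3 : ‖∑ u ∈ range H, e (u * x)‖ ≤ 1 / (2 * |x|) := by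
    rw [le_div_iff₀ (by positivity)]
    have := norm_nonneg (∑ u ∈ range H, e (u * x))
    nlinarith
  have hH' : (0 : ℝ) < H := by exact_mod_cast hH
  unfold fejer
  calc _ ≤ (1 / (2 * |x|)) ^ 2 / (H : ℝ) ^ 2 := by gcongr
    _ = _ := by field_simp

lemma sum_norm_sq_le_of_fejer {α : Type*} [DecidableEq α] {k : ℕ} (s : Finset α)
    (γ : α → Fin k → ℝ)
    (ξ : α → ℂ) (H : Fin k → ℕ) (hH : ∀ j, 0 < H j) (S : Finset (Fin k → ℤ))
    (hS : ∀ h ∈ S, ∀ j, |h j| ≤ H j) {D : ℝ}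
    (hD : ∀ a ∈ s, ∑ a' ∈ s, ∏ j, fejer (2 * H j) (γ a j - γ a' j) ≤ D) :
    ∑ h ∈ S, ‖∑ a ∈ s, ξ a * e (∑ j, γ a j * h j)‖ ^ 2 ≤
      (∏ j, (4 * (H j : ℝ))) * D * ∑ a ∈ s, ‖ξ a‖ ^ 2 := by
  set Z : (Fin k → ℤ) → ℂ := fun h => ∑ a ∈ s, ξ a * e (∑ j, γ a j * h j) with hZ
  set R := Fintype.piFinset fun j => range (2 * H j) with hR
  set W := Fintype.piFinset fun j => range (H j) with hW
  set Fj : α → α → ℝ := fun a a' => ∏ j, fejer (2 * H j) (γ a j - γ a' j) with hFj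
  have hF0 : ∀ a a', 0 ≤ Fj a a' := fun a a' => prod_nonneg fun j _ => fejer_nonneg _ _
  have hFs : ∀ a a', Fj a a' = Fj a' a := fun a a' => by
    simp only [hFj]
    apply prod_congr rfl
    intro j _
    rw [← fejer_neg, neg_sub]
  -- expansion over pairs
  have expand : ∑ z ∈ R ×ˢ R, ‖Z (fun j => (z.1 j : ℤ) - z.2 j)‖ ^ 2 ≤
      (∏ j, (2 * (H j : ℝ)) ^ 2) * (D * ∑ a ∈ s, ‖ξ a‖ ^ 2) := by
    have kern : ∀ a a', ∑ z ∈ R ×ˢ R, e (∑ j, (γ a j - γ a' j) * ((z.1 j : ℝ) - z.2 j)) =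
        (((∏ j, (2 * (H j : ℝ)) ^ 2) * Fj a a' : ℝ) : ℂ) := by
      intro a a'
      have h1 : ∑ u ∈ R, e (∑ j, (γ a j - γ a' j) * (u j : ℝ)) =
          ∏ j, ∑ u ∈ range (2 * H j), e (u * (γ a j - γ a' j)) := by
        rw [prod_univ_sum]
        apply sum_congr rfl
        intro u _
        rw [e_sum]
        apply prod_congr rfl
        intro j _
        rw [mul_comm]
      have h2 : ∑ z ∈ R ×ˢ R, e (∑ j, (γ a j - γ a' j) * ((z.1 j : ℝ) - z.2 j)) =
          (∑ u ∈ R, e (∑ j, (γ a j - γ a' j) * (u j : ℝ))) *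
          (starRingEnd ℂ) (∑ u ∈ R, e (∑ j, (γ a j - γ a' j) * (u j : ℝ))) := by
        rw [map_sum, sum_mul_sum, sum_product]
        apply sum_congr rfl
        intro u _
        apply sum_congr rfl
        intro v _
        rw [← e_neg, ← e_add]
        congr 1
        rw [← sub_eq_add_neg, ← sum_sub_distrib]
        apply sum_congr rfl
        intro j _
        ring
      rw [h2, Complex.mul_conj', h1, ← Complex.ofReal_pow]
      congr 1
      rw [norm_prod, ← prod_pow, hFj, ← prod_mul_distrib]
      apply prod_congr rfl
      intro j _
      have := hH j
      unfold fejer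
      generalize ‖∑ u ∈ range (2 * H j), e (u * (γ a j - γ a' j))‖ = w
      push_cast
      field_simp
    have hc : ((∑ z ∈ R ×ˢ R, ‖Z (fun j => (z.1 j : ℤ) - z.2 j)‖ ^ 2 : ℝ) : ℂ) =
        ∑ a ∈ s, ∑ a' ∈ s, ξ a * (starRingEnd ℂ) (ξ a') *
          (((∏ j, (2 * (H j : ℝ)) ^ 2) * Fj a a' : ℝ) : ℂ) := by
      simp only [← kern, mul_sum]
      rw [Complex.ofReal_sum]
      rw [sum_congr rfl (fun a _ => sum_comm), sum_comm]
      apply sum_congr rfl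
      intro z _
      rw [Complex.ofReal_pow, ← Complex.mul_conj', hZ]
      simp only [map_sum]
      rw [sum_mul_sum]
      apply sum_congr rfl
      intro a _
      apply sum_congr rfl
      intro a' _
      rw [map_mul, ← e_neg]
      have : e (∑ j, (γ a j - γ a' j) * ((z.1 j : ℝ) - z.2 j)) =
          e (∑ j, γ a j * ((z.1 j - z.2 j : ℤ) : ℝ)) *
            e (-∑ j, γ a' j * ((z.1 j - z.2 j : ℤ) : ℝ)) := by
        rw [← e_add, ← sub_eq_add_neg, ← sum_sub_distrib]
        congr 1
        apply sum_congr rfl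
        intro j _
        push_cast; ring
      rw [this]
      push_cast
      ring
    set Q := ∏ j, (2 * (H j : ℝ)) ^ 2 with hQ
    have hQ0 : 0 ≤ Q := prod_nonneg fun j _ => by positivity
    have h5 : ∑ z ∈ R ×ˢ R, ‖Z (fun j => (z.1 j : ℤ) - z.2 j)‖ ^ 2 ≤
        ∑ a ∈ s, ∑ a' ∈ s, ‖ξ a‖ * ‖ξ a'‖ * (Q * Fj a a') := by
      have h6 : 0 ≤ ∑ z ∈ R ×ˢ R, ‖Z (fun j => (z.1 j : ℤ) - z.2 j)‖ ^ 2 := by positivity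
      rw [← abs_of_nonneg h6, ← Real.norm_eq_abs, ← Complex.norm_real, hc]
      refine (norm_sum_le _ _).trans (sum_le_sum fun a _ => (norm_sum_le _ _).trans
        (sum_le_sum fun a' _ => ?_))
      rw [norm_mul, norm_mul, Complex.norm_conj, Complex.norm_real, Real.norm_eq_abs,
        abs_of_nonneg (mul_nonneg hQ0 (hF0 _ _))]
    have hhalf : ∑ a ∈ s, ∑ a' ∈ s, ‖ξ a‖ ^ 2 * (Q * Fj a a') ≤ Q * (D * ∑ a ∈ s, ‖ξ a‖ ^ 2) := by
      rw [mul_sum, mul_sum]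
      apply sum_le_sum
      intro a ha
      rw [← mul_sum, ← mul_sum]
      have := hD a ha
      calc ‖ξ a‖ ^ 2 * (Q * ∑ a' ∈ s, Fj a a') ≤ ‖ξ a‖ ^ 2 * (Q * D) := by gcongr
        _ = _ := by ring
    have hhalf' : ∑ a ∈ s, ∑ a' ∈ s, ‖ξ a'‖ ^ 2 * (Q * Fj a a') ≤
        Q * (D * ∑ a ∈ s, ‖ξ a‖ ^ 2) := by
      rw [sum_comm]
      refine le_trans (le_of_eq ?_) hhalf
      apply sum_congr rfl
      intro a _
      apply sum_congr rfl
      intro a' _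
      rw [hFs]
    have h7 : ∑ a ∈ s, ∑ a' ∈ s, ‖ξ a‖ * ‖ξ a'‖ * (Q * Fj a a') ≤
        ∑ a ∈ s, ∑ a' ∈ s, (‖ξ a‖ ^ 2 * (Q * Fj a a') + ‖ξ a'‖ ^ 2 * (Q * Fj a a')) / 2 := by
      apply sum_le_sum
      intro a _
      apply sum_le_sum
      intro a' _
      have h8 : 0 ≤ Q * Fj a a' := mul_nonneg hQ0 (hF0 _ _)
      have h9 := sq_nonneg (‖ξ a‖ - ‖ξ a'‖)
      nlinarith
    refine h5.trans (h7.trans ?_)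
    simp only [← sum_div, sum_add_distrib]
    linarith
  -- each vector of the box is a difference in many ways
  have inj : (∏ j, (H j : ℝ)) * ∑ h ∈ S, ‖Z h‖ ^ 2 ≤
      ∑ z ∈ R ×ˢ R, ‖Z (fun j => (z.1 j : ℤ) - z.2 j)‖ ^ 2 := by
    set Φ : (Fin k → ℤ) × (Fin k → ℕ) → (Fin k → ℕ) × (Fin k → ℕ) := fun q =>
      (fun j => q.2 j + (q.1 j).toNat, fun j => q.2 j + (-q.1 j).toNat) with hΦ
    have hd : ∀ q j, ((Φ q).1 j : ℤ) - (Φ q).2 j = q.1 j := by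
      intro q j
      simp only [hΦ]
      push_cast
      omega
    have h1 : (∏ j, (H j : ℝ)) * ∑ h ∈ S, ‖Z h‖ ^ 2 =
        ∑ q ∈ S ×ˢ W, ‖Z (fun j => ((Φ q).1 j : ℤ) - (Φ q).2 j)‖ ^ 2 := by
      simp only [hd]
      rw [sum_product, mul_sum]
      apply sum_congr rfl
      intro h _
      simp [hW, Fintype.card_piFinset]
    rw [h1, ← sum_image (s := S ×ˢ W) (g := Φ)
      (f := fun z => ‖Z (fun j => (z.1 j : ℤ) - z.2 j)‖ ^ 2)]
    · apply sum_le_sum_of_subset_of_nonneg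
      · intro z hz
        obtain ⟨q, hq, rfl⟩ := mem_image.1 hz
        have hq1 := hS q.1 (mem_product.1 hq).1
        have hq2 := Fintype.mem_piFinset.1 (mem_product.1 hq).2
        simp only [mem_product, hR, Fintype.mem_piFinset, mem_range, hΦ]
        constructor
        · intro j
          have := mem_range.1 (hq2 j); have := abs_le.1 (hq1 j)
          omega
        · intro j
          have := mem_range.1 (hq2 j); have := abs_le.1 (hq1 j)
          omega
      · intros; positivity
    · intro q _ q' _ hqq
      have e1 : q.1 = q'.1 := by
        funext j
        rw [← hd q j, ← hd q' j, hqq]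
      have e2 : q.2 = q'.2 := by
        funext j
        have := congrFun (congrArg Prod.fst hqq) j
        simp only [hΦ, e1] at this
        omega
      exact Prod.ext e1 e2
  have hP : 0 < ∏ j, (H j : ℝ) := prod_pos fun j _ => by exact_mod_cast hH j
  have h := inj.trans expand
  have e1 : ∏ j, (2 * (H j : ℝ)) ^ 2 = (∏ j, (H j : ℝ)) * ∏ j, (4 * (H j : ℝ)) := by
    rw [← prod_mul_distrib]
    apply prod_congr rfl
    intro j _
    ring
  rw [e1, mul_assoc] at h
  have := le_of_mul_le_mul_left h hP
  rw [mul_assoc]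
  exact this

lemma sum_fiber_sq_eq_vinogradovCount (s k L : ℕ) :
    ∑ h ∈ (box s L).image (powerSums k), (((box s L).filter fun x => powerSums k x = h).card : ℝ) ^ 2
      = vinogradovCount s k L := by
  unfold vinogradovCount
  rw [card_eq_sum_card_fiberwise (f := fun z => powerSums k z.1)
    (t := (box s L).image (powerSums k))]
  · push_cast
    apply sum_congr rfl
    intro h _
    rw [sq, ← Nat.cast_mul, ← card_product]
    congr 2
    ext z
    simp only [mem_product, mem_filter]
    constructor
    · rintro ⟨⟨h1, h2⟩, h3, h4⟩; exact ⟨⟨⟨h1, h3⟩, h2.trans h4.symm⟩, h2⟩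
    · rintro ⟨⟨⟨h1, h3⟩, h2⟩, h4⟩; exact ⟨⟨h1, h4⟩, h3, h2.symm.trans h4⟩
  · intro z hz
    have hz' := (mem_filter.1 (mem_coe.1 hz)).1
    exact mem_coe.2 (mem_image_of_mem _ (mem_product.1 hz').1)

/-- Large sieve for polynomial exponential sums, from Vinogradov's mean value theorem. -/
theorem large_sieve {k : ℕ} (hk : 1 ≤ k) {ε : ℝ} (hε : 0 < ε) :
    ∃ C > (0 : ℝ), ∀ (L : ℕ), 1 ≤ L → ∀ {α : Type} [DecidableEq α] (s : Finset α)
      (γ : α → Fin k → ℝ) (β : ℤ → ℂ), (∀ y, ‖β y‖ ≤ 1) → ∀ D : ℝ, 0 ≤ D →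
      (∀ a ∈ s, ∑ a' ∈ s, ∏ j : Fin k, fejer (2 * (hh k * L ^ (j.1 + 1))) (γ a j - γ a' j) ≤ D) →
      ∑ a ∈ s, ‖∑ y ∈ Icc 1 (L : ℤ), β y * e (∑ j : Fin k, γ a j * (y : ℝ) ^ (j.1 + 1))‖ ^ (2 * hh k)
        ≤ C * (L : ℝ) ^ (2 * (hh k : ℝ) + ε) * D := by
  obtain ⟨C, hC, hJ⟩ := vinogradovCount_le hk hε
  have hs := hh_pos hk
  refine ⟨C * (4 * hh k) ^ k, by positivity, fun L hL α _ s γ β hβ D hD0 hD => ?_⟩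
  have hL0 : (0 : ℝ) < L := by exact_mod_cast hL
  set S : α → ℂ := fun a => ∑ y ∈ Icc 1 (L : ℤ), β y * e (∑ j : Fin k, γ a j * (y : ℝ) ^ (j.1 + 1))
    with hSdef
  set ξ : α → ℂ := fun a => (starRingEnd ℂ) (S a ^ hh k) with hξ
  set Z : (Fin k → ℤ) → ℂ := fun h => ∑ a ∈ s, ξ a * e (∑ j, γ a j * h j) with hZ
  set X := ∑ a ∈ s, ‖S a‖ ^ (2 * hh k) with hX
  have hX0 : 0 ≤ X := by positivity
  have hpow : ∀ a, S a ^ hh k = ∑ x ∈ box (hh k) L, (∏ i, β (x i)) *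
      e (∑ j, γ a j * (powerSums k x j : ℤ)) := by
    intro a
    have h1 := prod_univ_sum (fun _ : Fin (hh k) => Icc 1 (L : ℤ)) (fun _ y => β y *
      e (∑ j : Fin k, γ a j * (y : ℝ) ^ (j.1 + 1)))
    rw [prod_const, card_univ, Fintype.card_fin] at h1
    rw [hSdef, h1]
    apply sum_congr rfl
    intro x _
    rw [prod_mul_distrib, ← e_sum]
    congr 2
    rw [sum_comm]
    apply sum_congr rfl
    intro j _
    rw [← mul_sum]
    unfold powerSums
    push_cast
    rfl
  have hXc : (X : ℂ) = ∑ x ∈ box (hh k) L, (∏ i, β (x i)) * Z (powerSums k x) := by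
    rw [hX, Complex.ofReal_sum]
    simp only [hZ, mul_sum]
    rw [sum_comm]
    apply sum_congr rfl
    intro a _
    have h1 : (((‖S a‖ ^ (2 * hh k) : ℝ)) : ℂ) = S a ^ hh k * ξ a := by
      rw [mul_comm 2, pow_mul, ← norm_pow, Complex.ofReal_pow, ← Complex.mul_conj']
    rw [h1, hpow, sum_mul]
    apply sum_congr rfl
    intro x _
    ring
  set I := (box (hh k) L).image (powerSums k) with hI
  have hX1 : X ≤ ∑ h ∈ I, (((box (hh k) L).filter fun x => powerSums k x = h).card : ℝ) * ‖Z h‖ := by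
    calc X = ‖(X : ℂ)‖ := by rw [Complex.norm_real, Real.norm_eq_abs, abs_of_nonneg hX0]
      _ ≤ ∑ x ∈ box (hh k) L, ‖Z (powerSums k x)‖ := by
        rw [hXc]
        refine (norm_sum_le _ _).trans (sum_le_sum fun x _ => ?_)
        rw [norm_mul, norm_prod]
        have : ∏ i, ‖β (x i)‖ ≤ 1 := prod_le_one (fun _ _ => norm_nonneg _) fun _ _ => hβ _
        have := norm_nonneg (Z (powerSums k x))
        nlinarith
      _ = _ := by
        rw [← sum_fiberwise_of_maps_to (t := I) (g := powerSums k)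
          (fun x hx => mem_image_of_mem _ hx)]
        apply sum_congr rfl
        intro h _
        rw [sum_congr rfl (fun x hx => by rw [(mem_filter.1 hx).2]), sum_const, nsmul_eq_mul]
  have hX2 := (pow_le_pow_left₀ hX0 hX1 2).trans (sum_mul_sq_le_sq_mul_sq _ _ _)
  rw [hI, sum_fiber_sq_eq_vinogradovCount] at hX2
  have hX3 := sum_norm_sq_le_of_fejer s γ ξ (fun j => hh k * L ^ (j.1 + 1))
    (fun j => by positivity) I (by
      intro h hh' j
      obtain ⟨x, hx, rfl⟩ := mem_image.1 hh'
      have hx' := Fintype.mem_piFinset.1 hx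
      unfold powerSums
      refine (abs_sum_le_sum_abs _ _).trans ?_
      calc ∑ i, |x i ^ (j.1 + 1)| ≤ ∑ i : Fin (hh k), (L : ℤ) ^ (j.1 + 1) := by
            apply sum_le_sum
            intro i _
            rw [abs_pow]
            have := mem_Icc.1 (hx' i)
            apply pow_le_pow_left₀ (abs_nonneg _)
            rw [abs_of_nonneg (by omega)]
            exact this.2
        _ = _ := by simp) hD
  have hξ2 : ∑ a ∈ s, ‖ξ a‖ ^ 2 = X := by
    rw [hX]
    apply sum_congr rfl
    intro a _
    rw [hξ, Complex.norm_conj, norm_pow, ← pow_mul, mul_comm]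
  have hprod : ∏ j : Fin k, (4 * ((hh k * L ^ (j.1 + 1) : ℕ) : ℝ)) =
      (4 * hh k) ^ k * (L : ℝ) ^ hh k := by
    push_cast
    simp only [← mul_assoc]
    rw [prod_mul_distrib, prod_const, card_univ, Fintype.card_fin, prod_pow_eq_pow_sum]
    congr 2
    rw [Fin.sum_univ_eq_sum_range (fun j => j + 1) k]
    have h1 := sum_range_id_mul_two (k + 1)
    rw [sum_range_succ' (fun i => i)] at h1
    have h2 := two_hh k
    simp only [add_zero, Nat.add_sub_cancel] at h1
    rw [mul_comm (k + 1)] at h1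
    omega
  rw [hξ2, hprod] at hX3
  rcases eq_or_lt_of_le hX0 with h0 | h0
  · rw [← h0]
    positivity
  · have h4 : X * X ≤ (C * (L : ℝ) ^ ((hh k : ℝ) + ε)) *
        ((4 * hh k) ^ k * (L : ℝ) ^ hh k * D) * X := by
      have := hJ L hL
      calc X * X = X ^ 2 := by ring
        _ ≤ _ := hX2
        _ ≤ (C * (L : ℝ) ^ ((hh k : ℝ) + ε)) * ((4 * hh k) ^ k * (L : ℝ) ^ hh k * D * X) := by
          gcongr
        _ = _ := by ring
    refine (le_of_mul_le_mul_right h4 h0).trans (le_of_eq ?_)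
    have hL2 : (L : ℝ) ^ (2 * (hh k : ℝ) + ε) =
        (L : ℝ) ^ ((hh k : ℝ) + ε) * (L : ℝ) ^ (hh k) := by
      rw [← Real.rpow_natCast, ← Real.rpow_add hL0]
      congr 1
      ring
    rw [hL2]
    ring

end VinogradovMean

namespace VinogradovMean

lemma min_one_sq_le_telescope {D : ℝ} (hD : 0 < D) (n : ℕ) :
    min 1 ((D / ((n + 1 : ℕ) : ℝ)) ^ 2) ≤
      4 * D ^ 2 / ((n : ℝ) + D) - 4 * D ^ 2 / (((n + 1 : ℕ) : ℝ) + D) := by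
  have hn : (0 : ℝ) ≤ n := n.cast_nonneg
  push_cast
  have h1 : 4 * D ^ 2 / ((n : ℝ) + D) - 4 * D ^ 2 / ((n : ℝ) + 1 + D) =
      4 * D ^ 2 / (((n : ℝ) + D) * ((n : ℝ) + 1 + D)) := by
    field_simp
    ring
  rw [h1]
  rcases le_total ((n : ℝ) + 1) D with h | h
  · refine (min_le_left _ _).trans ?_
    rw [le_div_iff₀ (by positivity)]
    nlinarith
  · refine (min_le_right _ _).trans ?_
    rw [div_pow, div_le_div_iff₀ (by positivity) (by positivity)]
    have : ((n : ℝ) + D) * ((n : ℝ) + 1 + D) ≤ 4 * ((n : ℝ) + 1) ^ 2 := by nlinarith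
    nlinarith [sq_nonneg D]

lemma sum_range_min_one_sq_le {D : ℝ} (hD : 0 < D) (M : ℕ) :
    ∑ n ∈ range M, min 1 ((D / ((n + 1 : ℕ) : ℝ)) ^ 2) ≤ 4 * D := by
  refine (sum_le_sum fun n _ => min_one_sq_le_telescope hD n).trans ?_
  rw [sum_range_sub' (fun n : ℕ => 4 * D ^ 2 / ((n : ℝ) + D))]
  have h1 : 4 * D ^ 2 / (((0 : ℕ) : ℝ) + D) = 4 * D := by
    push_cast
    field_simp
    ring
  have h2 : (0 : ℝ) ≤ 4 * D ^ 2 / ((M : ℝ) + D) := by positivity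
  linarith

lemma sum_min_one_sq_le {D : ℝ} (hD : 0 < D) (s : Finset ℕ) (a : ℕ) :
    ∑ a' ∈ s, min 1 ((D / |(a : ℝ) - a'|) ^ 2) ≤ 8 * D := by
  obtain ⟨M, hM⟩ := s.exists_nat_subset_range
  have hsub : s ⊆ range (a + (M + 1)) := hM.trans (range_mono (by omega))
  refine (sum_le_sum_of_subset_of_nonneg hsub fun _ _ _ => by positivity).trans ?_
  rw [sum_range_add, sum_range_succ', ← sum_range_reflect]
  have h1 : ∑ j ∈ range a, min 1 ((D / |(a : ℝ) - ((a - 1 - j : ℕ) : ℝ)|) ^ 2) ≤ 4 * D := by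
    refine le_of_eq_of_le (sum_congr rfl fun j hj => ?_) (sum_range_min_one_sq_le hD a)
    have := mem_range.1 hj
    rw [Nat.cast_sub (by omega), Nat.cast_sub (by omega)]
    congr 4
    rw [show (a : ℝ) - (a - (1 : ℕ) - j) = ((j + 1 : ℕ) : ℝ) by push_cast; ring, Nat.abs_cast]
  have h2 : ∑ j ∈ range M, min 1 ((D / |(a : ℝ) - ((a + (j + 1) : ℕ) : ℝ)|) ^ 2) ≤ 4 * D := by
    refine le_of_eq_of_le (sum_congr rfl fun j hj => ?_) (sum_range_min_one_sq_le hD M)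
    congr 4
    rw [show (a : ℝ) - ((a + (j + 1) : ℕ) : ℝ) = -((j + 1 : ℕ) : ℝ) by push_cast; ring, abs_neg,
      Nat.abs_cast]
  have h3 : min 1 ((D / |(a : ℝ) - ((a + 0 : ℕ) : ℝ)|) ^ 2) = 0 := by simp
  linarith

lemma fejer_le_min {H : ℕ} (hH : 0 < H) {x D n : ℝ} (hx : |x| ≤ 1 / 2)
    (hn : 0 < n) (h : n ≤ 2 * D * (H * |x|)) : fejer H x ≤ min 1 ((D / n) ^ 2) := by
  have hx0 : x ≠ 0 := by
    rintro rfl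
    simp at h
    linarith
  have hH' : (0 : ℝ) < H := by exact_mod_cast hH
  have := abs_pos.2 hx0
  refine le_min (fejer_le_one _ _) ((fejer_le hH hx hx0).trans ?_)
  rw [div_pow, div_le_div_iff₀ (by positivity) (by positivity), one_mul, ← mul_pow]
  apply pow_le_pow_left₀ hn.le
  linarith

/-- Counting with one spaced coordinate. -/
lemma sum_kernel_le_one {k : ℕ} (i : Fin k) (s : Finset ℕ) (γ : ℕ → Fin k → ℝ) (H : Fin k → ℕ)
    (hH : ∀ j, 0 < H j) {D : ℝ} (hD : 0 < D)
    (hsmall : ∀ a ∈ s, ∀ a' ∈ s, |γ a i - γ a' i| ≤ 1 / 2)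
    (hsp : ∀ a ∈ s, ∀ a' ∈ s, |(a : ℝ) - a'| ≤ 2 * D * (H i * |γ a i - γ a' i|)) :
    ∀ a ∈ s, ∑ a' ∈ s, ∏ j, fejer (H j) (γ a j - γ a' j) ≤ 1 + 8 * D := by
  intro a ha
  have key : ∀ a' ∈ s, ∏ j, fejer (H j) (γ a j - γ a' j) ≤
      (if a' = a then 1 else 0) + min 1 ((D / |(a : ℝ) - a'|) ^ 2) := by
    intro a' ha'
    split_ifs with h
    · have h1 : ∏ j, fejer (H j) (γ a j - γ a' j) ≤ 1 :=
        prod_le_one (fun _ _ => fejer_nonneg _ _) fun j _ => fejer_le_one _ _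
      have h2 : (0 : ℝ) ≤ min 1 ((D / |(a : ℝ) - a'|) ^ 2) := by positivity
      linarith
    · rw [zero_add, ← mul_prod_erase univ _ (mem_univ i)]
      have h1 : ∏ j ∈ univ.erase i, fejer (H j) (γ a j - γ a' j) ≤ 1 :=
        prod_le_one (fun _ _ => fejer_nonneg _ _) fun j _ => fejer_le_one _ _
      refine (mul_le_of_le_one_right (fejer_nonneg _ _) h1).trans ?_
      refine fejer_le_min (hH i) (hsmall a ha a' ha') ?_ (hsp a ha a' ha')
      rw [abs_pos, sub_ne_zero]
      exact fun h' => h (Nat.cast_injective h').symm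
  refine (sum_le_sum key).trans ?_
  rw [sum_add_distrib, sum_ite_eq' s a, if_pos ha]
  have := sum_min_one_sq_le hD s a
  linarith

/-- Counting with two coordinates, the second one spaced only up to distance `W`. -/
lemma sum_kernel_le_two {k : ℕ} (i i' : Fin k) (s : Finset ℕ) (γ : ℕ → Fin k → ℝ)
    (H : Fin k → ℕ) (hH : ∀ j, 0 < H j) {D D' W : ℝ} (hD : 0 < D) (hD' : 0 < D') (hW : 0 < W)
    (hsmall : ∀ a ∈ s, ∀ a' ∈ s, |γ a i - γ a' i| ≤ 1 / 2)
    (hsp : ∀ a ∈ s, ∀ a' ∈ s, |(a : ℝ) - a'| ≤ 2 * D * (H i * |γ a i - γ a' i|))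
    (hsmall' : ∀ a ∈ s, ∀ a' ∈ s, |(a : ℝ) - a'| ≤ W → |γ a i' - γ a' i'| ≤ 1 / 2)
    (hsp' : ∀ a ∈ s, ∀ a' ∈ s, |(a : ℝ) - a'| ≤ 2 * D' * (H i' * |γ a i' - γ a' i'|)) :
    ∀ a ∈ s, ∑ a' ∈ s, ∏ j, fejer (H j) (γ a j - γ a' j) ≤ 1 + 8 * D' + 8 * (D ^ 2 / W) := by
  intro a ha
  have key : ∀ a' ∈ s, ∏ j, fejer (H j) (γ a j - γ a' j) ≤
      (if a' = a then 1 else 0) + min 1 ((D' / |(a : ℝ) - a'|) ^ 2) +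
        (D / W) ^ 2 * min 1 ((W / |(a : ℝ) - a'|) ^ 2) := by
    intro a' ha'
    have h1 : ∀ t : Finset (Fin k), ∏ j ∈ t, fejer (H j) (γ a j - γ a' j) ≤ 1 := fun t =>
      prod_le_one (fun _ _ => fejer_nonneg _ _) fun j _ => fejer_le_one _ _
    have h2 : (0 : ℝ) ≤ min 1 ((D' / |(a : ℝ) - a'|) ^ 2) := by positivity
    have h3 : (0 : ℝ) ≤ (D / W) ^ 2 * min 1 ((W / |(a : ℝ) - a'|) ^ 2) := by positivity
    split_ifs with h
    · have := h1 univ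
      linarith
    · have hpos : 0 < |(a : ℝ) - a'| := by
        rw [abs_pos, sub_ne_zero]
        exact fun h' => h (Nat.cast_injective h').symm
      have hle : ∀ l, ∏ j, fejer (H j) (γ a j - γ a' j) ≤ fejer (H l) (γ a l - γ a' l) := by
        intro l
        rw [← mul_prod_erase univ _ (mem_univ l)]
        exact mul_le_of_le_one_right (fejer_nonneg _ _) (h1 _)
      rcases le_or_gt |(a : ℝ) - a'| W with hW' | hW'
      · have := (hle i').trans (fejer_le_min (hH i') (hsmall' a ha a' ha' hW') hpos
          (hsp' a ha a' ha'))
        linarith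
      · have h4 := (hle i).trans (fejer_le_min (hH i) (hsmall a ha a' ha') hpos
          (hsp a ha a' ha'))
        have h5 := h4.trans (min_le_right _ _)
        rw [min_eq_right (a := (1 : ℝ)) (b := (W / |(a : ℝ) - a'|) ^ 2), ← mul_pow,
          div_mul_div_cancel₀ hW.ne']
        · linarith
        · apply pow_le_one₀ (by positivity)
          rw [div_le_one hpos]
          exact hW'.le
  refine (sum_le_sum key).trans ?_
  rw [sum_add_distrib, sum_add_distrib, sum_ite_eq' s a, if_pos ha, ← mul_sum]
  have h1 := sum_min_one_sq_le hD' s a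
  have h2 := mul_le_mul_of_nonneg_left (sum_min_one_sq_le hW s a) (sq_nonneg (D / W))
  have h3 : (D / W) ^ 2 * (8 * W) = 8 * (D ^ 2 / W) := by field_simp
  linarith

/-- The large sieve combined with Hölder's inequality. -/
lemma sum_norm_pow_le {k : ℕ} (hk : 1 ≤ k) {ε : ℝ} (hε : 0 < ε) :
    ∃ C > 0, ∀ L : ℕ, 1 ≤ L → ∀ (s : Finset ℕ) (γ : ℕ → Fin k → ℝ) (β : ℤ → ℂ),
      (∀ y, ‖β y‖ ≤ 1) → ∀ D A : ℝ, 0 ≤ D → (s.card : ℝ) ≤ A →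
      (∀ a ∈ s, ∑ a' ∈ s, ∏ j : Fin k, fejer (2 * (hh k * L ^ (j.1 + 1))) (γ a j - γ a' j) ≤ D) →
      (∑ a ∈ s, ‖∑ y ∈ Icc 1 (L : ℤ), β y * e (∑ j, γ a j * (y : ℝ) ^ (j.1 + 1))‖) ^ (2 * hh k) ≤
        C * A ^ (2 * hh k - 1) * (L : ℝ) ^ (2 * (hh k : ℝ) + ε) * D := by
  obtain ⟨C, hC, hmain⟩ := large_sieve hk hε
  refine ⟨C, hC, fun L hL s γ β hβ D A hD hA hs => ?_⟩
  have h1 := hmain L hL s γ β hβ D hD hs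
  have hP := hh_pos hk
  obtain ⟨n, hn⟩ : ∃ n, 2 * hh k = n + 1 := ⟨2 * hh k - 1, by omega⟩
  rcases s.eq_empty_or_nonempty with rfl | hne
  · have hA' : 0 ≤ A := by simpa using hA
    rw [sum_empty, zero_pow (by omega)]
    positivity
  · have hc : (0 : ℝ) < s.card := by exact_mod_cast hne.card_pos
    have h2 := pow_sum_div_card_le_sum_pow (s := s) (f := fun a =>
      ‖∑ y ∈ Icc 1 (L : ℤ), β y * e (∑ j, γ a j * (y : ℝ) ^ (j.1 + 1))‖)
      (fun _ _ => norm_nonneg _) n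
    rw [div_le_iff₀ (by positivity), ← hn] at h2
    refine h2.trans ?_
    calc _ ≤ (C * (L : ℝ) ^ (2 * (hh k : ℝ) + ε) * D) * A ^ n := by gcongr
      _ = _ := by rw [hn, Nat.add_sub_cancel]; ring

end VinogradovMean

namespace VinogradovMean

/-- The generalized binomial coefficient `θ (θ - 1) ⋯ (θ - j + 1) / j!`. -/
def gbinom : ℕ → ℝ → ℝ
  | 0, _ => 1
  | j + 1, θ => θ / (j + 1) * gbinom j (θ - 1)

lemma gbinom_ne_zero (j : ℕ) : ∀ θ : ℝ, (∀ z : ℤ, (z : ℝ) ≠ θ) → gbinom j θ ≠ 0 := by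
  induction j with
  | zero => intro θ _; simp [gbinom]
  | succ j ih =>
    intro θ h
    have h0 : θ ≠ 0 := fun h' => h 0 (by simp [h'])
    have h1 := ih (θ - 1) fun z hz => h (z + 1) (by push_cast; linarith)
    have h2 : (j : ℝ) + 1 ≠ 0 := by positivity
    simp only [gbinom]
    positivity

lemma hasDerivAt_one_add_rpow_sub (k : ℕ) (θ : ℝ) {t : ℝ} (ht : 0 ≤ t) :
    HasDerivAt (fun t : ℝ => (1 + t) ^ θ - ∑ j ∈ range (k + 1), gbinom j θ * t ^ j)
      (θ * ((1 + t) ^ (θ - 1) - ∑ j ∈ range k, gbinom j (θ - 1) * t ^ j)) t := by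
  have h1 : HasDerivAt (fun t : ℝ => (1 + t) ^ θ) (θ * (1 + t) ^ (θ - 1)) t := by
    have := ((hasDerivAt_id t).const_add 1).rpow_const (p := θ) (Or.inl (by simp; linarith))
    simpa using this
  have h2 : HasDerivAt (fun t : ℝ => ∑ j ∈ range (k + 1), gbinom j θ * t ^ j)
      (∑ j ∈ range (k + 1), gbinom j θ * (j * t ^ (j - 1))) t :=
    HasDerivAt.fun_sum fun j _ => (hasDerivAt_pow j t).const_mul _
  refine (h1.sub h2).congr_deriv ?_
  rw [mul_sub, mul_sum, sum_range_succ']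
  simp only [CharP.cast_eq_zero, zero_mul, mul_zero, add_zero, Nat.add_sub_cancel]
  congr 1
  apply sum_congr rfl
  intro j _
  simp only [gbinom]
  push_cast
  field_simp

/-- Taylor's formula for `(1 + t) ^ θ` on `[0, 1]`. -/
lemma abs_one_add_rpow_sub_le (k : ℕ) : ∀ θ : ℝ, ∃ C > 0, ∀ t : ℝ, 0 ≤ t → t ≤ 1 →
    |(1 + t) ^ θ - ∑ j ∈ range k, gbinom j θ * t ^ j| ≤ C * t ^ k := by
  induction k with
  | zero =>
    intro θ
    refine ⟨2 ^ |θ|, by positivity, fun t h0 h1 => ?_⟩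
    simp only [range_zero, sum_empty, sub_zero, pow_zero, mul_one]
    rw [abs_of_nonneg (by positivity)]
    calc (1 + t) ^ θ ≤ (1 + t) ^ |θ| :=
          Real.rpow_le_rpow_of_exponent_le (by linarith) (le_abs_self _)
      _ ≤ 2 ^ |θ| := Real.rpow_le_rpow (by linarith) (by linarith) (abs_nonneg _)
  | succ k ih =>
    intro θ
    obtain ⟨C, hC, h⟩ := ih (θ - 1)
    refine ⟨(|θ| + 1) * C, by positivity, fun t h0 h1 => ?_⟩
    have := Convex.norm_image_sub_le_of_norm_hasDerivWithin_le
      (f := fun t : ℝ => (1 + t) ^ θ - ∑ j ∈ range (k + 1), gbinom j θ * t ^ j)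
      (s := Set.Icc 0 t) (C := (|θ| + 1) * C * t ^ k)
      (fun u hu => (hasDerivAt_one_add_rpow_sub k θ hu.1).hasDerivWithinAt)
      (fun u hu => by
        rw [norm_mul, Real.norm_eq_abs, Real.norm_eq_abs, mul_assoc]
        have h2 := h u hu.1 (hu.2.trans h1)
        have h3 : u ^ k ≤ t ^ k := pow_le_pow_left₀ hu.1 hu.2 k
        have h4 : C * u ^ k ≤ C * t ^ k := by gcongr
        have := abs_nonneg ((1 + u) ^ (θ - 1) - ∑ j ∈ range k, gbinom j (θ - 1) * u ^ j)
        have := abs_nonneg θ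
        nlinarith)
      (convex_Icc 0 t) (Set.left_mem_Icc.2 h0) (Set.right_mem_Icc.2 h0)
    have hz : (1 + (0 : ℝ)) ^ θ - ∑ j ∈ range (k + 1), gbinom j θ * (0 : ℝ) ^ j = 0 := by
      rw [sum_range_succ']
      simp [gbinom]
    simp only [hz, sub_zero, Real.norm_eq_abs, abs_of_nonneg h0] at this
    rw [pow_succ, ← mul_assoc]
    exact this

variable {d : ℕ}

lemma tendsto_sum_mul_rpow_sub (c θ : Fin (d + 1) → ℝ) (hθ : StrictMono θ) :
    Tendsto (fun x : ℝ => ∑ i, c i * x ^ (θ i - θ (Fin.last d))) atTop (nhds (c (Fin.last d))) := by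
  have h : ∀ i, Tendsto (fun x : ℝ => c i * x ^ (θ i - θ (Fin.last d))) atTop
      (nhds (if i = Fin.last d then c i else 0)) := by
    intro i
    split_ifs with h
    · subst h
      simp
    · have h1 : 0 < θ (Fin.last d) - θ i := sub_pos.2 (hθ (Fin.lt_last_iff_ne_last.2 h))
      have h2 := (tendsto_rpow_neg_atTop h1).const_mul (c i)
      simpa using h2
  have := tendsto_finsetSum univ fun i _ => h i
  simpa using this

lemma rpow_mem_of_mem {X x : ℝ} (r : ℝ) (hX : 0 < X) (h1 : X ≤ x) (h2 : x ≤ 8 * X) :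
    8 ^ (-|r|) * X ^ r ≤ x ^ r ∧ x ^ r ≤ 8 ^ |r| * X ^ r := by
  have h3 : 1 ≤ x / X := by rwa [one_le_div hX]
  have h4 : x / X ≤ 8 := by rwa [div_le_iff₀ hX]
  have h5 : x ^ r = (x / X) ^ r * X ^ r := by
    rw [← Real.mul_rpow (by positivity) hX.le, div_mul_cancel₀ _ hX.ne']
  have h6 : (x / X) ^ |r| ≤ 8 ^ |r| := Real.rpow_le_rpow (by linarith) h4 (abs_nonneg _)
  rw [h5]
  constructor
  · gcongr
    calc (8 : ℝ) ^ (-|r|) ≤ (x / X) ^ (-|r|) := by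
          rw [Real.rpow_neg (by norm_num), Real.rpow_neg (by linarith)]
          gcongr
      _ ≤ _ := Real.rpow_le_rpow_of_exponent_le h3 (neg_abs_le r)
  · gcongr
    exact (Real.rpow_le_rpow_of_exponent_le h3 (le_abs_self r)).trans h6

/-- A generalized polynomial is bi-Lipschitz, up to a power, on intervals `[X, 8 * X]`. -/
lemma sum_rpow_biLipschitz (c θ : Fin (d + 1) → ℝ) (hθ : StrictMono θ) (s : ℝ)
    (hc : c (Fin.last d) * (θ (Fin.last d) - s) ≠ 0) :
    ∃ C ≥ (1 : ℝ), ∀ X ≥ C, ∀ x x' : ℝ, X ≤ x → x ≤ 8 * X → X ≤ x' → x' ≤ 8 * X →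
      C⁻¹ * X ^ (θ (Fin.last d) - s - 1) * |x - x'| ≤
          |∑ i, c i * x ^ (θ i - s) - ∑ i, c i * x' ^ (θ i - s)| ∧
        |∑ i, c i * x ^ (θ i - s) - ∑ i, c i * x' ^ (θ i - s)| ≤
          C * X ^ (θ (Fin.last d) - s - 1) * |x - x'| := by
  set ℓ := c (Fin.last d) * (θ (Fin.last d) - s) with hℓ
  set r := θ (Fin.last d) - s - 1 with hr
  have hlim := (tendsto_sum_mul_rpow_sub (fun i => c i * (θ i - s)) θ hθ).abs
  have hℓ0 : 0 < |ℓ| := abs_pos.2 hc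
  have hev := (hlim.eventually (lt_mem_nhds (show |ℓ| / 2 < |ℓ| by linarith))).and
    (hlim.eventually (gt_mem_nhds (show |ℓ| < 2 * |ℓ| by linarith)))
  obtain ⟨x₀, hx₀⟩ := eventually_atTop.1 hev
  set g : ℝ → ℝ := fun x => ∑ i, c i * x ^ (θ i - s) with hg
  have hder : ∀ x : ℝ, 0 < x → HasDerivAt g
      (x ^ r * ∑ i, c i * (θ i - s) * x ^ (θ i - θ (Fin.last d))) x := by
    intro x hx
    have h1 : HasDerivAt g (∑ i, c i * ((θ i - s) * x ^ (θ i - s - 1))) x :=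
      HasDerivAt.fun_sum fun i _ => (Real.hasDerivAt_rpow_const (Or.inl hx.ne')).const_mul _
    convert h1 using 1
    rw [mul_sum]
    apply sum_congr rfl
    intro i _
    rw [show θ i - s - 1 = r + (θ i - θ (Fin.last d)) by rw [hr]; ring, Real.rpow_add hx]
    ring
  set K : ℝ := 8 ^ |r| with hK
  have hK0 : 0 < K := by positivity
  set C := max (max 1 x₀) (max (K * (2 * |ℓ|)) (K * (2 / |ℓ|))) with hC
  have hC1 : 1 ≤ C := (le_max_left _ _).trans (le_max_left _ _)
  have hC2 : x₀ ≤ C := (le_max_right _ _).trans (le_max_left _ _)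
  have hC3 : K * (2 * |ℓ|) ≤ C := (le_max_left _ _).trans (le_max_right _ _)
  have hC4 : K * (2 / |ℓ|) ≤ C := (le_max_right _ _).trans (le_max_right _ _)
  refine ⟨C, hC1, ?_⟩
  have main : ∀ X ≥ C, ∀ x x' : ℝ, X ≤ x → x ≤ 8 * X → X ≤ x' → x' ≤ 8 * X → x < x' →
      C⁻¹ * X ^ r * |x - x'| ≤ |g x - g x'| ∧ |g x - g x'| ≤ C * X ^ r * |x - x'| := by
    intro X hX x x' h1 h2 h3 h4 hlt
    have hX0 : 0 < X := by linarith
    obtain ⟨y, hy, hy'⟩ := exists_hasDerivAt_eq_slope g _ hlt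
      (fun y hy => (hder y (by linarith [hy.1])).continuousAt.continuousWithinAt)
      (fun y hy => hder y (by linarith [hy.1]))
    rw [eq_div_iff (by linarith)] at hy'
    have hgx : |g x - g x'| = y ^ r * |∑ i, c i * (θ i - s) * y ^ (θ i - θ (Fin.last d))| *
        |x - x'| := by
      have : 0 < y := by linarith [hy.1]
      rw [abs_sub_comm, ← hy', abs_mul, abs_mul, abs_of_pos (Real.rpow_pos_of_pos this _),
        abs_sub_comm x]
    have hq := hx₀ y (by linarith [hy.1])
    have hp := rpow_mem_of_mem r hX0 (h1.trans hy.1.le) (hy.2.le.trans h4)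
    have hXr : 0 < X ^ r := by positivity
    rw [hgx]
    constructor
    · refine mul_le_mul_of_nonneg_right ?_ (abs_nonneg _)
      calc C⁻¹ * X ^ r ≤ (K * (2 / |ℓ|))⁻¹ * X ^ r := by gcongr
        _ = 8 ^ (-|r|) * X ^ r * (|ℓ| / 2) := by
          rw [Real.rpow_neg (by norm_num)]
          change _ = K⁻¹ * X ^ r * (|ℓ| / 2)
          field_simp
        _ ≤ _ := mul_le_mul hp.1 hq.1.le (by positivity) (by
          have : 0 < y := by linarith [hy.1]
          positivity)
    · refine mul_le_mul_of_nonneg_right ?_ (abs_nonneg _)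
      calc _ ≤ (8 ^ |r| * X ^ r) * (2 * |ℓ|) :=
            mul_le_mul hp.2 hq.2.le (abs_nonneg _) (by positivity)
        _ = K * (2 * |ℓ|) * X ^ r := by ring
        _ ≤ _ := by gcongr
  intro X hX x x' h1 h2 h3 h4
  rcases lt_trichotomy x x' with h | h | h
  · exact main X hX x x' h1 h2 h3 h4 h
  · subst h
    simp
  · have := main X hX x' x h3 h4 h1 h2 h
    rw [abs_sub_comm x x', abs_sub_comm (∑ i, c i * x ^ (θ i - s))]
    exact this

/-- The pseudo polynomial with coefficients `α` and exponents `θ`. -/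
def ppoly (α θ : Fin (d + 1) → ℝ) (x : ℝ) : ℝ := ∑ i, α i * x ^ θ i

/-- The `j`-th Taylor coefficient `x ^ j f^{(j)}(x) / j!` of a pseudo polynomial. -/
def taylorCoeff (α θ : Fin (d + 1) → ℝ) (j : ℕ) (x : ℝ) : ℝ :=
  ∑ i, α i * gbinom j (θ i) * x ^ θ i

lemma abs_ppoly_sub_taylor_le (α θ : Fin (d + 1) → ℝ) (hα : ∀ i, 0 < α i) (hθ : StrictMono θ)
    (k : ℕ) :
    ∃ C > 0, ∀ x t : ℝ, 1 ≤ x → 0 ≤ t → t ≤ 1 →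
      |ppoly α θ (x * (1 + t)) - ∑ j ∈ range k, taylorCoeff α θ j x * t ^ j| ≤
        C * x ^ θ (Fin.last d) * t ^ k := by
  choose C hC h using fun i => abs_one_add_rpow_sub_le k (θ i)
  refine ⟨∑ i, α i * C i, sum_pos (fun i _ => mul_pos (hα i) (hC i)) univ_nonempty,
    fun x t hx h0 h1 => ?_⟩
  have h2 : ppoly α θ (x * (1 + t)) - ∑ j ∈ range k, taylorCoeff α θ j x * t ^ j =
      ∑ i, α i * x ^ θ i * ((1 + t) ^ θ i - ∑ j ∈ range k, gbinom j (θ i) * t ^ j) := by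
    unfold ppoly taylorCoeff
    simp only [mul_sub, sum_sub_distrib, sum_mul, mul_sum]
    rw [sum_comm]
    congr 1
    · apply sum_congr rfl
      intro i _
      rw [Real.mul_rpow (by linarith) (by linarith)]
      ring
    · apply sum_congr rfl
      intro i _
      apply sum_congr rfl
      intro j _
      ring
  rw [h2, sum_mul, sum_mul]
  refine (abs_sum_le_sum_abs _ _).trans (sum_le_sum fun i _ => ?_)
  rw [abs_mul, abs_of_pos (mul_pos (hα i) (by positivity))]
  have h3 : x ^ θ i ≤ x ^ θ (Fin.last d) :=
    Real.rpow_le_rpow_of_exponent_le hx (hθ.monotone (Fin.le_last i))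
  have := (hα i).le
  calc _ ≤ α i * x ^ θ (Fin.last d) * (C i * t ^ k) := by
        apply mul_le_mul _ (h i t h0 h1) (abs_nonneg _) (by positivity)
        gcongr
    _ = _ := by ring

end VinogradovMean

namespace VinogradovMean

lemma norm_e_sub_e_le (x y : ℝ) : ‖e x - e y‖ ≤ 2 * Real.pi * |x - y| := by
  have h1 : e x - e y = e y *
      (Complex.exp (Complex.I * ((2 * Real.pi * (x - y) : ℝ) : ℂ)) - 1) := by
    have : e x = e y * e (x - y) := by rw [← e_add]; congr 1; ring
    rw [this, mul_sub, mul_one]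
    congr 2
    unfold e
    congr 1
    push_cast
    ring
  rw [h1, norm_mul, norm_e, one_mul]
  refine (Real.norm_exp_I_mul_ofReal_sub_one_le).trans ?_
  rw [Real.norm_eq_abs, abs_mul, abs_of_pos (by positivity)]

variable {d : ℕ}

/-- The coefficient of `y ^ (j + 1)` in the Taylor expansion of `ξ f (a (b + y))`. -/
def blockCoeff (α θ : Fin (d + 1) → ℝ) (ξ : ℝ) (a b j : ℕ) : ℝ :=
  ξ * taylorCoeff α θ (j + 1) (a * b) / (b : ℝ) ^ (j + 1)

lemma taylor_phase_le (α θ : Fin (d + 1) → ℝ) (hα : ∀ i, 0 < α i) (hθ : StrictMono θ)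
    (hΘ : 0 ≤ θ (Fin.last d)) (k : ℕ) :
    ∃ C > 0, ∀ N ≥ (2 : ℝ), ∀ (T ξ : ℝ) (a b y : ℕ), 0 ≤ ξ → N / 2 ≤ (a : ℝ) * b →
      (a : ℝ) * b ≤ 4 * N → (y : ℝ) ≤ T * b → T ≤ 1 →
      |ξ * ppoly α θ (a * (b + y)) - (ξ * taylorCoeff α θ 0 (a * b) +
        ∑ j : Fin k, blockCoeff α θ ξ a b j * (y : ℝ) ^ (j.1 + 1))| ≤
        C * ξ * N ^ θ (Fin.last d) * T ^ (k + 1) := by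
  obtain ⟨C, hC, h⟩ := abs_ppoly_sub_taylor_le α θ hα hθ (k + 1)
  refine ⟨C * 4 ^ θ (Fin.last d), by positivity, fun N hN T ξ a b y hξ h1 h2 h3 h4 => ?_⟩
  have hb : (0 : ℝ) < b := by
    rcases Nat.eq_zero_or_pos b with rfl | hb
    · simp at h1; linarith
    · exact_mod_cast hb
  have hT : (y : ℝ) / b ≤ T := by rwa [div_le_iff₀ hb]
  have h5 := h (a * b) (y / b) (by linarith) (by positivity) (hT.trans h4)
  have h6 : (a : ℝ) * b * (1 + y / b) = a * (b + y) := by field_simp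
  rw [h6, sum_range_succ', pow_zero, mul_one] at h5
  have h7 : ∑ j ∈ range k, taylorCoeff α θ (j + 1) ((a : ℝ) * b) * ((y : ℝ) / b) ^ (j + 1) =
      ∑ j : Fin k, taylorCoeff α θ (j + 1) ((a : ℝ) * b) * ((y : ℝ) / b) ^ (j.1 + 1) :=
    (Fin.sum_univ_eq_sum_range (fun j => taylorCoeff α θ (j + 1) ((a : ℝ) * b) *
      ((y : ℝ) / b) ^ (j + 1)) k).symm
  rw [h7] at h5
  have h8 : ξ * ppoly α θ (a * (b + y)) - (ξ * taylorCoeff α θ 0 (a * b) +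
        ∑ j : Fin k, blockCoeff α θ ξ a b j * (y : ℝ) ^ (j.1 + 1)) =
      ξ * (ppoly α θ (a * (b + y)) - (∑ j : Fin k, taylorCoeff α θ (j + 1) ((a : ℝ) * b) *
        ((y : ℝ) / b) ^ (j.1 + 1) + taylorCoeff α θ 0 (a * b))) := by
    have h9 : ∑ j : Fin k, blockCoeff α θ ξ a b j * (y : ℝ) ^ (j.1 + 1) =
        ξ * ∑ j : Fin k, taylorCoeff α θ (j + 1) ((a : ℝ) * b) * ((y : ℝ) / b) ^ (j.1 + 1) := by
      rw [mul_sum]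
      apply sum_congr rfl
      intro j _
      unfold blockCoeff
      rw [div_pow]
      ring
    rw [h9]
    ring
  rw [h8, abs_mul, abs_of_nonneg hξ]
  calc _ ≤ ξ * (C * ((a : ℝ) * b) ^ θ (Fin.last d) * ((y : ℝ) / b) ^ (k + 1)) := by gcongr
    _ ≤ ξ * (C * (4 * N) ^ θ (Fin.last d) * T ^ (k + 1)) := by gcongr
    _ = _ := by rw [Real.mul_rpow (by norm_num) (by linarith)]; ring

lemma block_core (α θ : Fin (d + 1) → ℝ) (hα : ∀ i, 0 < α i) (hθ : StrictMono θ)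
    (hΘ : 0 ≤ θ (Fin.last d)) {k : ℕ} (hk : 1 ≤ k) {ε ρ : ℝ} (hε : 0 < ε) (hρ : 0 < ρ) {K : ℝ}
    (hK : 1 ≤ K) :
    ∃ C ≥ (1 : ℝ), ∀ N ≥ C, ∀ τ v β μ ξ : ℝ, τ = (k + 1) * v → ρ ≤ 2 * v → v ≤ β → β ≤ 1 →
      ξ = N ^ (τ - ρ - θ (Fin.last d)) → ∀ (s : Finset ℕ) (a b : ℕ → ℕ) (w : ℤ → ℂ),
      (∀ y, ‖w y‖ ≤ 1) →
      (∀ n ∈ s, N / 2 ≤ (a n : ℝ) * b n ∧ (a n : ℝ) * b n ≤ 4 * N ∧ N ^ β / 4 ≤ b n) →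
      (s.card : ℝ) ≤ K * N ^ μ →
      (∀ n ∈ s, ∑ n' ∈ s, ∏ j : Fin k, fejer (2 * (hh k * ⌊N ^ (β - v)⌋₊ ^ (j.1 + 1)))
        (blockCoeff α θ ξ (a n) (b n) j - blockCoeff α θ ξ (a n') (b n') j) ≤
          K * N ^ (μ - ρ * (2 * hh k))) →
      ∑ n ∈ s, ‖∑ y ∈ Icc 1 ⌊N ^ (β - v)⌋₊, w y * e (ξ * ppoly α θ (a n * (b n + y)))‖ ≤
        C * N ^ (μ + β - v - ρ + ε) := by
  obtain ⟨C₁, hC₁, htay⟩ := taylor_phase_le α θ hα hθ hΘ k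
  obtain ⟨C₂, hC₂, hls⟩ := sum_norm_pow_le hk hε
  have hP := hh_pos hk
  set P := 2 * hh k with hPdef
  set C₃ : ℝ := 2 * Real.pi * (C₁ * 4 ^ (k + 1)) with hC₃
  have hC₃0 : 0 < C₃ := by positivity
  set C₄ : ℝ := max 1 (C₂ * K ^ P) with hC₄
  have hC₄1 : 1 ≤ C₄ := le_max_left _ _
  set C := max (max 2 (4 ^ (2 / ρ))) (C₄ + K * C₃) with hC
  have hC2 : 2 ≤ C := (le_max_left _ _).trans (le_max_left _ _)
  have hCρ : (4 : ℝ) ^ (2 / ρ) ≤ C := (le_max_right _ _).trans (le_max_left _ _)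
  have hC5 : C₄ + K * C₃ ≤ C := le_max_right _ _
  refine ⟨C, by linarith, fun N hN τ v β μ ξ hτ hv hvβ hβ hξ s a b w hw hs hcard hD => ?_⟩
  have hN2 : 2 ≤ N := by linarith
  have hN1 : 1 ≤ N := by linarith
  have hN0 : 0 < N := by linarith
  set L := ⌊N ^ (β - v)⌋₊ with hL
  have hLle : (L : ℝ) ≤ N ^ (β - v) := Nat.floor_le (by positivity)
  have hL1 : 1 ≤ L := by
    apply Nat.le_floor
    rw [Nat.cast_one]
    exact Real.one_le_rpow hN1 (by linarith)
  have hL0 : (0 : ℝ) < L := by exact_mod_cast hL1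
  have hNv : 4 ≤ N ^ v := by
    calc (4 : ℝ) = (4 ^ (2 / ρ)) ^ (ρ / 2) := by
          rw [← Real.rpow_mul (by norm_num)]
          field_simp
          simp
      _ ≤ N ^ (ρ / 2) := by
          apply Real.rpow_le_rpow (by positivity) (hCρ.trans hN) (by positivity)
      _ ≤ N ^ v := Real.rpow_le_rpow_of_exponent_le hN1 (by linarith)
  set T : ℝ := 4 * N ^ (-v) with hT
  have hT1 : T ≤ 1 := by
    rw [hT, Real.rpow_neg hN0.le, ← div_eq_mul_inv, div_le_one (by positivity)]
    exact hNv
  have hξ0 : 0 < ξ := by rw [hξ]; positivity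
  set γ : ℕ → Fin k → ℝ := fun n j => blockCoeff α θ ξ (a n) (b n) j with hγ
  have hNT : ξ * N ^ θ (Fin.last d) * T ^ (k + 1) = 4 ^ (k + 1) * N ^ (-ρ) := by
    rw [hξ, hT, ← Real.rpow_add hN0, mul_pow, ← Real.rpow_natCast (N ^ (-v)),
      ← Real.rpow_mul hN0.le, mul_left_comm, ← Real.rpow_add hN0]
    congr 2
    push_cast
    rw [hτ]
    ring
  have hpt : ∀ n ∈ s, ‖∑ y ∈ Icc 1 L, w y * e (ξ * ppoly α θ (a n * (b n + y)))‖ ≤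
      ‖∑ y ∈ Icc 1 (L : ℤ), w y * e (∑ j, γ n j * (y : ℝ) ^ (j.1 + 1))‖ +
        L * (C₃ * N ^ (-ρ)) := by
    intro n hn
    obtain ⟨h1, h2, h3⟩ := hs n hn
    set c := ξ * taylorCoeff α θ 0 (a n * b n) with hc
    have h4 : ‖∑ y ∈ Icc 1 (L : ℤ), w y * e (∑ j, γ n j * (y : ℝ) ^ (j.1 + 1))‖ =
        ‖∑ y ∈ Icc 1 L, w y * e (c + ∑ j, γ n j * (y : ℝ) ^ (j.1 + 1))‖ := by
      have h5 : ∑ y ∈ Icc 1 (L : ℤ), w y * e (∑ j, γ n j * (y : ℝ) ^ (j.1 + 1)) =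
          ∑ y ∈ Icc 1 L, w y * e (∑ j, γ n j * (y : ℝ) ^ (j.1 + 1)) := by
        symm
        apply sum_nbij (fun y : ℕ => (y : ℤ))
        · intro y hy
          have := mem_Icc.1 hy
          exact mem_Icc.2 ⟨by omega, by omega⟩
        · intro x _ y _ h
          exact Nat.cast_injective h
        · intro y hy
          have := mem_Icc.1 (mem_coe.1 hy)
          exact ⟨y.toNat, mem_coe.2 (mem_Icc.2 ⟨by omega, by omega⟩), by simp; omega⟩
        · intro y _
          push_cast
          rfl
      have h6 : ∑ y ∈ Icc 1 L, w y * e (c + ∑ j, γ n j * (y : ℝ) ^ (j.1 + 1)) =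
          e c * ∑ y ∈ Icc 1 L, w y * e (∑ j, γ n j * (y : ℝ) ^ (j.1 + 1)) := by
        rw [mul_sum]
        apply sum_congr rfl
        intro y _
        rw [e_add]
        ring
      rw [h5, h6, norm_mul, norm_e, one_mul]
    rw [h4]
    refine norm_le_norm_add_norm_sub' _ (∑ y ∈ Icc 1 L, w y * e (c + ∑ j, γ n j * (y : ℝ) ^ (j.1 + 1)))
      |>.trans (add_le_add le_rfl ?_)
    rw [← sum_sub_distrib]
    refine (norm_sum_le _ _).trans ?_
    calc _ ≤ ∑ y ∈ Icc 1 L, C₃ * N ^ (-ρ) := by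
          apply sum_le_sum
          intro y hy
          have hy' := mem_Icc.1 hy
          rw [← mul_sub, norm_mul]
          have h7 := norm_e_sub_e_le (ξ * ppoly α θ (a n * (b n + y)))
            (c + ∑ j, γ n j * (y : ℝ) ^ (j.1 + 1))
          have h8 := htay N hN2 T ξ (a n) (b n) y hξ0.le h1 h2 (by
            have : (y : ℝ) ≤ L := by exact_mod_cast hy'.2
            calc (y : ℝ) ≤ N ^ (β - v) := this.trans hLle
              _ = T * (N ^ β / 4) := by
                rw [hT, sub_eq_add_neg, Real.rpow_add hN0]; ring
              _ ≤ _ := by gcongr) hT1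
          have h9 : ‖w y‖ * ‖e (ξ * ppoly α θ (a n * (b n + y))) -
              e (c + ∑ j, γ n j * (y : ℝ) ^ (j.1 + 1))‖ ≤ 1 * (2 * Real.pi *
              (C₁ * ξ * N ^ θ (Fin.last d) * T ^ (k + 1))) := by
            apply mul_le_mul (hw _) _ (norm_nonneg _) zero_le_one
            refine h7.trans ?_
            gcongr
          refine h9.trans (le_of_eq ?_)
          rw [one_mul, hC₃, mul_assoc C₁, mul_assoc C₁, hNT]
          ring
      _ = _ := by simp
  refine (sum_le_sum hpt).trans ?_
  rw [sum_add_distrib, sum_const, nsmul_eq_mul]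
  have hsecond : (s.card : ℝ) * (L * (C₃ * N ^ (-ρ))) ≤ K * C₃ * N ^ (μ + β - v - ρ + ε) := by
    calc _ ≤ (K * N ^ μ) * (N ^ (β - v) * (C₃ * N ^ (-ρ))) := by gcongr
      _ = K * C₃ * N ^ (μ + β - v - ρ) := by
        rw [show μ + β - v - ρ = μ + (β - v) + -ρ by ring, Real.rpow_add hN0, Real.rpow_add hN0]
        ring
      _ ≤ _ := by
        gcongr
        linarith
  have hfirst : ∑ n ∈ s, ‖∑ y ∈ Icc 1 (L : ℤ), w y * e (∑ j, γ n j * (y : ℝ) ^ (j.1 + 1))‖ ≤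
      C₄ * N ^ (μ + β - v - ρ + ε) := by
    have h1 := hls L hL1 s γ w hw (K * N ^ (μ - ρ * P)) (K * N ^ μ) (by positivity) hcard (by
      simpa [hPdef] using hD)
    refine le_of_pow_le_pow_left₀ (n := P) (by omega) (by positivity) (h1.trans ?_)
    have h2 : (L : ℝ) ^ (2 * (hh k : ℝ) + ε) ≤ (N ^ (β - v)) ^ P * N ^ ε := by
      have h3 : (L : ℝ) ≤ N := hLle.trans (by
        calc N ^ (β - v) ≤ N ^ (1 : ℝ) := Real.rpow_le_rpow_of_exponent_le hN1 (by linarith)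
          _ = N := Real.rpow_one _)
      rw [Real.rpow_add hL0, show 2 * (hh k : ℝ) = (P : ℕ) by rw [hPdef]; push_cast; ring,
        Real.rpow_natCast]
      gcongr
    calc _ ≤ C₂ * (K * N ^ μ) ^ (P - 1) * ((N ^ (β - v)) ^ P * N ^ ε) *
          (K * N ^ (μ - ρ * P)) := by gcongr
      _ = C₂ * K ^ P * ((N ^ μ) ^ P * (N ^ (β - v)) ^ P * (N ^ (-ρ)) ^ P * N ^ ε) := by
        obtain ⟨n, hn⟩ : ∃ n, P = n + 1 := ⟨P - 1, by omega⟩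
        have h4 : N ^ (μ - ρ * P) = N ^ μ * (N ^ (-ρ)) ^ P := by
          rw [← Real.rpow_natCast (N ^ (-ρ)), ← Real.rpow_mul hN0.le, ← Real.rpow_add hN0]
          congr 1
          ring
        rw [h4, hn, Nat.add_sub_cancel]
        ring
      _ ≤ C₄ ^ P * ((N ^ μ) ^ P * (N ^ (β - v)) ^ P * (N ^ (-ρ)) ^ P * (N ^ ε) ^ P) := by
        have h5 : C₂ * K ^ P ≤ C₄ ^ P :=
          (le_max_right _ _).trans (le_self_pow₀ hC₄1 (by omega))
        have h6 : N ^ ε ≤ (N ^ ε) ^ P := le_self_pow₀ (Real.one_le_rpow hN1 hε.le) (by omega)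
        gcongr
      _ = _ := by
        rw [show μ + β - v - ρ + ε = μ + (β - v) + -ρ + ε by ring, Real.rpow_add hN0,
          Real.rpow_add hN0, Real.rpow_add hN0]
        ring
  calc _ ≤ C₄ * N ^ (μ + β - v - ρ + ε) + K * C₃ * N ^ (μ + β - v - ρ + ε) := by gcongr
    _ = (C₄ + K * C₃) * N ^ (μ + β - v - ρ + ε) := by ring
    _ ≤ _ := by gcongr

end VinogradovMean

namespace VinogradovMean

variable {d : ℕ}

lemma pow_mem_of_mem {B b : ℝ} (j : ℕ) (hB : 0 < B) (h1 : B / 4 ≤ b) (h2 : b ≤ 4 * B) :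
    (4 ^ j)⁻¹ * (B ^ j)⁻¹ ≤ (b ^ j)⁻¹ ∧ (b ^ j)⁻¹ ≤ 4 ^ j * (B ^ j)⁻¹ := by
  have hb : 0 < b := by linarith
  constructor
  · rw [← mul_inv, ← mul_pow]
    gcongr
  · rw [← inv_pow, ← inv_pow, ← mul_pow]
    apply pow_le_pow_left₀ (by positivity)
    rw [inv_eq_one_div, ← div_eq_mul_inv, div_le_div_iff₀ hb hB]
    linarith

/-- Spacing of the Taylor coefficients in the first factor. -/
lemma blockCoeff_sub_left (α θ : Fin (d + 1) → ℝ) (hα : ∀ i, 0 < α i) (hθ : StrictMono θ)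
    (hz : ∀ z : ℤ, (z : ℝ) ≠ θ (Fin.last d)) (j : ℕ) :
    ∃ C ≥ (1 : ℝ), ∀ N ≥ C, ∀ (β E ξ : ℝ) (a a' b : ℕ), ξ = N ^ E →
      N / 2 ≤ (a : ℝ) * b → (a : ℝ) * b ≤ 4 * N → N / 2 ≤ (a' : ℝ) * b → (a' : ℝ) * b ≤ 4 * N →
      N ^ β / 4 ≤ b → (b : ℝ) ≤ 4 * N ^ β →
      C⁻¹ * N ^ (E + θ (Fin.last d) - 1 - β * j) * |(a : ℝ) - a'| ≤
          |blockCoeff α θ ξ a b j - blockCoeff α θ ξ a' b j| ∧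
        |blockCoeff α θ ξ a b j - blockCoeff α θ ξ a' b j| ≤
          C * N ^ (E + θ (Fin.last d) - 1 - β * j) * |(a : ℝ) - a'| := by
  set Θ := θ (Fin.last d) with hΘ
  obtain ⟨C, hC, h⟩ := sum_rpow_biLipschitz (fun i => α i * gbinom (j + 1) (θ i)) θ hθ 0 (by
    rw [sub_zero]
    exact mul_ne_zero (mul_ne_zero (hα _).ne' (gbinom_ne_zero _ _ hz))
      fun h => hz 0 (by rw [hΘ, h]; simp))
  simp only [sub_zero] at h
  rw [← hΘ] at h
  set M : ℝ := 2 ^ |Θ - 1| with hM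
  have hM1 : 1 ≤ M := Real.one_le_rpow (by norm_num) (abs_nonneg _)
  have h4 : (1 : ℝ) ≤ 4 ^ j := one_le_pow₀ (by norm_num)
  have hCC : 2 * C ≤ 2 * C * M * 4 ^ j := by
    have : 1 ≤ M * 4 ^ j := one_le_mul_of_one_le_of_one_le hM1 h4
    nlinarith
  refine ⟨2 * C * M * 4 ^ j, by linarith, ?_⟩
  intro N hN β E ξ a a' b hξ h1 h2 h1' h2' h3 h3'
  have hN0 : 0 < N := by linarith
  have hB : 0 < N ^ β := by positivity
  have hb : (0 : ℝ) < b := by linarith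
  have hξ0 : 0 < ξ := by rw [hξ]; positivity
  have h5 := h (N / 2) (by linarith) (a * b) (a' * b) h1 (by linarith) h1' (by linarith)
  have h6 : |(a : ℝ) * b - a' * b| = b * |(a : ℝ) - a'| := by
    rw [← sub_mul, abs_mul, abs_of_pos hb, mul_comm]
  have h7 : |blockCoeff α θ ξ a b j - blockCoeff α θ ξ a' b j| = ξ * ((b : ℝ) ^ j)⁻¹ * (b : ℝ)⁻¹ *
      |∑ i, α i * gbinom (j + 1) (θ i) * ((a : ℝ) * b) ^ θ i -
        ∑ i, α i * gbinom (j + 1) (θ i) * ((a' : ℝ) * b) ^ θ i| := by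
    unfold blockCoeff taylorCoeff
    rw [← sub_div, ← mul_sub, abs_div, abs_mul, abs_of_pos hξ0,
      abs_of_pos (show (0 : ℝ) < (b : ℝ) ^ (j + 1) by positivity), pow_succ]
    field_simp
  obtain ⟨p1, p2⟩ := pow_mem_of_mem j hB h3 h3'
  have h8 : N ^ (E + Θ - 1 - β * j) = ξ * ((N ^ β) ^ j)⁻¹ * N ^ (Θ - 1) := by
    rw [show E + Θ - 1 - β * j = E + -(β * j) + (Θ - 1) by ring, Real.rpow_add hN0,
      Real.rpow_add hN0, Real.rpow_neg hN0.le, Real.rpow_mul hN0.le, Real.rpow_natCast, hξ]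
  have h9 : M⁻¹ * N ^ (Θ - 1) ≤ (N / 2) ^ (Θ - 1) ∧ (N / 2) ^ (Θ - 1) ≤ M * N ^ (Θ - 1) := by
    rw [Real.div_rpow hN0.le (by norm_num)]
    have q1 : (2 : ℝ) ^ (Θ - 1) ≤ M :=
      Real.rpow_le_rpow_of_exponent_le (by norm_num) (le_abs_self _)
    have q2 : M⁻¹ ≤ (2 : ℝ) ^ (Θ - 1) := by
      rw [hM, ← Real.rpow_neg (by norm_num)]
      exact Real.rpow_le_rpow_of_exponent_le (by norm_num) (neg_abs_le _)
    have q3 : (0 : ℝ) < 2 ^ (Θ - 1) := by positivity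
    have q4 : 0 < N ^ (Θ - 1) := by positivity
    constructor
    · rw [div_eq_inv_mul]
      gcongr
    · rw [div_eq_inv_mul]
      gcongr
      rw [inv_le_comm₀ q3 (by positivity)]
      exact q2
  rw [h6] at h5
  rw [h7, h8]
  constructor
  · calc _ ≤ ξ * ((4 ^ j)⁻¹ * ((N ^ β) ^ j)⁻¹) * (C⁻¹ * (M⁻¹ * N ^ (Θ - 1)) * |(a : ℝ) - a'|) := by
          have q : (2 * C * M * 4 ^ j)⁻¹ ≤ (4 ^ j)⁻¹ * C⁻¹ * M⁻¹ := by
            rw [← mul_inv, ← mul_inv]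
            apply inv_anti₀ (by positivity)
            have : 0 ≤ C * M * 4 ^ j := by positivity
            nlinarith
          calc _ ≤ ((4 ^ j)⁻¹ * C⁻¹ * M⁻¹) * (ξ * ((N ^ β) ^ j)⁻¹ * N ^ (Θ - 1)) * |(a : ℝ) - a'| := by
                gcongr
            _ = _ := by ring
      _ ≤ ξ * ((b : ℝ) ^ j)⁻¹ * (C⁻¹ * (N / 2) ^ (Θ - 1) * |(a : ℝ) - a'|) := by
          gcongr
          exact h9.1
      _ = ξ * ((b : ℝ) ^ j)⁻¹ * (b : ℝ)⁻¹ * (C⁻¹ * (N / 2) ^ (Θ - 1) * (b * |(a : ℝ) - a'|)) := by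
          field_simp
      _ ≤ _ := by
          gcongr
          exact h5.1
  · calc _ ≤ ξ * ((b : ℝ) ^ j)⁻¹ * (b : ℝ)⁻¹ * (C * (N / 2) ^ (Θ - 1) * (b * |(a : ℝ) - a'|)) := by
          gcongr
          exact h5.2
      _ = ξ * ((b : ℝ) ^ j)⁻¹ * (C * (N / 2) ^ (Θ - 1) * |(a : ℝ) - a'|) := by
          field_simp
      _ ≤ ξ * (4 ^ j * ((N ^ β) ^ j)⁻¹) * (C * (M * N ^ (Θ - 1)) * |(a : ℝ) - a'|) := by
          gcongr
          exact h9.2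
      _ = (C * M * 4 ^ j) * (ξ * ((N ^ β) ^ j)⁻¹ * N ^ (Θ - 1)) * |(a : ℝ) - a'| := by ring
      _ ≤ _ := by
          gcongr
          linarith

/-- Spacing of the Taylor coefficients in the second factor. -/
lemma blockCoeff_sub_right (α θ : Fin (d + 1) → ℝ) (hα : ∀ i, 0 < α i) (hθ : StrictMono θ)
    (hz : ∀ z : ℤ, (z : ℝ) ≠ θ (Fin.last d)) (j : ℕ) :
    ∃ C ≥ (1 : ℝ), ∀ N ≥ C, ∀ (β E ξ : ℝ) (a b b' : ℕ), ξ = N ^ E →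
      N / 2 ≤ (a : ℝ) * b → (a : ℝ) * b ≤ 4 * N → N / 2 ≤ (a : ℝ) * b' → (a : ℝ) * b' ≤ 4 * N →
      N ^ β / 4 ≤ b → (b : ℝ) ≤ 4 * N ^ β →
      C⁻¹ * N ^ (E + θ (Fin.last d) - β * (j + 2)) * |(b : ℝ) - b'| ≤
          |blockCoeff α θ ξ a b j - blockCoeff α θ ξ a b' j| ∧
        |blockCoeff α θ ξ a b j - blockCoeff α θ ξ a b' j| ≤
          C * N ^ (E + θ (Fin.last d) - β * (j + 2)) * |(b : ℝ) - b'| := by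
  set Θ := θ (Fin.last d) with hΘ
  obtain ⟨C, hC, h⟩ := sum_rpow_biLipschitz (fun i => α i * gbinom (j + 1) (θ i)) θ hθ (j + 1) (by
    refine mul_ne_zero (mul_ne_zero (hα _).ne' (gbinom_ne_zero _ _ hz)) (sub_ne_zero.2 ?_)
    have := hz (j + 1)
    push_cast at this
    exact this.symm)
  rw [← hΘ] at h
  set r := Θ - (j + 1) - 1 with hr
  set M : ℝ := 2 ^ |r| with hM
  have hM1 : 1 ≤ M := Real.one_le_rpow (by norm_num) (abs_nonneg _)
  have h4 : (1 : ℝ) ≤ 16 ^ (j + 2) := one_le_pow₀ (by norm_num)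
  have hCC : 2 * C ≤ 2 * C * M * 16 ^ (j + 2) := by
    have : 1 ≤ M * 16 ^ (j + 2) := one_le_mul_of_one_le_of_one_le hM1 h4
    nlinarith
  refine ⟨2 * C * M * 16 ^ (j + 2), by linarith, ?_⟩
  intro N hN β E ξ a b b' hξ h1 h2 h1' h2' h3 h3'
  have hN0 : 0 < N := by linarith
  have hB : 0 < N ^ β := by positivity
  have hb : (0 : ℝ) < b := by linarith
  have ha : (0 : ℝ) < a := by
    by_contra ha
    nlinarith
  have hb' : (0 : ℝ) < b' := by
    by_contra hb'
    nlinarith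
  have hξ0 : 0 < ξ := by rw [hξ]; positivity
  have h5 := h (N / 2) (by linarith) (a * b) (a * b') h1 (by linarith) h1' (by linarith)
  have h6 : |(a : ℝ) * b - a * b'| = a * |(b : ℝ) - b'| := by
    rw [← mul_sub, abs_mul, abs_of_pos ha]
  have hblock : ∀ c : ℕ, (0 : ℝ) < c → blockCoeff α θ ξ a c j = ξ * (a : ℝ) ^ (j + 1) *
      ∑ i, α i * gbinom (j + 1) (θ i) * ((a : ℝ) * c) ^ (θ i - (j + 1)) := by
    intro c hc
    unfold blockCoeff taylorCoeff
    rw [mul_div_assoc, mul_assoc, sum_div]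
    congr 1
    rw [mul_sum]
    apply sum_congr rfl
    intro i _
    have : ((a : ℝ) * c) ^ ((j : ℝ) + 1) = (a : ℝ) ^ (j + 1) * (c : ℝ) ^ (j + 1) := by
      rw [← mul_pow, ← Real.rpow_natCast]
      push_cast
      rfl
    rw [Real.rpow_sub (by positivity), this]
    field_simp
  have h7 : |blockCoeff α θ ξ a b j - blockCoeff α θ ξ a b' j| = ξ * (a : ℝ) ^ (j + 1) *
      |∑ i, α i * gbinom (j + 1) (θ i) * ((a : ℝ) * b) ^ (θ i - (j + 1)) -
        ∑ i, α i * gbinom (j + 1) (θ i) * ((a : ℝ) * b') ^ (θ i - (j + 1))| := by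
    rw [hblock b hb, hblock b' hb', ← mul_sub, abs_mul, abs_of_pos (by positivity)]
  set A := N ^ (1 - β) with hA
  have hA0 : 0 < A := by positivity
  have hAB : A * N ^ β = N := by
    rw [hA, ← Real.rpow_add hN0, sub_add_cancel, Real.rpow_one]
  have ha1 : A / 16 ≤ a := by
    by_contra hlt
    push Not at hlt
    have : (a : ℝ) * b ≤ (A / 16) * (4 * N ^ β) := mul_le_mul hlt.le h3' hb.le (by positivity)
    have h8 : (A / 16) * (4 * N ^ β) = N / 4 := by linear_combination (1 / 4 : ℝ) * hAB
    linarith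
  have ha2 : (a : ℝ) ≤ 16 * A := by
    by_contra hlt
    push Not at hlt
    have h8 : (16 * A) * (N ^ β / 4) = 4 * N := by linear_combination (4 : ℝ) * hAB
    have : (16 * A) * (N ^ β / 4) < a * b := mul_lt_mul hlt h3 (by positivity) ha.le
    linarith
  have p1 : A ^ (j + 2) * (16 ^ (j + 2))⁻¹ ≤ (a : ℝ) ^ (j + 2) := by
    rw [← div_eq_mul_inv, ← div_pow]
    gcongr
  have p2 : (a : ℝ) ^ (j + 2) ≤ 16 ^ (j + 2) * A ^ (j + 2) := by
    rw [← mul_pow]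
    gcongr
  have h8 : N ^ (E + Θ - β * (j + 2)) = ξ * A ^ (j + 2) * N ^ r := by
    rw [hA, ← Real.rpow_natCast, ← Real.rpow_mul hN0.le, hξ, ← Real.rpow_add hN0,
      ← Real.rpow_add hN0]
    congr 1
    rw [hr]
    push_cast
    ring
  have h9 : M⁻¹ * N ^ r ≤ (N / 2) ^ r ∧ (N / 2) ^ r ≤ M * N ^ r := by
    rw [Real.div_rpow hN0.le (by norm_num)]
    have q1 : (2 : ℝ) ^ r ≤ M :=
      Real.rpow_le_rpow_of_exponent_le (by norm_num) (le_abs_self _)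
    have q2 : M⁻¹ ≤ (2 : ℝ) ^ r := by
      rw [hM, ← Real.rpow_neg (by norm_num)]
      exact Real.rpow_le_rpow_of_exponent_le (by norm_num) (neg_abs_le _)
    have q3 : (0 : ℝ) < 2 ^ r := by positivity
    have q4 : 0 < N ^ r := by positivity
    constructor
    · rw [div_eq_inv_mul]
      gcongr
    · rw [div_eq_inv_mul]
      gcongr
      rw [inv_le_comm₀ q3 (by positivity)]
      exact q2
  rw [h6] at h5
  rw [h7, h8]
  constructor
  · calc _ ≤ ξ * (A ^ (j + 2) * (16 ^ (j + 2))⁻¹) * (C⁻¹ * (M⁻¹ * N ^ r) * |(b : ℝ) - b'|) := by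
          have q : (2 * C * M * 16 ^ (j + 2))⁻¹ ≤ (16 ^ (j + 2))⁻¹ * C⁻¹ * M⁻¹ := by
            rw [← mul_inv, ← mul_inv]
            apply inv_anti₀ (by positivity)
            have : 0 ≤ C * M * 16 ^ (j + 2) := by positivity
            nlinarith
          calc _ ≤ ((16 ^ (j + 2))⁻¹ * C⁻¹ * M⁻¹) * (ξ * A ^ (j + 2) * N ^ r) *
                |(b : ℝ) - b'| := by gcongr
            _ = _ := by ring
      _ ≤ ξ * (a : ℝ) ^ (j + 2) * (C⁻¹ * (N / 2) ^ r * |(b : ℝ) - b'|) := by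
          gcongr
          exact h9.1
      _ = ξ * (a : ℝ) ^ (j + 1) * (C⁻¹ * (N / 2) ^ r * (a * |(b : ℝ) - b'|)) := by ring
      _ ≤ _ := by
          gcongr
          exact h5.1
  · calc _ ≤ ξ * (a : ℝ) ^ (j + 1) * (C * (N / 2) ^ r * (a * |(b : ℝ) - b'|)) := by
          gcongr
          exact h5.2
      _ = ξ * (a : ℝ) ^ (j + 2) * (C * (N / 2) ^ r * |(b : ℝ) - b'|) := by ring
      _ ≤ ξ * (16 ^ (j + 2) * A ^ (j + 2)) * (C * (M * N ^ r) * |(b : ℝ) - b'|) := by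
          gcongr
          exact h9.2
      _ = (C * M * 16 ^ (j + 2)) * (ξ * A ^ (j + 2) * N ^ r) * |(b : ℝ) - b'| := by ring
      _ ≤ _ := by
          gcongr
          linarith

end VinogradovMean

namespace VinogradovMean

variable {d : ℕ}

lemma half_le_floor {x : ℝ} (hx : 1 ≤ x) : x / 2 ≤ (⌊x⌋₊ : ℝ) := by
  have h1 := Nat.lt_floor_add_one x
  have h2 : 1 ≤ ⌊x⌋₊ := Nat.le_floor (by simpa using hx)
  have h3 : (1 : ℝ) ≤ ⌊x⌋₊ := by exact_mod_cast h2
  linarith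

lemma le_two_mul_of_spacing {N C₀ δ E n g : ℝ} {L c : ℕ} (j : ℕ) (hN : 0 < N) (hC₀ : 1 ≤ C₀)
    (hL : N ^ δ / 2 ≤ L) (hc : 1 ≤ c) (hn : 0 ≤ n) (hg : C₀⁻¹ * N ^ E * n ≤ g) :
    n ≤ 2 * (C₀ * 2 ^ (j + 1) * N ^ (-E - δ * (j + 1))) *
      (((2 * (c * L ^ (j + 1)) : ℕ) : ℝ) * g) := by
  have hc' : (1 : ℝ) ≤ c := by exact_mod_cast hc
  have h1 : N ^ (-E - δ * (j + 1)) = (N ^ E)⁻¹ * ((N ^ δ) ^ (j + 1))⁻¹ := by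
    rw [sub_eq_add_neg, Real.rpow_add hN, Real.rpow_neg hN.le, Real.rpow_neg hN.le,
      Real.rpow_mul hN.le, ← Real.rpow_natCast (N ^ δ)]
    push_cast
    rfl
  have hE : 0 < N ^ E := by positivity
  have hδ : 0 < N ^ δ := by positivity
  have h2 : (N ^ δ) ^ (j + 1) / 2 ^ (j + 1) ≤ (L : ℝ) ^ (j + 1) := by
    rw [← div_pow]
    gcongr
  have hC₀' : 0 < C₀ := by linarith
  have h3 : (N ^ δ) ^ (j + 1) / 2 ^ (j + 1) * (C₀⁻¹ * N ^ E * n) ≤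
      ((2 * (c * L ^ (j + 1)) : ℕ) : ℝ) * g := by
    apply mul_le_mul _ hg (by positivity) (by positivity)
    refine h2.trans ?_
    push_cast
    have : (0 : ℝ) ≤ (L : ℝ) ^ (j + 1) := by positivity
    nlinarith
  calc n ≤ 2 * n := by linarith
    _ = 2 * (C₀ * 2 ^ (j + 1) * N ^ (-E - δ * (j + 1))) *
        ((N ^ δ) ^ (j + 1) / 2 ^ (j + 1) * (C₀⁻¹ * N ^ E * n)) := by
      rw [h1]
      field_simp
    _ ≤ _ := by gcongr

lemma abs_natCast_sub_le {x y : ℕ} {M : ℝ} (hx : (x : ℝ) ≤ M) (hy : (y : ℝ) ≤ M) :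
    |(x : ℝ) - y| ≤ M := by
  have h1 : (0 : ℝ) ≤ x := x.cast_nonneg
  have h2 : (0 : ℝ) ≤ y := y.cast_nonneg
  exact abs_le.2 ⟨by linarith, by linarith⟩

lemma card_le_of_forall_le {s : Finset ℕ} {M : ℝ} (hM : 0 ≤ M) (h : ∀ n ∈ s, (n : ℝ) ≤ M) :
    (s.card : ℝ) ≤ M + 1 := by
  have : s ⊆ range (⌊M⌋₊ + 1) := fun n hn =>
    mem_range.2 (Nat.lt_succ_of_le (Nat.le_floor (h n hn)))
  have h1 := card_le_card this
  rw [card_range] at h1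
  have h2 : (s.card : ℝ) ≤ ⌊M⌋₊ + 1 := by exact_mod_cast h1
  linarith [Nat.floor_le hM]

set_option maxHeartbeats 1000000 in
/-- Bilinear blocks where the second factor is fixed up to the block variable. -/
lemma block_left (α θ : Fin (d + 1) → ℝ) (hα : ∀ i, 0 < α i) (hθ : StrictMono θ)
    (hz : ∀ z : ℤ, (z : ℝ) ≠ θ (Fin.last d)) (hΘ : 0 ≤ θ (Fin.last d)) {k : ℕ} (hk : 2 ≤ k)
    {ε ρ : ℝ} (hε : 0 < ε) (hρ : 0 < ρ) :
    ∃ C ≥ (1 : ℝ), ∀ N ≥ C, ∀ τ v β ξ : ℝ, τ = (k + 1) * v → ρ ≤ 2 * v → v ≤ β →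
      τ ≤ k * β → ρ * (2 * hh k) ≤ 1 - β →
      (ρ * (2 * hh k + 1) ≤ v ∨
        ρ * (2 * hh k + 1) ≤ 2 * v ∧ ρ * (2 * hh k + 1) ≤ (k - 1) * (β - v)) →
      ξ = N ^ (τ - ρ - θ (Fin.last d)) → ∀ (s : Finset ℕ) (b : ℕ) (w : ℤ → ℂ),
      (∀ y, ‖w y‖ ≤ 1) → (∀ a ∈ s, N / 2 ≤ (a : ℝ) * b ∧ (a : ℝ) * b ≤ 4 * N) →
      N ^ β / 4 ≤ b → (b : ℝ) ≤ 4 * N ^ β →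
      ∑ a ∈ s, ‖∑ y ∈ Icc 1 ⌊N ^ (β - v)⌋₊, w y * e (ξ * ppoly α θ (a * (b + y)))‖ ≤
        C * N ^ (1 - v - ρ + ε) := by
  obtain ⟨m, rfl⟩ : ∃ m, k = m + 2 := ⟨k - 2, by omega⟩
  obtain ⟨Ca, hCa, ha⟩ := blockCoeff_sub_left α θ hα hθ hz (m + 1)
  obtain ⟨Cb, hCb, hb⟩ := blockCoeff_sub_left α θ hα hθ hz m
  set C₀ := max Ca Cb with hC₀
  have hCaC : Ca ≤ C₀ := le_max_left _ _
  have hCbC : Cb ≤ C₀ := le_max_right _ _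
  have hC₀1 : 1 ≤ C₀ := hCa.trans hCaC
  set K : ℝ := 17 + 8 * (C₀ * 2 ^ (m + 2)) + 8 * (C₀ * 2 ^ (m + 1)) +
    8 * ((C₀ * 2 ^ (m + 2)) ^ 2 * (2 * C₀)) with hK
  have hKa : 0 ≤ C₀ * 2 ^ (m + 2) := by positivity
  have hKb : 0 ≤ C₀ * 2 ^ (m + 1) := by positivity
  have hKc : 0 ≤ (C₀ * 2 ^ (m + 2)) ^ 2 * (2 * C₀) := by positivity
  have hK17 : 17 ≤ K := by rw [hK]; linarith
  obtain ⟨C₁, hC₁, hcore⟩ := block_core α θ hα hθ hΘ (k := m + 2) (by omega) hε hρ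
    (K := K) (by linarith)
  set C := max C₁ (max C₀ ((32 * C₀) ^ (1 / ρ))) with hC
  have hCC₁ : C₁ ≤ C := le_max_left _ _
  have hCC₀ : C₀ ≤ C := (le_max_left _ _).trans (le_max_right _ _)
  have hCρ : (32 * C₀) ^ (1 / ρ) ≤ C := (le_max_right _ _).trans (le_max_right _ _)
  refine ⟨C, by linarith, fun N hN τ v β ξ hτ hv hvβ hτβ hρβ hcase hξ s b w hw hs hb1 hb2 => ?_⟩
  have hN1 : 1 ≤ N := by linarith
  have hN0 : 0 < N := by linarith
  set P : ℝ := 2 * hh (m + 2) with hP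
  have hP0 : 0 ≤ P := by positivity
  have hβ1 : β ≤ 1 := by nlinarith
  have hNρ : 32 * C₀ ≤ N ^ ρ := by
    calc 32 * C₀ = ((32 * C₀) ^ (1 / ρ)) ^ ρ := by
          rw [← Real.rpow_mul (by positivity), one_div_mul_cancel hρ.ne', Real.rpow_one]
      _ ≤ _ := Real.rpow_le_rpow (by positivity) (hCρ.trans hN) hρ.le
  have hNNρ : 16 * C₀ * N ^ (-ρ) ≤ 1 / 2 := by
    rw [Real.rpow_neg hN0.le, ← div_eq_mul_inv, div_le_iff₀ (by positivity)]
    linarith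
  have hb0 : (0 : ℝ) < b := lt_of_lt_of_le (by positivity) hb1
  have hβN : N ^ (1 - β) * N ^ β = N := by
    rw [← Real.rpow_add hN0, sub_add_cancel, Real.rpow_one]
  have hale : ∀ a ∈ s, (a : ℝ) ≤ 16 * N ^ (1 - β) := by
    intro a ha
    by_contra hlt
    push Not at hlt
    have h8 : (16 * N ^ (1 - β)) * (N ^ β / 4) = 4 * N := by linear_combination (4 : ℝ) * hβN
    have : (16 * N ^ (1 - β)) * (N ^ β / 4) < a * b :=
      mul_lt_mul hlt hb1 (by positivity) a.cast_nonneg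
    linarith [(hs a ha).2]
  have hA1 : 1 ≤ N ^ (1 - β) := Real.one_le_rpow hN1 (by linarith)
  have hcard : (s.card : ℝ) ≤ K * N ^ (1 - β) := by
    refine (card_le_of_forall_le (by positivity) hale).trans ?_
    nlinarith
  have hLfl := half_le_floor (Real.one_le_rpow hN1 (sub_nonneg.2 hvβ))
  have hL1 : 1 ≤ ⌊N ^ (β - v)⌋₊ :=
    Nat.le_floor (by simpa using Real.one_le_rpow hN1 (sub_nonneg.2 hvβ))
  set L := ⌊N ^ (β - v)⌋₊ with hL
  have hhp : 1 ≤ hh (m + 2) := hh_pos (by omega)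
  have hH : ∀ j : Fin (m + 2), 0 < 2 * (hh (m + 2) * L ^ (j.1 + 1)) := fun j => by positivity
  set γ : ℕ → Fin (m + 2) → ℝ := fun a j => blockCoeff α θ ξ a b j with hγ
  set i : Fin (m + 2) := ⟨m + 1, by omega⟩ with hi
  set i' : Fin (m + 2) := ⟨m, by omega⟩ with hi'
  set E := τ - ρ - 1 - β * (m + 1) with hE
  set E' := τ - ρ - 1 - β * m with hE'
  push_cast at hτ hτβ hcase
  have hsp : ∀ a ∈ s, ∀ a' ∈ s, C₀⁻¹ * N ^ E * |(a : ℝ) - a'| ≤ |γ a i - γ a' i| ∧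
      |γ a i - γ a' i| ≤ C₀ * N ^ E * |(a : ℝ) - a'| := by
    intro a has a' has'
    obtain ⟨h1, h2⟩ := ha N (by linarith) β (τ - ρ - θ (Fin.last d)) ξ a a' b hξ (hs a has).1
      (hs a has).2 (hs a' has').1 (hs a' has').2 hb1 hb2
    rw [show τ - ρ - θ (Fin.last d) + θ (Fin.last d) - 1 - β * ((m + 1 : ℕ) : ℝ) = E by
      rw [hE]; push_cast; ring] at h1 h2
    constructor
    · refine le_trans ?_ h1
      gcongr
    · refine h2.trans ?_
      gcongr
  have hsp' : ∀ a ∈ s, ∀ a' ∈ s, C₀⁻¹ * N ^ E' * |(a : ℝ) - a'| ≤ |γ a i' - γ a' i'| ∧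
      |γ a i' - γ a' i'| ≤ C₀ * N ^ E' * |(a : ℝ) - a'| := by
    intro a has a' has'
    obtain ⟨h1, h2⟩ := hb N (by linarith) β (τ - ρ - θ (Fin.last d)) ξ a a' b hξ (hs a has).1
      (hs a has).2 (hs a' has').1 (hs a' has').2 hb1 hb2
    rw [show τ - ρ - θ (Fin.last d) + θ (Fin.last d) - 1 - β * (m : ℝ) = E' by
      rw [hE']; ring] at h1 h2
    constructor
    · refine le_trans ?_ h1
      gcongr
    · refine h2.trans ?_
      gcongr
  have hsmall : ∀ a ∈ s, ∀ a' ∈ s, |γ a i - γ a' i| ≤ 1 / 2 := by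
    intro a has a' has'
    refine (hsp a has a' has').2.trans (le_trans ?_ hNNρ)
    calc _ ≤ C₀ * N ^ E * (16 * N ^ (1 - β)) := by
          gcongr
          exact abs_natCast_sub_le (hale a has) (hale a' has')
      _ = 16 * C₀ * N ^ (E + (1 - β)) := by rw [Real.rpow_add hN0]; ring
      _ ≤ _ := by
          gcongr
          rw [hE]
          linarith
  have hexp : ∀ r : ℝ, r ≤ 1 - β - ρ * P → N ^ r ≤ N ^ (1 - β - ρ * P) := fun r hr =>
    Real.rpow_le_rpow_of_exponent_le hN1 hr
  have h1exp : 1 ≤ N ^ (1 - β - ρ * P) := Real.one_le_rpow hN1 (by linarith)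
  have hspD : ∀ a ∈ s, ∀ a' ∈ s, |(a : ℝ) - a'| ≤
      2 * (C₀ * 2 ^ (m + 2) * N ^ (-E - (β - v) * (m + 2))) *
        (((2 * (hh (m + 2) * L ^ (i.1 + 1)) : ℕ) : ℝ) * |γ a i - γ a' i|) := by
    intro a has a' has'
    have := le_two_mul_of_spacing (m + 1) hN0 hC₀1 hLfl hhp (abs_nonneg _) (hsp a has a' has').1
    convert this using 5
    push_cast
    ring
  have hDexp : N ^ (-E - (β - v) * (m + 2)) = N ^ (1 - β + ρ - v) := by
    congr 1
    rw [hE, hτ]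
    ring
  have hbound : ∀ a ∈ s, ∑ a' ∈ s, ∏ j : Fin (m + 2), fejer (2 * (hh (m + 2) * L ^ (j.1 + 1)))
        (γ a j - γ a' j) ≤ K * N ^ (1 - β - ρ * P) := by
    rcases hcase with hc | ⟨hc1, hc2⟩
    · intro a has
      have h1 := sum_kernel_le_one i s γ (fun j => 2 * (hh (m + 2) * L ^ (j.1 + 1))) hH
        (D := C₀ * 2 ^ (m + 2) * N ^ (-E - (β - v) * (m + 2))) (by positivity) hsmall hspD a has
      refine h1.trans ?_
      have h2 := hexp (1 - β + ρ - v) (by linarith)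
      rw [hDexp]
      have h3 := mul_le_mul_of_nonneg_left h2 hKa
      have h4 := mul_nonneg hKb (zero_le_one.trans h1exp)
      have h5 := mul_nonneg hKc (zero_le_one.trans h1exp)
      have h6 : K * N ^ (1 - β - ρ * P) = 17 * N ^ (1 - β - ρ * P) +
          8 * (C₀ * 2 ^ (m + 2) * N ^ (1 - β - ρ * P)) +
          8 * (C₀ * 2 ^ (m + 1) * N ^ (1 - β - ρ * P)) +
          8 * ((C₀ * 2 ^ (m + 2)) ^ 2 * (2 * C₀) * N ^ (1 - β - ρ * P)) := by
        rw [hK]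
        ring
      have h7 := mul_nonneg hKa (Real.rpow_nonneg hN0.le (1 - β - ρ * P))
      rw [h6]
      linarith
    · intro a has
      have hspD' : ∀ a ∈ s, ∀ a' ∈ s, |(a : ℝ) - a'| ≤
          2 * (C₀ * 2 ^ (m + 1) * N ^ (-E' - (β - v) * (m + 1))) *
            (((2 * (hh (m + 2) * L ^ (i'.1 + 1)) : ℕ) : ℝ) * |γ a i' - γ a' i'|) := by
        intro a has a' has'
        exact le_two_mul_of_spacing m hN0 hC₀1 hLfl hhp (abs_nonneg _) (hsp' a has a' has').1
      have h1 := sum_kernel_le_two i i' s γ (fun j => 2 * (hh (m + 2) * L ^ (j.1 + 1))) hH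
        (D := C₀ * 2 ^ (m + 2) * N ^ (-E - (β - v) * (m + 2)))
        (D' := C₀ * 2 ^ (m + 1) * N ^ (-E' - (β - v) * (m + 1)))
        (W := N ^ (-E') * (2 * C₀)⁻¹) (by positivity) (by positivity) (by positivity) hsmall hspD
        (by
          intro a has a' has' hW
          refine (hsp' a has a' has').2.trans ?_
          calc _ ≤ C₀ * N ^ E' * (N ^ (-E') * (2 * C₀)⁻¹) := by gcongr
            _ = 1 / 2 := by
              rw [Real.rpow_neg hN0.le]
              have : 0 < N ^ E' := by positivity
              field_simp) hspD' a has
      refine h1.trans ?_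
      have h4 : N ^ (-E' - (β - v) * (m + 1)) = N ^ (1 - β + ρ - 2 * v) := by
        congr 1
        rw [hE', hτ]
        ring
      have h5 : (C₀ * 2 ^ (m + 2) * N ^ (-E - (β - v) * (m + 2))) ^ 2 /
          (N ^ (-E') * (2 * C₀)⁻¹) = (C₀ * 2 ^ (m + 2)) ^ 2 * (2 * C₀) *
            N ^ (1 - β + ρ - (m + 1) * (β - v)) := by
        have h6 : N ^ (1 - β + ρ - (m + 1) * (β - v)) =
            (N ^ (-E - (β - v) * (m + 2))) ^ 2 * N ^ E' := by
          rw [← Real.rpow_natCast, ← Real.rpow_mul hN0.le, ← Real.rpow_add hN0]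
          congr 1
          rw [hE, hE', hτ]
          push_cast
          ring
        rw [h6, Real.rpow_neg hN0.le]
        have : 0 < N ^ E' := by positivity
        field_simp
      rw [h4, h5]
      have h2 := mul_le_mul_of_nonneg_left (hexp (1 - β + ρ - 2 * v) (by linarith)) hKb
      have h3 := mul_le_mul_of_nonneg_left
        (hexp (1 - β + ρ - (m + 1) * (β - v)) (by linarith)) hKc
      have h7 := mul_nonneg hKa (Real.rpow_nonneg hN0.le (1 - β - ρ * P))
      have h8 := mul_nonneg hKb (Real.rpow_nonneg hN0.le (1 - β - ρ * P))
      have h9 := mul_nonneg hKc (Real.rpow_nonneg hN0.le (1 - β - ρ * P))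
      have h6 : K * N ^ (1 - β - ρ * P) = 17 * N ^ (1 - β - ρ * P) +
          8 * (C₀ * 2 ^ (m + 2) * N ^ (1 - β - ρ * P)) +
          8 * (C₀ * 2 ^ (m + 1) * N ^ (1 - β - ρ * P)) +
          8 * ((C₀ * 2 ^ (m + 2)) ^ 2 * (2 * C₀) * N ^ (1 - β - ρ * P)) := by
        rw [hK]
        ring
      rw [h6]
      linarith
  have := hcore N (by linarith) τ v β (1 - β) ξ (by push_cast; exact hτ) hv hvβ hβ1 hξ s
    (fun a => a) (fun _ => b) w hw (fun a ha => ⟨(hs a ha).1, (hs a ha).2, hb1⟩) hcard hbound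
  refine this.trans ?_
  rw [show 1 - β + β - v - ρ + ε = 1 - v - ρ + ε by ring]
  gcongr

/-- Blocks with a fixed first factor, averaged over the position of the block. -/
lemma block_right (α θ : Fin (d + 1) → ℝ) (hα : ∀ i, 0 < α i) (hθ : StrictMono θ)
    (hz : ∀ z : ℤ, (z : ℝ) ≠ θ (Fin.last d)) (hΘ : 0 ≤ θ (Fin.last d)) {k : ℕ} (hk : 1 ≤ k)
    {ε ρ : ℝ} (hε : 0 < ε) (hρ : 0 < ρ) :
    ∃ C ≥ (1 : ℝ), ∀ N ≥ C, ∀ τ v β ξ : ℝ, τ = (k + 1) * v → v ≤ β → β ≤ 1 →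
      τ ≤ k * β → ρ * (2 * hh k) ≤ β → ρ * (2 * hh k + 1) ≤ v →
      ξ = N ^ (τ - ρ - θ (Fin.last d)) → ∀ (s : Finset ℕ) (a : ℕ),
      (∀ b ∈ s, N / 2 ≤ (a : ℝ) * b ∧ (a : ℝ) * b ≤ 4 * N ∧ N ^ β / 4 ≤ b ∧ (b : ℝ) ≤ 4 * N ^ β) →
      ∑ b ∈ s, ‖∑ y ∈ Icc 1 ⌊N ^ (β - v)⌋₊, e (ξ * ppoly α θ (a * (b + y)))‖ ≤
        C * N ^ (2 * β - v - ρ + ε) := by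
  obtain ⟨m, rfl⟩ : ∃ m, k = m + 1 := ⟨k - 1, by omega⟩
  obtain ⟨C₀, hC₀1, ha⟩ := blockCoeff_sub_right α θ hα hθ hz m
  set K : ℝ := 5 + 8 * (C₀ * 2 ^ (m + 1)) with hK
  have hKa : 0 ≤ C₀ * 2 ^ (m + 1) := by positivity
  have hK5 : 5 ≤ K := by rw [hK]; linarith
  obtain ⟨C₁, hC₁, hcore⟩ := block_core α θ hα hθ hΘ (k := m + 1) (by omega) hε hρ
    (K := K) (by linarith)
  set C := max C₁ (max C₀ ((32 * C₀) ^ (1 / ρ))) with hC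
  have hCC₁ : C₁ ≤ C := le_max_left _ _
  have hCC₀ : C₀ ≤ C := (le_max_left _ _).trans (le_max_right _ _)
  have hCρ : (32 * C₀) ^ (1 / ρ) ≤ C := (le_max_right _ _).trans (le_max_right _ _)
  refine ⟨C, by linarith, fun N hN τ v β ξ hτ hvβ hβ1 hτβ hρβ hcase hξ s q hs => ?_⟩
  have hN1 : 1 ≤ N := by linarith
  have hN0 : 0 < N := by linarith
  set P : ℝ := 2 * hh (m + 1) with hP
  have hP0 : 0 ≤ P := by positivity
  have hβ0 : 0 ≤ β := le_trans (by positivity) hρβ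
  have hNρ : 32 * C₀ ≤ N ^ ρ := by
    calc 32 * C₀ = ((32 * C₀) ^ (1 / ρ)) ^ ρ := by
          rw [← Real.rpow_mul (by positivity), one_div_mul_cancel hρ.ne', Real.rpow_one]
      _ ≤ _ := Real.rpow_le_rpow (by positivity) (hCρ.trans hN) hρ.le
  have hNNρ : 16 * C₀ * N ^ (-ρ) ≤ 1 / 2 := by
    rw [Real.rpow_neg hN0.le, ← div_eq_mul_inv, div_le_iff₀ (by positivity)]
    linarith
  have hble : ∀ b ∈ s, (b : ℝ) ≤ 4 * N ^ β := fun b hb => (hs b hb).2.2.2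
  have hB1 : 1 ≤ N ^ β := Real.one_le_rpow hN1 hβ0
  have hcard : (s.card : ℝ) ≤ K * N ^ β := by
    refine (card_le_of_forall_le (by positivity) hble).trans ?_
    nlinarith
  have hLfl := half_le_floor (Real.one_le_rpow hN1 (sub_nonneg.2 hvβ))
  have hL1 : 1 ≤ ⌊N ^ (β - v)⌋₊ :=
    Nat.le_floor (by simpa using Real.one_le_rpow hN1 (sub_nonneg.2 hvβ))
  set L := ⌊N ^ (β - v)⌋₊ with hL
  have hhp : 1 ≤ hh (m + 1) := hh_pos (by omega)
  have hH : ∀ j : Fin (m + 1), 0 < 2 * (hh (m + 1) * L ^ (j.1 + 1)) := fun j => by positivity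
  set γ : ℕ → Fin (m + 1) → ℝ := fun b j => blockCoeff α θ ξ q b j with hγ
  set i : Fin (m + 1) := ⟨m, by omega⟩ with hi
  set E := τ - ρ - β * (m + 2) with hE
  push_cast at hτ hτβ
  have hsp : ∀ b ∈ s, ∀ b' ∈ s, C₀⁻¹ * N ^ E * |(b : ℝ) - b'| ≤ |γ b i - γ b' i| ∧
      |γ b i - γ b' i| ≤ C₀ * N ^ E * |(b : ℝ) - b'| := by
    intro b hbs b' hbs'
    have h := ha N (by linarith) β (τ - ρ - θ (Fin.last d)) ξ q b b' hξ (hs b hbs).1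
      (hs b hbs).2.1 (hs b' hbs').1 (hs b' hbs').2.1 (hs b hbs).2.2.1 (hs b hbs).2.2.2
    rwa [show τ - ρ - θ (Fin.last d) + θ (Fin.last d) - β * ((m : ℝ) + 2) = E by
      rw [hE]; ring] at h
  have hsmall : ∀ b ∈ s, ∀ b' ∈ s, |γ b i - γ b' i| ≤ 1 / 2 := by
    intro b hbs b' hbs'
    refine (hsp b hbs b' hbs').2.trans (le_trans ?_ hNNρ)
    calc _ ≤ C₀ * N ^ E * (16 * N ^ β) := by
          gcongr
          refine (abs_natCast_sub_le (hble b hbs) (hble b' hbs')).trans ?_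
          linarith
      _ = 16 * C₀ * N ^ (E + β) := by rw [Real.rpow_add hN0]; ring
      _ ≤ _ := by
          gcongr
          rw [hE]
          linarith
  have h1exp : 1 ≤ N ^ (β - ρ * P) := Real.one_le_rpow hN1 (by linarith)
  have hbound : ∀ b ∈ s, ∑ b' ∈ s, ∏ j : Fin (m + 1), fejer (2 * (hh (m + 1) * L ^ (j.1 + 1)))
        (γ b j - γ b' j) ≤ K * N ^ (β - ρ * P) := by
    intro b hbs
    have h1 := sum_kernel_le_one i s γ (fun j => 2 * (hh (m + 1) * L ^ (j.1 + 1))) hH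
      (D := C₀ * 2 ^ (m + 1) * N ^ (-E - (β - v) * (m + 1))) (by positivity) hsmall
      (fun b hbs b' hbs' => le_two_mul_of_spacing m hN0 hC₀1 hLfl hhp (abs_nonneg _)
        (hsp b hbs b' hbs').1) b hbs
    refine h1.trans ?_
    have h2 : N ^ (-E - (β - v) * (m + 1)) ≤ N ^ (β - ρ * P) := by
      apply Real.rpow_le_rpow_of_exponent_le hN1
      rw [hE, hτ]
      linarith
    have h3 := mul_le_mul_of_nonneg_left h2 hKa
    rw [hK]
    nlinarith
  have hv : ρ ≤ 2 * v := by nlinarith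
  have := hcore N (by linarith) τ v β β ξ (by push_cast; exact hτ) hv hvβ hβ1 hξ s
    (fun _ => q) (fun b => b) (fun _ => 1) (fun _ => by simp)
    (fun b hb => ⟨(hs b hb).1, (hs b hb).2.1, (hs b hb).2.2.1⟩) hcard hbound
  simp only [one_mul] at this
  refine this.trans ?_
  rw [show β + β - v - ρ + ε = 2 * β - v - ρ + ε by ring]
  gcongr

end VinogradovMean

namespace VinogradovMean

lemma saving_small {Θ ρ : ℝ} (hΘ : 3 < Θ) (hρ : ρ * (8 * Θ ^ 2 + 12 * Θ + 10) = 1) :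
    0 < ρ ∧ ρ < 1 / 118 ∧ ρ * Θ < 3 / 118 := by
  have hD : 0 < 8 * Θ ^ 2 + 12 * Θ + 10 := by positivity
  have h0 : 0 < ρ := by
    by_contra h
    push Not at h
    nlinarith
  have h1 : 118 * Θ < 3 * (8 * Θ ^ 2 + 12 * Θ + 10) := by nlinarith
  refine ⟨h0, by nlinarith, ?_⟩
  have := mul_lt_mul_of_pos_left h1 h0
  linarith

/-- Comparison of the quadratic in `Θ` with the one in the nearby exponent `τ`. -/
lemma saving_quadratic {Θ ρ τ : ℝ} (hΘ : 3 < Θ) (hρ : ρ * (8 * Θ ^ 2 + 12 * Θ + 10) = 1)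
    (hτ2 : τ ≤ Θ + 3.2 * ρ) (hτ0 : 0 ≤ τ) :
    8 * τ ^ 2 + 12 * τ + 8.3 ≤ 8 * Θ ^ 2 + 12 * Θ + 10 := by
  obtain ⟨h0, h1, h2⟩ := saving_small hΘ hρ
  have : τ ^ 2 ≤ (Θ + 3.2 * ρ) ^ 2 := by gcongr
  nlinarith

lemma typeTwo_exponents {Θ ρ τ β : ℝ} (hΘ : 3 < Θ) (hρ : ρ * (8 * Θ ^ 2 + 12 * Θ + 10) = 1)
    (hτ1 : Θ - 0.1 * ρ ≤ τ) (hτ2 : τ ≤ Θ + 3.2 * ρ) (hβ1 : 1 / 2 ≤ β) (hβ2 : β ≤ 0.672) :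
    ∃ k : ℕ, ∃ v : ℝ, 2 ≤ k ∧ (k : ℝ) ≤ 2 * τ + 1 ∧ τ = (k + 1) * v ∧ ρ ≤ v ∧ v ≤ β ∧
      τ ≤ k * β ∧ ρ * (2 * hh k) ≤ 1 - β ∧ (ρ * (2 * hh k + 1) ≤ v ∨
        ρ * (2 * hh k + 1) ≤ 2 * v ∧ ρ * (2 * hh k + 1) ≤ (k - 1) * (β - v)) := by
  obtain ⟨hρ0, hρ1, hρΘ⟩ := saving_small hΘ hρ
  have hτ0 : 2.99 < τ := by linarith
  have hD := saving_quadratic hΘ hρ hτ2 (by linarith)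
  set D := 8 * Θ ^ 2 + 12 * Θ + 10 with hDdef
  have hβ0 : 0 < β := by linarith
  set k := ⌊τ / β⌋₊ + 1 with hk
  have hk1 : τ / β < k := by rw [hk]; push_cast; exact Nat.lt_floor_add_one _
  have hk2 : (k : ℝ) ≤ τ / β + 1 := by
    rw [hk]; push_cast; linarith [Nat.floor_le (show 0 ≤ τ / β by positivity)]
  rw [div_lt_iff₀ hβ0] at hk1
  have hk3 : (k : ℝ) * β ≤ τ + β := by
    have := mul_le_mul_of_nonneg_right hk2 hβ0.le
    rwa [add_mul, div_mul_cancel₀ _ hβ0.ne', one_mul] at this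
  have hkr : (4 : ℝ) < k := by nlinarith
  have hk4 : (k : ℝ) ≤ 2 * τ + 1 := by nlinarith
  have hh2 : (2 * hh k : ℝ) = k * (k + 1) := by exact_mod_cast two_hh k
  have hv : τ = (k + 1) * (τ / (k + 1)) := by field_simp
  set v := τ / (k + 1) with hvdef
  have hvβ : v ≤ β := by
    rw [hvdef, div_le_iff₀ (by positivity)]
    linarith
  have hv38 : 0.37 ≤ v := by
    rw [hvdef, le_div_iff₀ (by positivity)]
    linarith
  have hq1 : ρ * (k * (k + 1)) ≤ 1 - β := by
    have h1 : (τ + β) * (τ + 2 * β) ≤ β ^ 2 * (1 - β) * D := by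
      have e1 : 0 ≤ (β - 0.5) * (0.672 - β) * (D * β + 0.172 * D + 2) := by
        have : 0 ≤ D := by positivity
        have h3 : 0 ≤ D * β + 0.172 * D + 2 := by positivity
        exact mul_nonneg (mul_nonneg (by linarith) (by linarith)) h3
      have e2 : 0 ≤ 0.5 ^ 2 * 0.5 * D - 2 * 0.5 ^ 2 - 3 * τ * 0.5 - τ ^ 2 := by nlinarith
      have e3 : 0 ≤ 0.672 ^ 2 * 0.328 * D - 2 * 0.672 ^ 2 - 3 * τ * 0.672 - τ ^ 2 := by nlinarith
      have e4 := mul_nonneg e2 (show 0 ≤ 0.672 - β by linarith)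
      have e5 := mul_nonneg e3 (show 0 ≤ β - 0.5 by linarith)
      nlinarith
    have h2 : (k * (k + 1) : ℝ) * β ^ 2 ≤ (τ + β) * (τ + 2 * β) := by
      have : (k + 1 : ℝ) * β ≤ τ + 2 * β := by linarith
      have := mul_le_mul hk3 this (by positivity) (by positivity)
      linarith
    have h3 : (k * (k + 1) : ℝ) ≤ (1 - β) * D := by
      have h4 : (k * (k + 1) : ℝ) * β ^ 2 ≤ (1 - β) * D * β ^ 2 := by linarith
      exact le_of_mul_le_mul_right h4 (by positivity)
    have := mul_le_mul_of_nonneg_left h3 hρ0.le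
    linear_combination this + (1 - β) * hρ
  refine ⟨k, v, by exact_mod_cast (show (2 : ℝ) ≤ k by linarith), hk4, hv, by linarith, hvβ,
    by linarith, by rwa [hh2], ?_⟩
  rw [hh2]
  by_cases hc : ρ * (k * (k + 1) + 1) ≤ v
  · exact Or.inl hc
  right
  push Not at hc
  have hq : ρ * (k * (k + 1) + 1) ≤ 1 / 2 := by
    have h1 : (k : ℝ) * (k + 1) + 1 ≤ D / 2 := by nlinarith
    have := mul_le_mul_of_nonneg_left h1 hρ0.le
    linear_combination this + hρ / 2
  refine ⟨by linarith, hq.trans ?_⟩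
  have hcub : τ * D < (k + 1) * (k * (k + 1) + 1) := by
    have h1 : τ < (k + 1) * (ρ * (k * (k + 1) + 1)) := by
      calc τ = (k + 1) * v := hv
        _ < _ := by gcongr
    have h2 := mul_lt_mul_of_pos_right h1 (show 0 < D by positivity)
    have h3 : (k + 1 : ℝ) * (ρ * (k * (k + 1) + 1)) * D = (k + 1) * (k * (k + 1) + 1) := by
      linear_combination (k + 1 : ℝ) * (k * (k + 1) + 1) * hρ
    linarith
  have hz : 2 * τ < k - 1 / 3 := by
    by_contra h
    push Not at h
    have h0 : (0 : ℝ) < k - 1 / 3 := by linarith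
    have h1 : (k - 1 / 3 : ℝ) ^ 2 ≤ (2 * τ) ^ 2 := by gcongr
    have h2 : (k - 1 / 3 : ℝ) ^ 3 ≤ (2 * τ) ^ 3 := by gcongr
    have h3 : τ * (8 * τ ^ 2 + 12 * τ + 8.3) ≤ τ * D := by gcongr
    have h4 : (5 : ℝ) ≤ k := by
      have : 4 < k := by exact_mod_cast hkr
      exact_mod_cast this
    linarith
  have hk7 : (7 : ℝ) ≤ k := by
    have : (6 : ℝ) < k := by linarith
    have : 6 < k := by exact_mod_cast this
    exact_mod_cast this
  have hv2 : v ≤ 1 / 2 - 2 / 3 / (k + 1) := by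
    rw [hvdef, div_le_iff₀ (by positivity), sub_mul, div_mul_cancel₀ _ (by positivity)]
    linarith
  have h8 : 2 / 3 / (k + 1 : ℝ) ≤ β - v := by linarith
  have h9 := mul_le_mul_of_nonneg_left h8 (show (0 : ℝ) ≤ k - 1 by linarith)
  refine le_trans ?_ h9
  rw [mul_div_assoc', le_div_iff₀ (by positivity)]
  linarith

lemma typeOne_exponents {Θ ρ τ β : ℝ} (hΘ : 3 < Θ) (hρ : ρ * (8 * Θ ^ 2 + 12 * Θ + 10) = 1)
    (hτ1 : Θ - 0.1 * ρ ≤ τ) (hτ2 : τ ≤ Θ + 3.2 * ρ) (hβ1 : 2 / 3 ≤ β) :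
    ∃ k : ℕ, ∃ v : ℝ, 1 ≤ k ∧ (k : ℝ) ≤ 2 * τ + 1 ∧ τ = (k + 1) * v ∧ ρ ≤ v ∧ v ≤ β ∧
      τ ≤ k * β ∧ ρ * (2 * hh k) ≤ β ∧ ρ * (2 * hh k + 1) ≤ v := by
  obtain ⟨hρ0, hρ1, hρΘ⟩ := saving_small hΘ hρ
  have hτ0 : 2.99 < τ := by linarith
  have hD := saving_quadratic hΘ hρ hτ2 (by linarith)
  set D := 8 * Θ ^ 2 + 12 * Θ + 10 with hDdef
  have hβ0 : 0 < β := by linarith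
  set k := ⌊τ / β⌋₊ + 1 with hk
  have hk1 : τ / β < k := by rw [hk]; push_cast; exact Nat.lt_floor_add_one _
  have hk2 : (k : ℝ) ≤ τ / β + 1 := by
    rw [hk]; push_cast; linarith [Nat.floor_le (show 0 ≤ τ / β by positivity)]
  rw [div_lt_iff₀ hβ0] at hk1
  have hk3 : (k : ℝ) * β ≤ τ + β := by
    have := mul_le_mul_of_nonneg_right hk2 hβ0.le
    rwa [add_mul, div_mul_cancel₀ _ hβ0.ne', one_mul] at this
  have hk0 : (1 : ℝ) ≤ k := by rw [hk]; push_cast; linarith [(⌊τ / β⌋₊).cast_nonneg (α := ℝ)]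
  have hk4 : (k : ℝ) ≤ 1.5 * τ + 1 := by nlinarith
  have hh2 : (2 * hh k : ℝ) = k * (k + 1) := by exact_mod_cast two_hh k
  have hv : τ = (k + 1) * (τ / (k + 1)) := by field_simp
  have hkk : (k : ℝ) * (k + 1) ≤ (1.5 * τ + 1) * (1.5 * τ + 2) := by
    gcongr ?_ * ?_
    linarith
  have hq : ρ * (k * (k + 1) + 1) ≤ τ / (k + 1) := by
    rw [le_div_iff₀ (by positivity)]
    have h1 : ((k : ℝ) * (k + 1) + 1) * (k + 1) ≤ τ * D := by
      have h2 : ((k : ℝ) * (k + 1) + 1) * (k + 1) ≤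
          ((1.5 * τ + 1) * (1.5 * τ + 2) + 1) * (1.5 * τ + 2) := by
        gcongr ?_ * ?_ <;> linarith
      have h3 : τ * (8 * τ ^ 2 + 12 * τ + 8.3) ≤ τ * D := by gcongr
      refine h2.trans (le_trans ?_ h3)
      nlinarith [mul_pos (show 0 < τ by linarith) (show 0 < τ - 2.99 by linarith),
        mul_pos (mul_pos (show 0 < τ by linarith) (show 0 < τ by linarith))
          (show 0 < τ - 2.99 by linarith)]
    have := mul_le_mul_of_nonneg_left h1 hρ0.le
    linear_combination this + τ * hρ
  have hvβ : τ / (k + 1) ≤ β := by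
    rw [div_le_iff₀ (by positivity)]
    linarith
  have h0 : (0 : ℝ) ≤ k * (k + 1) := by positivity
  refine ⟨k, τ / (k + 1), by exact_mod_cast hk0, by linarith, hv, ?_, hvβ, by linarith, ?_,
    by rwa [hh2]⟩
  · nlinarith
  · rw [hh2]
    nlinarith

end VinogradovMean

namespace VinogradovMean

variable {d : ℕ}

/-- Constants depending on a bounded natural parameter can be chosen uniformly. -/
lemma exists_uniform_const {Q : ℕ → ℝ → Prop} (k₀ K : ℕ)
    (h : ∀ k, k₀ ≤ k → ∃ C ≥ (1 : ℝ), Q k C) (hmono : ∀ k C C', 1 ≤ C → C ≤ C' → Q k C → Q k C') :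
    ∃ C ≥ (1 : ℝ), ∀ k, k₀ ≤ k → k ≤ K → Q k C := by
  have h' : ∀ k, ∃ C ≥ (1 : ℝ), k₀ ≤ k → Q k C := fun k => by
    by_cases hk : k₀ ≤ k
    · obtain ⟨C, h1, h2⟩ := h k hk
      exact ⟨C, h1, fun _ => h2⟩
    · exact ⟨1, le_rfl, fun h => absurd h hk⟩
  choose c hc1 hc using h'
  have hle : ∀ k ∈ range (K + 1), c k ≤ ∑ j ∈ range (K + 1), c j := fun k hk =>
    single_le_sum (fun j _ => by linarith [hc1 j]) hk
  exact ⟨∑ j ∈ range (K + 1), c j, (hc1 0).trans (hle 0 (by simp)), fun k hk hkK =>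
    hmono k _ _ (hc1 k) (hle k (mem_range.2 (by omega))) (hc k hk)⟩

lemma typeTwo_block (α θ : Fin (d + 1) → ℝ) (hα : ∀ i, 0 < α i) (hθ : StrictMono θ)
    (hz : ∀ z : ℤ, (z : ℝ) ≠ θ (Fin.last d)) (hΘ : 3 < θ (Fin.last d)) {ε ρ : ℝ} (hε : 0 < ε)
    (hρ : ρ * (8 * θ (Fin.last d) ^ 2 + 12 * θ (Fin.last d) + 10) = 1) :
    ∃ C ≥ (1 : ℝ), ∀ N ≥ C, ∀ τ β ξ : ℝ, θ (Fin.last d) - 0.1 * ρ ≤ τ →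
      τ ≤ θ (Fin.last d) + 3.2 * ρ → 1 / 2 ≤ β → β ≤ 0.672 →
      ξ = N ^ (τ - ρ - θ (Fin.last d)) → ∃ v : ℝ, ρ ≤ v ∧ v ≤ β ∧
      ∀ (s : Finset ℕ) (b : ℕ) (w : ℤ → ℂ),
      (∀ y, ‖w y‖ ≤ 1) → (∀ a ∈ s, N / 2 ≤ (a : ℝ) * b ∧ (a : ℝ) * b ≤ 4 * N) →
      N ^ β / 4 ≤ b → (b : ℝ) ≤ 4 * N ^ β →
      ∑ a ∈ s, ‖∑ y ∈ Icc 1 ⌊N ^ (β - v)⌋₊, w y * e (ξ * ppoly α θ (a * (b + y)))‖ ≤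
        C * N ^ (1 - v - ρ + ε) := by
  obtain ⟨hρ0, hρ1, hρΘ⟩ := saving_small hΘ hρ
  obtain ⟨C, hC, h⟩ := exists_uniform_const 2 ⌊2 * (θ (Fin.last d) + 3.2 * ρ) + 1⌋₊
    (fun k hk => block_left α θ hα hθ hz (by linarith) hk hε hρ0)
    (fun k C C' h1C hCC h N hN τ v β ξ h1 h2 h3 h4 h5 h6 h7 s b w h8 h9 h10 h11 => by
      have := h N (hCC.trans hN) τ v β ξ h1 h2 h3 h4 h5 h6 h7 s b w h8 h9 h10 h11
      have hN0 : 0 ≤ N := by linarith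
      refine this.trans ?_
      gcongr)
  refine ⟨C, hC, fun N hN τ β ξ hτ1 hτ2 hβ1 hβ2 hξ => ?_⟩
  obtain ⟨k, v, hk2, hkτ, hτ, hv, hvβ, hτβ, hq1, hq⟩ :=
    typeTwo_exponents hΘ hρ hτ1 hτ2 hβ1 hβ2
  exact ⟨v, hv, hvβ, h k hk2 (Nat.le_floor (by linarith)) N hN τ v β ξ hτ (by linarith) hvβ hτβ
    hq1 hq hξ⟩

lemma typeOne_block (α θ : Fin (d + 1) → ℝ) (hα : ∀ i, 0 < α i) (hθ : StrictMono θ)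
    (hz : ∀ z : ℤ, (z : ℝ) ≠ θ (Fin.last d)) (hΘ : 3 < θ (Fin.last d)) {ε ρ : ℝ} (hε : 0 < ε)
    (hρ : ρ * (8 * θ (Fin.last d) ^ 2 + 12 * θ (Fin.last d) + 10) = 1) :
    ∃ C ≥ (1 : ℝ), ∀ N ≥ C, ∀ τ β ξ : ℝ, θ (Fin.last d) - 0.1 * ρ ≤ τ →
      τ ≤ θ (Fin.last d) + 3.2 * ρ → 2 / 3 ≤ β → β ≤ 1 →
      ξ = N ^ (τ - ρ - θ (Fin.last d)) → ∃ v : ℝ, ρ ≤ v ∧ v ≤ β ∧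
      ∀ (s : Finset ℕ) (a : ℕ),
      (∀ b ∈ s, N / 2 ≤ (a : ℝ) * b ∧ (a : ℝ) * b ≤ 4 * N ∧ N ^ β / 4 ≤ b ∧ (b : ℝ) ≤ 4 * N ^ β) →
      ∑ b ∈ s, ‖∑ y ∈ Icc 1 ⌊N ^ (β - v)⌋₊, e (ξ * ppoly α θ (a * (b + y)))‖ ≤
        C * N ^ (2 * β - v - ρ + ε) := by
  obtain ⟨hρ0, hρ1, hρΘ⟩ := saving_small hΘ hρ
  obtain ⟨C, hC, h⟩ := exists_uniform_const 1 ⌊2 * (θ (Fin.last d) + 3.2 * ρ) + 1⌋₊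
    (fun k hk => block_right α θ hα hθ hz (by linarith) hk hε hρ0)
    (fun k C C' h1C hCC h N hN τ v β ξ h1 h2 h3 h4 h5 h6 h7 s a h8 => by
      have := h N (hCC.trans hN) τ v β ξ h1 h2 h3 h4 h5 h6 h7 s a h8
      have hN0 : 0 ≤ N := by linarith
      refine this.trans ?_
      gcongr)
  refine ⟨C, hC, fun N hN τ β ξ hτ1 hτ2 hβ1 hβ2 hξ => ?_⟩
  obtain ⟨k, v, hk2, hkτ, hτ, hv, hvβ, hτβ, hq1, hq⟩ := typeOne_exponents hΘ hρ hτ1 hτ2 hβ1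
  exact ⟨v, hv, hvβ, h k hk2 (Nat.le_floor (by linarith)) N hN τ v β ξ hτ hvβ hβ2 hτβ
    hq1 hq hξ⟩

/-- Averaging a sum over an interval over shifts of length `L`. -/
lemma shift_average {F : ℕ → ℂ} (hF : ∀ n, ‖F n‖ ≤ 1) (L x y : ℕ) :
    L * ‖∑ b ∈ Ioc x y, F b‖ ≤
      ∑ b ∈ range (y + 1) with x ≤ b ∧ b + L ≤ y, ‖∑ t ∈ Icc 1 L, F (b + t)‖ + L * L := by
  have hcard : ∀ s : Finset ℕ, ‖∑ b ∈ s, F b‖ ≤ s.card := fun s => by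
    refine (norm_sum_le _ _).trans ((sum_le_card_nsmul _ _ 1 fun n _ => hF n).trans ?_)
    simp
  have hset : {b ∈ range (y + 1) | x ≤ b ∧ b + L ≤ y} = Ico x (y + 1 - L) := by
    ext b
    simp only [mem_filter, mem_range, mem_Ico]
    omega
  rw [hset]
  have hone : ∀ t ∈ Icc 1 L, ‖∑ b ∈ Ioc x y, F b - ∑ b ∈ Ico x (y + 1 - L), F (b + t)‖ ≤ L := by
    intro t ht
    rw [mem_Icc] at ht
    by_cases hxy : x + L ≤ y
    · have h1 : ∑ b ∈ Ico x (y + 1 - L), F (b + t) = ∑ b ∈ Ico (x + t) (y + 1 - L + t), F b :=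
        sum_Ico_add' F x (y + 1 - L) t
      have h2 : Ico (x + t) (y + 1 - L + t) ⊆ Ioc x y := fun b hb => by
        rw [mem_Ico] at hb
        rw [mem_Ioc]
        omega
      rw [h1, ← sum_sdiff h2, add_sub_cancel_right]
      refine (hcard _).trans ?_
      rw [card_sdiff_of_subset h2, Nat.card_Ioc, Nat.card_Ico]
      exact_mod_cast (by omega)
    · have h1 : Ico x (y + 1 - L) = ∅ := Ico_eq_empty (by omega)
      rw [h1, sum_empty, sub_zero]
      refine (hcard _).trans ?_
      rw [Nat.card_Ioc]
      exact_mod_cast (by omega)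
  have hL : (L : ℂ) * ∑ b ∈ Ioc x y, F b = ∑ b ∈ Ico x (y + 1 - L), ∑ t ∈ Icc 1 L, F (b + t) +
      ∑ t ∈ Icc 1 L, (∑ b ∈ Ioc x y, F b - ∑ b ∈ Ico x (y + 1 - L), F (b + t)) := by
    rw [sum_sub_distrib, sum_comm (s := Ico x (y + 1 - L)), add_sub_cancel, sum_const,
      Nat.card_Icc, add_tsub_cancel_right, nsmul_eq_mul]
  calc (L : ℝ) * ‖∑ b ∈ Ioc x y, F b‖ = ‖(L : ℂ) * ∑ b ∈ Ioc x y, F b‖ := by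
        rw [norm_mul, Complex.norm_natCast]
    _ ≤ _ := by
      rw [hL]
      refine (norm_add_le _ _).trans (add_le_add (norm_sum_le _ _) ?_)
      refine (norm_sum_le _ _).trans ((sum_le_card_nsmul _ _ _ hone).trans ?_)
      simp

end VinogradovMean

namespace VinogradovMean

variable {d : ℕ}

lemma rpow_one_sub_log_div {N A : ℝ} (hN : 1 < N) (hA : 0 < A) :
    N ^ (1 - Real.log A / Real.log N) = N / A := by
  have hN0 : 0 < N := by linarith
  have hl : Real.log N ≠ 0 := (Real.log_pos hN).ne'
  rw [Real.rpow_sub hN0, Real.rpow_one, Real.rpow_def_of_pos hN0 (_ / _), mul_div_cancel₀ _ hl,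
    Real.exp_log hA]

/-- If a block of integers `b` has all products `a * b` in `(N, N']`, its start is large. -/
lemma mul_start_bounds {N N' a b L : ℕ} (ha : 0 < a) (h1 : N / a ≤ b) (h2 : b + L ≤ N' / a) :
    (N : ℝ) - a ≤ a * b ∧ (a : ℝ) * b ≤ N' := by
  have h3 : N < a * (b + 1) := by
    have := Nat.lt_mul_div_succ N ha
    exact this.trans_le (Nat.mul_le_mul_left a (by omega))
  have h4 : a * b ≤ N' := (Nat.mul_le_mul_left a (by omega)).trans (Nat.mul_div_le N' a)
  have h5 : (N : ℝ) < a * (b + 1) := by exact_mod_cast h3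
  exact ⟨by linarith, by exact_mod_cast h4⟩

lemma typeOne_sum (α θ : Fin (d + 1) → ℝ) (hα : ∀ i, 0 < α i) (hθ : StrictMono θ)
    (hz : ∀ z : ℤ, (z : ℝ) ≠ θ (Fin.last d)) (hΘ : 3 < θ (Fin.last d)) {ε ρ : ℝ} (hε : 0 < ε)
    (hρ : ρ * (8 * θ (Fin.last d) ^ 2 + 12 * θ (Fin.last d) + 10) = 1) :
    ∃ C ≥ (1 : ℝ), ∀ N : ℕ, C ≤ N → ∀ τ ξ : ℝ, θ (Fin.last d) - 0.1 * ρ ≤ τ →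
      τ ≤ θ (Fin.last d) + 3.2 * ρ → ξ = (N : ℝ) ^ (τ - ρ - θ (Fin.last d)) →
      ∀ N' a : ℕ, N' ≤ 2 * N → 1 ≤ a → a ^ 3 ≤ N →
      ‖∑ b ∈ Ioc (N / a) (N' / a), e (ξ * ppoly α θ (a * b))‖ ≤
        C * (N : ℝ) ^ (1 - ρ + ε) / a := by
  obtain ⟨C, hC, h⟩ := typeOne_block α θ hα hθ hz hΘ hε hρ
  refine ⟨2 * C + 2, by linarith, fun N hN τ ξ hτ1 hτ2 hξ N' a hN' ha haN => ?_⟩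
  have ha1 : (1 : ℝ) ≤ a := by exact_mod_cast ha
  have haN' : (a : ℝ) ^ 3 ≤ N := by exact_mod_cast haN
  have hN1 : (1 : ℝ) < N := by linarith
  have hN0 : (0 : ℝ) < N := by linarith
  have hlog := Real.log_pos hN1
  have hla := Real.log_nonneg ha1
  have hla3 : 3 * Real.log a ≤ Real.log N := by
    have := Real.log_le_log (by positivity) haN'
    rwa [Real.log_pow] at this
  have hNβ := rpow_one_sub_log_div hN1 (show (0 : ℝ) < a by linarith)
  set β := 1 - Real.log a / Real.log N with hβ
  have hq : Real.log a / Real.log N ≤ 1 / 3 := by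
    rw [div_le_iff₀ hlog]
    linarith
  have hq0 : 0 ≤ Real.log a / Real.log N := by positivity
  obtain ⟨v, hv, hvβ, hblock⟩ := h N (by linarith) τ β ξ hτ1 hτ2 (by linarith) (by linarith) hξ
  have hLfl := half_le_floor (Real.one_le_rpow hN1.le (sub_nonneg.2 hvβ))
  have hLle := Nat.floor_le (show 0 ≤ (N : ℝ) ^ (β - v) by positivity)
  set L := ⌊(N : ℝ) ^ (β - v)⌋₊ with hL
  have hY : 0 < (N : ℝ) ^ (β - v) := by positivity
  have hL0 : (0 : ℝ) < L := by linarith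
  have hN'' : (N' : ℝ) ≤ 2 * N := by exact_mod_cast hN'
  have ha2 : (a : ℝ) ≤ N / 2 := by
    by_cases h1 : a = 1
    · rw [h1]; push_cast; linarith
    · have : (2 : ℝ) ≤ a := by exact_mod_cast (by omega : 2 ≤ a)
      nlinarith [mul_nonneg (mul_nonneg (show (0 : ℝ) ≤ a by linarith) (sub_nonneg.2 this))
        (show (0 : ℝ) ≤ a + 2 by linarith)]
  have key := shift_average (F := fun b => e (ξ * ppoly α θ (a * b))) (fun n => (norm_e _).le)
    L (N / a) (N' / a)
  push_cast at key
  have hb := hblock {b ∈ range (N' / a + 1) | N / a ≤ b ∧ b + L ≤ N' / a} a (by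
    intro b hb
    rw [mem_filter] at hb
    obtain ⟨h1, h2⟩ := mul_start_bounds ha hb.2.1 hb.2.2
    refine ⟨by linarith, by linarith, ?_, ?_⟩
    · rw [hNβ, div_div, div_le_iff₀ (by positivity)]
      linarith
    · rw [hNβ, mul_div_assoc', le_div_iff₀ (by positivity)]
      linarith)
  have hsum := key.trans (add_le_add_left hb _)
  have hpow : (N : ℝ) ^ (2 * β - v - ρ + ε) = N ^ (β - v) * N ^ (β - ρ + ε) := by
    rw [← Real.rpow_add hN0]
    ring_nf
  have hW : (N : ℝ) ^ (1 - ρ + ε) / a = N ^ (β - ρ + ε) := by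
    rw [show 1 - ρ + ε = 1 + (-ρ + ε) by ring, show β - ρ + ε = β + (-ρ + ε) by ring,
      Real.rpow_add hN0 1, Real.rpow_add hN0 β, hNβ, Real.rpow_one]
    ring
  have hLW : (L : ℝ) ≤ N ^ (β - ρ + ε) :=
    hLle.trans (Real.rpow_le_rpow_of_exponent_le hN1.le (by linarith))
  rw [mul_div_assoc, hW]
  refine le_of_mul_le_mul_left (hsum.trans ?_) hL0
  rw [hpow]
  have hWn : 0 ≤ C * (N : ℝ) ^ (β - ρ + ε) := by positivity
  have h1 : C * (N ^ (β - v) * (N : ℝ) ^ (β - ρ + ε)) ≤ 2 * L * (C * N ^ (β - ρ + ε)) := by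
    nlinarith
  nlinarith

end VinogradovMean

namespace VinogradovMean

variable {d : ℕ}

lemma typeTwo_dyadic (α θ : Fin (d + 1) → ℝ) (hα : ∀ i, 0 < α i) (hθ : StrictMono θ)
    (hz : ∀ z : ℤ, (z : ℝ) ≠ θ (Fin.last d)) (hΘ : 3 < θ (Fin.last d)) {ε ρ : ℝ} (hε : 0 < ε)
    (hρ : ρ * (8 * θ (Fin.last d) ^ 2 + 12 * θ (Fin.last d) + 10) = 1) :
    ∃ C ≥ (1 : ℝ), ∀ N : ℕ, C ≤ N → ∀ τ ξ : ℝ, θ (Fin.last d) - 0.1 * ρ ≤ τ →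
      τ ≤ θ (Fin.last d) + 3.2 * ρ → ξ = (N : ℝ) ^ (τ - ρ - θ (Fin.last d)) →
      ∀ (N' i : ℕ) (s : Finset ℕ) (w : ℕ → ℂ), N' ≤ 2 * N → (∀ n, ‖w n‖ ≤ 1) →
      (∀ a ∈ s, 2 ^ i ≤ a ∧ a < 2 ^ (i + 1) ∧ N ≤ a ^ 3 ∧ a ^ 2 ≤ 2 * N) →
      ∑ a ∈ s, ‖∑ b ∈ Ioc (N / a) (N' / a), w b * e (ξ * ppoly α θ (a * b))‖ ≤
        C * (N : ℝ) ^ (1 - ρ + ε) := by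
  obtain ⟨C, hC, h⟩ := typeTwo_block α θ hα hθ hz hΘ hε hρ
  refine ⟨10 * C + 3 + Real.exp 400, by linarith [Real.exp_pos 400],
    fun N hN τ ξ hτ1 hτ2 hξ N' i s w hN' hw hs => ?_⟩
  have hexp0 := Real.exp_pos 400
  have hN400 : Real.exp 400 ≤ N := by linarith
  have hN401 : (401 : ℝ) ≤ N := by linarith [Real.add_one_le_exp 400]
  have hN1 : (1 : ℝ) < N := by linarith
  have hN0 : (0 : ℝ) < N := by linarith
  obtain rfl | ⟨a₀, ha₀⟩ := s.eq_empty_or_nonempty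
  · rw [sum_empty]
    positivity
  have hlog : 400 ≤ Real.log N := (Real.le_log_iff_exp_le hN0).2 hN400
  have hlog0 : 0 < Real.log N := by linarith
  set A : ℝ := 0.7 * 2 ^ i with hA
  have hA0 : 0 < A := by positivity
  have hsr : ∀ a ∈ s, (2 : ℝ) ^ i ≤ a ∧ (a : ℝ) < 2 * 2 ^ i ∧ (N : ℝ) ≤ (a : ℝ) ^ 3 ∧
      (a : ℝ) ^ 2 ≤ 2 * N := fun a ha => by
    obtain ⟨h1, h2, h3, h4⟩ := hs a ha
    refine ⟨by exact_mod_cast h1, ?_, by exact_mod_cast h3, by exact_mod_cast h4⟩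
    rw [pow_succ'] at h2
    exact_mod_cast h2
  have hA1 : Real.log A ≤ Real.log N / 2 := by
    obtain ⟨h1, -, -, h4⟩ := hsr a₀ ha₀
    have h5 : A ^ 2 ≤ N := by
      rw [hA]
      have : ((2 : ℝ) ^ i) ^ 2 ≤ (a₀ : ℝ) ^ 2 := by gcongr
      nlinarith
    have := Real.log_le_log (by positivity) h5
    rw [Real.log_pow] at this
    push_cast at this
    linarith
  have hA2 : 0.328 * Real.log N ≤ Real.log A := by
    obtain ⟨h1, h2, h3, -⟩ := hsr a₀ ha₀
    have h5 := Real.log_le_log hN0 h3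
    have ha0 : (0 : ℝ) < a₀ := lt_of_lt_of_le (by positivity) h1
    rw [Real.log_pow] at h5
    push_cast at h5
    have h6 : 0.35 * (a₀ : ℝ) ≤ A := by rw [hA]; linarith
    have h7 := Real.log_le_log (by positivity) h6
    rw [Real.log_mul (by norm_num) ha0.ne'] at h7
    have h8 := Real.one_sub_inv_le_log_of_pos (show (0 : ℝ) < 0.35 by norm_num)
    norm_num at h8 h7 ⊢
    linarith
  have hNβ := rpow_one_sub_log_div hN1 hA0
  set β := 1 - Real.log A / Real.log N with hβ
  have hβ1 : 1 / 2 ≤ β := by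
    have : Real.log A / Real.log N ≤ 1 / 2 := by
      rw [div_le_iff₀ hlog0]
      linarith
    linarith
  have hβ2 : β ≤ 0.672 := by
    have : 0.328 ≤ Real.log A / Real.log N := by
      rw [le_div_iff₀ hlog0]
      linarith
    linarith
  obtain ⟨v, hv, hvβ, hblock⟩ := h N (by linarith) τ β ξ hτ1 hτ2 hβ1 hβ2 hξ
  have hLfl := half_le_floor (Real.one_le_rpow hN1.le (sub_nonneg.2 hvβ))
  have hLle := Nat.floor_le (show 0 ≤ (N : ℝ) ^ (β - v) by positivity)
  set L := ⌊(N : ℝ) ^ (β - v)⌋₊ with hL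
  have hY : 0 < (N : ℝ) ^ (β - v) := by positivity
  have hL0 : (0 : ℝ) < L := by linarith
  have hN'' : (N' : ℝ) ≤ 2 * N := by exact_mod_cast hN'
  have hsmall : ∀ a ∈ s, (a : ℝ) ≤ 0.1 * N := by
    intro a ha
    obtain ⟨-, -, -, h4⟩ := hsr a ha
    by_contra hlt
    push Not at hlt
    have : (0.1 * (N : ℝ)) ^ 2 < (a : ℝ) ^ 2 := by gcongr
    nlinarith
  let T : ℕ → Finset ℕ := fun a => {b ∈ range (N' / a + 1) | N / a ≤ b ∧ b + L ≤ N' / a}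
  have hT : ∀ a ∈ s, ∀ b ∈ T a, 0.9 * (N : ℝ) ≤ a * b ∧ (a : ℝ) * b ≤ 2 * N ∧
      (N : ℝ) ^ β / 4 ≤ b ∧ (b : ℝ) ≤ 4 * (N : ℝ) ^ β := by
    intro a ha b hb
    rw [mem_filter] at hb
    obtain ⟨h1, h2, -, -⟩ := hsr a ha
    have ha0 : 0 < a := lt_of_lt_of_le (by positivity) (hs a ha).1
    obtain ⟨h5, h6⟩ := mul_start_bounds ha0 hb.2.1 hb.2.2
    have h7 := hsmall a ha
    have h8 : 0.9 * (N : ℝ) ≤ a * b := by linarith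
    have h9 : (a : ℝ) * b ≤ 2 * N := by linarith
    have hb0 : (0 : ℝ) ≤ b := b.cast_nonneg
    refine ⟨h8, h9, ?_, ?_⟩
    · rw [hNβ, div_div, div_le_iff₀ (by positivity), hA]
      have : (a : ℝ) * b ≤ 2 * 2 ^ i * b := by gcongr
      linarith
    · rw [hNβ, mul_div_assoc', le_div_iff₀ (by positivity), hA]
      have : (2 : ℝ) ^ i * b ≤ a * b := by gcongr
      linarith
  have key : ∀ a ∈ s, L * ‖∑ b ∈ Ioc (N / a) (N' / a), w b * e (ξ * ppoly α θ (a * b))‖ ≤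
      ∑ b ∈ T a, ‖∑ y ∈ Icc 1 L, w (b + y) * e (ξ * ppoly α θ (a * (b + y)))‖ + L * L := by
    intro a _
    have := shift_average (F := fun b => w b * e (ξ * ppoly α θ (a * b)))
      (fun n => by rw [norm_mul, norm_e, mul_one]; exact hw n) L (N / a) (N' / a)
    push_cast at this
    exact this
  have hswap : ∑ a ∈ s, ∑ b ∈ T a,
      ‖∑ y ∈ Icc 1 L, w (b + y) * e (ξ * ppoly α θ (a * (b + y)))‖ =
      ∑ b ∈ s.biUnion T, ∑ a ∈ s with b ∈ T a,
        ‖∑ y ∈ Icc 1 L, w (b + y) * e (ξ * ppoly α θ (a * (b + y)))‖ := by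
    apply sum_comm'
    intro a b
    simp only [mem_biUnion, mem_filter]
    exact ⟨fun h => ⟨⟨h.1, h.2⟩, a, h.1, h.2⟩, fun h => h.1⟩
  have hU : ∀ b ∈ s.biUnion T, (N : ℝ) ^ β / 4 ≤ b ∧ (b : ℝ) ≤ 4 * (N : ℝ) ^ β := by
    intro b hb
    obtain ⟨a, ha, hab⟩ := mem_biUnion.1 hb
    exact (hT a ha b hab).2.2
  have hB1 : 1 ≤ (N : ℝ) ^ β := Real.one_le_rpow hN1.le (by linarith)
  have hUcard : ((s.biUnion T).card : ℝ) ≤ 5 * (N : ℝ) ^ β := by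
    refine (card_le_of_forall_le (by positivity) fun b hb => (hU b hb).2).trans ?_
    linarith
  have hinner : ∀ b ∈ s.biUnion T, ∑ a ∈ s with b ∈ T a,
      ‖∑ y ∈ Icc 1 L, w (b + y) * e (ξ * ppoly α θ (a * (b + y)))‖ ≤
        C * (N : ℝ) ^ (1 - v - ρ + ε) := by
    intro b hb
    have := hblock {a ∈ s | b ∈ T a} b (fun z => w (b + z.toNat)) (fun _ => hw _)
      (fun a ha => by
        rw [mem_filter] at ha
        obtain ⟨h1, h2, -, -⟩ := hT a ha.1 b ha.2
        exact ⟨by linarith, by linarith⟩) (hU b hb).1 (hU b hb).2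
    simpa only [Int.toNat_natCast] using this
  have hscard : (s.card : ℝ) ≤ 2 * (N : ℝ) ^ (1 - β) := by
    have h1 : s ⊆ Ico (2 ^ i) (2 ^ (i + 1)) := fun a ha =>
      mem_Ico.2 ⟨(hs a ha).1, (hs a ha).2.1⟩
    have h2 := card_le_card h1
    rw [Nat.card_Ico, pow_succ, mul_two, Nat.add_sub_cancel] at h2
    have h3 : (s.card : ℝ) ≤ 2 ^ i := by exact_mod_cast h2
    rw [Real.rpow_sub hN0, Real.rpow_one, hNβ, div_div_cancel₀ hN0.ne', hA]
    have : (0 : ℝ) < 2 ^ i := by positivity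
    linarith
  have htot : L * ∑ a ∈ s, ‖∑ b ∈ Ioc (N / a) (N' / a), w b * e (ξ * ppoly α θ (a * b))‖ ≤
      5 * (N : ℝ) ^ β * (C * (N : ℝ) ^ (1 - v - ρ + ε)) + 2 * (N : ℝ) ^ (1 - β) * (L * L) := by
    rw [mul_sum]
    refine (sum_le_sum key).trans ?_
    rw [sum_add_distrib, hswap, sum_const, nsmul_eq_mul]
    refine add_le_add ((sum_le_card_nsmul _ _ _ hinner).trans ?_) (by gcongr)
    rw [nsmul_eq_mul]
    gcongr
  have e1 : (N : ℝ) ^ β * (N : ℝ) ^ (1 - v - ρ + ε) =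
      (N : ℝ) ^ (β - v) * (N : ℝ) ^ (1 - ρ + ε) := by
    rw [← Real.rpow_add hN0, ← Real.rpow_add hN0]
    ring_nf
  have e2 : (N : ℝ) ^ (1 - β) * L ≤ (N : ℝ) ^ (1 - ρ + ε) := by
    calc (N : ℝ) ^ (1 - β) * L ≤ (N : ℝ) ^ (1 - β) * (N : ℝ) ^ (β - v) := by gcongr
      _ = (N : ℝ) ^ (1 - v) := by
        rw [← Real.rpow_add hN0]
        ring_nf
      _ ≤ _ := Real.rpow_le_rpow_of_exponent_le hN1.le (by linarith)
  set W := (N : ℝ) ^ (1 - ρ + ε)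
  have hW : 0 < W := by positivity
  refine le_of_mul_le_mul_left (htot.trans ?_) hL0
  have e3 : (N : ℝ) ^ (β - v) * (C * W) ≤ 2 * L * (C * W) := by
    gcongr
    linarith
  have e4 := mul_le_mul_of_nonneg_left e2 hL0.le
  have e5 : 0 ≤ (L : ℝ) * W * Real.exp 400 := by positivity
  have e6 : 0 ≤ (L : ℝ) * W := by positivity
  have e7 : 5 * (N : ℝ) ^ β * (C * (N : ℝ) ^ (1 - v - ρ + ε)) =
      5 * ((N : ℝ) ^ (β - v) * (C * W)) := by
    linear_combination 5 * C * e1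
  rw [e7]
  linarith

end VinogradovMean

namespace VinogradovMean

variable {d : ℕ}

lemma natLog_le_rpow {ε : ℝ} (hε : 0 < ε) {N : ℕ} (hN : 1 ≤ N) :
    (Nat.log 2 N : ℝ) ≤ 2 / ε * (N : ℝ) ^ ε := by
  have h1 := Real.natLog_le_logb N 2
  have hN1 : (1 : ℝ) ≤ N := by exact_mod_cast hN
  have h2 := Real.log_le_rpow_div (x := N) (by linarith) hε
  have h3 := Real.log_nonneg hN1
  have h4 : Real.logb 2 N ≤ 2 * Real.log N := by
    rw [Real.logb, div_le_iff₀ (Real.log_pos one_lt_two)]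
    nlinarith [Real.log_two_gt_d9]
  push_cast at h1
  calc (Nat.log 2 N : ℝ) ≤ 2 * ((N : ℝ) ^ ε / ε) := by linarith
    _ = _ := by ring

lemma typeTwo_sum (α θ : Fin (d + 1) → ℝ) (hα : ∀ i, 0 < α i) (hθ : StrictMono θ)
    (hz : ∀ z : ℤ, (z : ℝ) ≠ θ (Fin.last d)) (hΘ : 3 < θ (Fin.last d)) {ε ρ : ℝ} (hε : 0 < ε)
    (hρ : ρ * (8 * θ (Fin.last d) ^ 2 + 12 * θ (Fin.last d) + 10) = 1) :
    ∃ C ≥ (1 : ℝ), ∀ N : ℕ, C ≤ N → ∀ τ ξ : ℝ, θ (Fin.last d) - 0.1 * ρ ≤ τ →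
      τ ≤ θ (Fin.last d) + 3.2 * ρ → ξ = (N : ℝ) ^ (τ - ρ - θ (Fin.last d)) →
      ∀ (N' : ℕ) (s : Finset ℕ) (u w : ℕ → ℂ), N' ≤ 2 * N → (∀ n, ‖u n‖ ≤ 1) →
      (∀ n, ‖w n‖ ≤ 1) → (∀ a ∈ s, N ≤ a ^ 3 ∧ a ^ 2 ≤ 2 * N) →
      ‖∑ a ∈ s, u a * ∑ b ∈ Ioc (N / a) (N' / a), w b * e (ξ * ppoly α θ (a * b))‖ ≤
        C * (N : ℝ) ^ (1 - ρ + ε) := by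
  obtain ⟨C, hC, h⟩ := typeTwo_dyadic α θ hα hθ hz hΘ (half_pos hε) hρ
  refine ⟨(4 / ε + 2) * C, ?_, fun N hN τ ξ hτ1 hτ2 hξ N' s u w hN' hu hw hs => ?_⟩
  · have : 0 < 4 / ε := by positivity
    nlinarith
  have h4ε : 0 < 4 / ε := by positivity
  have hNC : C ≤ N := by nlinarith
  have hN1 : (1 : ℝ) ≤ N := by linarith
  have hN1' : 1 ≤ N := by exact_mod_cast hN1
  set G : ℕ → ℝ := fun a => ‖∑ b ∈ Ioc (N / a) (N' / a), w b * e (ξ * ppoly α θ (a * b))‖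
    with hG
  have h1 : ‖∑ a ∈ s, u a * ∑ b ∈ Ioc (N / a) (N' / a), w b * e (ξ * ppoly α θ (a * b))‖ ≤
      ∑ a ∈ s, G a := by
    refine (norm_sum_le _ _).trans (sum_le_sum fun a _ => ?_)
    rw [norm_mul]
    exact mul_le_of_le_one_left (norm_nonneg _) (hu a)
  have ha0 : ∀ a ∈ s, a ≠ 0 := by
    rintro a ha rfl
    have := (hs 0 ha).1
    omega
  have h2 : ∑ a ∈ s, G a = ∑ i ∈ range (Nat.log 2 N + 2), ∑ a ∈ s with Nat.log 2 a = i, G a := by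
    refine (sum_fiberwise_of_maps_to (fun a ha => ?_) _).symm
    rw [mem_range]
    have h3 : a ≤ 2 * N := le_trans (Nat.le_self_pow two_ne_zero a) (hs a ha).2
    have h4 := Nat.log_mono_right (b := 2) h3
    rw [mul_comm, Nat.log_mul_base one_lt_two (by omega)] at h4
    omega
  rw [h2] at h1
  refine h1.trans ?_
  have h5 : ∀ i ∈ range (Nat.log 2 N + 2), ∑ a ∈ s with Nat.log 2 a = i, G a ≤
      C * (N : ℝ) ^ (1 - ρ + ε / 2) := by
    intro i _
    refine h N hNC τ ξ hτ1 hτ2 hξ N' i _ w hN' hw fun a ha => ?_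
    rw [mem_filter] at ha
    refine ⟨?_, ?_, hs a ha.1⟩
    · rw [← ha.2]
      exact Nat.pow_log_le_self 2 (ha0 a ha.1)
    · rw [← ha.2]
      exact Nat.lt_pow_succ_log_self one_lt_two a
  refine (sum_le_card_nsmul _ _ _ h5).trans ?_
  rw [card_range, nsmul_eq_mul]
  have h6 := natLog_le_rpow (half_pos hε) hN1'
  have h7 : 1 ≤ (N : ℝ) ^ (ε / 2) := Real.one_le_rpow hN1 (by linarith)
  have h8 : ((Nat.log 2 N + 2 : ℕ) : ℝ) ≤ (4 / ε + 2) * (N : ℝ) ^ (ε / 2) := by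
    push_cast
    have : 2 / (ε / 2) = 4 / ε := by ring
    rw [this] at h6
    linarith
  calc _ ≤ (4 / ε + 2) * (N : ℝ) ^ (ε / 2) * (C * (N : ℝ) ^ (1 - ρ + ε / 2)) := by gcongr
    _ = (4 / ε + 2) * C * ((N : ℝ) ^ (1 - ρ + ε / 2) * (N : ℝ) ^ (ε / 2)) := by ring
    _ = _ := by
      rw [← Real.rpow_add (by linarith)]
      ring_nf

/-- Bilinear sums over the hyperbolic region, both variables exceeding the cube root. -/
lemma typeTwo_hyperbolic (α θ : Fin (d + 1) → ℝ) (hα : ∀ i, 0 < α i) (hθ : StrictMono θ)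
    (hz : ∀ z : ℤ, (z : ℝ) ≠ θ (Fin.last d)) (hΘ : 3 < θ (Fin.last d)) {ε ρ : ℝ} (hε : 0 < ε)
    (hρ : ρ * (8 * θ (Fin.last d) ^ 2 + 12 * θ (Fin.last d) + 10) = 1) :
    ∃ C ≥ (1 : ℝ), ∀ N : ℕ, C ≤ N → ∀ τ ξ : ℝ, θ (Fin.last d) - 0.1 * ρ ≤ τ →
      τ ≤ θ (Fin.last d) + 3.2 * ρ → ξ = (N : ℝ) ^ (τ - ρ - θ (Fin.last d)) →
      ∀ (N' : ℕ) (u w : ℕ → ℂ), N' ≤ 2 * N → (∀ n, ‖u n‖ ≤ 1) → (∀ n, ‖w n‖ ≤ 1) →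
      (∀ n, u n ≠ 0 → N ≤ n ^ 3) → (∀ n, w n ≠ 0 → N ≤ n ^ 3) →
      ‖∑ a ∈ Ioc 0 N', u a * ∑ b ∈ Ioc (N / a) (N' / a), w b * e (ξ * ppoly α θ (a * b))‖ ≤
        C * (N : ℝ) ^ (1 - ρ + ε) := by
  obtain ⟨C, hC, h⟩ := typeTwo_sum α θ hα hθ hz hΘ hε hρ
  refine ⟨2 * C, by linarith, fun N hN τ ξ hτ1 hτ2 hξ N' u w hN' hu hw hu0 hw0 => ?_⟩
  have hNC : C ≤ N := by linarith
  have hside : ∀ u w : ℕ → ℂ, (∀ n, ‖u n‖ ≤ 1) → (∀ n, ‖w n‖ ≤ 1) → (∀ n, u n ≠ 0 → N ≤ n ^ 3) →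
      ‖∑ a ∈ Ioc 0 N' with a * a ≤ N', u a * ∑ b ∈ Ioc (N / a) (N' / a),
        w b * e (ξ * ppoly α θ (a * b))‖ ≤ C * (N : ℝ) ^ (1 - ρ + ε) := by
    intro u w hu hw hu0
    have h1 : ∑ a ∈ Ioc 0 N' with a * a ≤ N', u a * ∑ b ∈ Ioc (N / a) (N' / a),
        w b * e (ξ * ppoly α θ (a * b)) = ∑ a ∈ Ioc 0 N' with (a * a ≤ N' ∧ u a ≠ 0),
        u a * ∑ b ∈ Ioc (N / a) (N' / a), w b * e (ξ * ppoly α θ (a * b)) := by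
      rw [← filter_filter]
      refine (sum_filter_of_ne fun a _ ha => left_ne_zero_of_mul ha).symm
    rw [h1]
    refine h N hNC τ ξ hτ1 hτ2 hξ N' _ u w hN' hu hw fun a ha => ?_
    rw [mem_filter] at ha
    exact ⟨hu0 a ha.2.2, by rw [pow_two]; exact ha.2.1.trans hN'⟩
  rw [← sum_filter_add_sum_filter_not (Ioc 0 N') fun a => a * a ≤ N']
  have hswap : ∑ a ∈ Ioc 0 N' with ¬ a * a ≤ N', u a * ∑ b ∈ Ioc (N / a) (N' / a),
        w b * e (ξ * ppoly α θ (a * b)) =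
      ∑ b ∈ Ioc 0 N' with b * b ≤ N', w b * ∑ a ∈ Ioc (N / b) (N' / b),
        (if a * a ≤ N' then 0 else u a) * e (ξ * ppoly α θ (b * a)) := by
    have h1 : ∀ b ∈ {b ∈ Ioc 0 N' | b * b ≤ N'}, w b * ∑ a ∈ Ioc (N / b) (N' / b),
        (if a * a ≤ N' then 0 else u a) * e (ξ * ppoly α θ (b * a)) =
        ∑ a ∈ Ioc (N / b) (N' / b) with ¬ a * a ≤ N',
          u a * (w b * e (ξ * ppoly α θ (a * b))) := by
      intro b _
      rw [mul_sum, sum_filter]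
      refine sum_congr rfl fun a _ => ?_
      rw [mul_comm (b : ℝ)]
      split_ifs
      · simp_all
      · ring
    rw [sum_congr rfl h1]
    simp_rw [mul_sum]
    apply sum_comm'
    intro a b
    simp only [mem_filter, mem_Ioc, not_le]
    constructor
    · rintro ⟨⟨⟨h1, h2⟩, h3⟩, h4, h5⟩
      rw [Nat.div_lt_iff_lt_mul h1] at h4
      rw [Nat.le_div_iff_mul_le h1] at h5
      have hb : 0 < b := Nat.pos_of_ne_zero fun hb => by simp [hb] at h4
      have hba : b < a := by
        by_contra hab
        push Not at hab
        have := Nat.mul_le_mul_right a hab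
        omega
      refine ⟨⟨⟨(Nat.div_lt_iff_lt_mul hb).2 (by linarith), ?_⟩, h3⟩, ⟨hb, by nlinarith⟩, ?_⟩
      · rw [Nat.le_div_iff_mul_le hb]
        linarith
      · have := Nat.mul_le_mul_left b hba.le
        omega
    · rintro ⟨⟨⟨h1, h2⟩, h3⟩, ⟨h4, h5⟩, h6⟩
      rw [Nat.div_lt_iff_lt_mul h4] at h1
      rw [Nat.le_div_iff_mul_le h4] at h2
      have ha : 0 < a := Nat.pos_of_ne_zero fun ha => by simp [ha] at h1
      refine ⟨⟨⟨ha, by nlinarith⟩, h3⟩, (Nat.div_lt_iff_lt_mul ha).2 (by linarith), ?_⟩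
      rw [Nat.le_div_iff_mul_le ha]
      linarith
  rw [hswap]
  refine (norm_add_le _ _).trans ?_
  have h1 := hside u w hu hw hu0
  have h2 := hside w (fun a => if a * a ≤ N' then 0 else u a) hw
    (fun n => by split_ifs <;> simp [hu]) hw0
  linarith

end VinogradovMean

namespace VinogradovMean

lemma card_divisors_le_rpow {ε : ℝ} (hε : 0 < ε) :
    ∃ C ≥ (1 : ℝ), ∀ n : ℕ, n ≠ 0 → (n.divisors.card : ℝ) ≤ C * (n : ℝ) ^ ε := by
  set P : ℕ := ⌈(2 : ℝ) ^ (1 / ε)⌉₊ with hP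
  set K : ℝ := max 1 (1 / (ε * Real.log 2)) with hK
  have hl : 0 < Real.log 2 := Real.log_pos one_lt_two
  have hK1 : 1 ≤ K := le_max_left _ _
  have hK2 : 1 ≤ K * (ε * Real.log 2) := by
    rw [← div_le_iff₀ (by positivity)]
    exact le_max_right _ _
  have hlocal : ∀ p a : ℕ, p.Prime →
      ((a + 1 : ℕ) : ℝ) ≤ (if p < P then K else 1) * ((p : ℝ) ^ a) ^ ε := by
    intro p a hp
    have hp2 : (2 : ℝ) ≤ p := by exact_mod_cast hp.two_le
    have hswap : ((p : ℝ) ^ a) ^ ε = ((p : ℝ) ^ ε) ^ a :=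
      (Real.rpow_pow_comm (by linarith) ε a).symm
    split_ifs with hpP
    · have h1 : 1 + a * (ε * Real.log 2) ≤ ((p : ℝ) ^ a) ^ ε := by
        calc 1 + a * (ε * Real.log 2) = a * (ε * Real.log 2) + 1 := by ring
          _ ≤ Real.exp (a * (ε * Real.log 2)) := Real.add_one_le_exp _
          _ = ((2 : ℝ) ^ a) ^ ε := by
            rw [Real.rpow_def_of_pos (by positivity), Real.log_pow]
            congr 1
            ring
          _ ≤ _ := by gcongr
      have h2 : (a : ℝ) * 1 ≤ a * (K * (ε * Real.log 2)) := by gcongr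
      push_cast
      calc (a : ℝ) + 1 ≤ K * (1 + a * (ε * Real.log 2)) := by linarith
        _ ≤ _ := by gcongr
    · have h1 : (2 : ℝ) ≤ (p : ℝ) ^ ε := by
        have h2 : (2 : ℝ) ^ (1 / ε) ≤ p := (Nat.le_ceil _).trans (by exact_mod_cast not_lt.1 hpP)
        calc (2 : ℝ) = ((2 : ℝ) ^ (1 / ε)) ^ ε := by
              rw [← Real.rpow_mul (by norm_num), one_div_mul_cancel hε.ne', Real.rpow_one]
          _ ≤ _ := by gcongr
      rw [one_mul, hswap]
      calc ((a + 1 : ℕ) : ℝ) ≤ 2 ^ a := by exact_mod_cast Nat.lt_two_pow_self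
        _ ≤ _ := by gcongr
  refine ⟨K ^ P, one_le_pow₀ hK1, fun n hn => ?_⟩
  have hprod : ((n : ℕ) : ℝ) ^ ε = ∏ p ∈ n.primeFactors, ((p : ℝ) ^ n.factorization p) ^ ε := by
    rw [Real.finsetProd_rpow _ _ fun p _ => by positivity]
    congr 1
    conv_lhs => rw [← Nat.prod_factorization_pow_eq_self hn]
    rw [Finsupp.prod]
    push_cast
    rfl
  have hKprod : ∏ p ∈ n.primeFactors, (if p < P then K else 1) ≤ K ^ P := by
    rw [← prod_filter, prod_const]
    refine pow_le_pow_right₀ hK1 ?_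
    calc _ ≤ (range P).card := card_le_card fun p hp => by simp_all
      _ = P := card_range P
  rw [Nat.card_divisors hn, hprod]
  push_cast
  calc ∏ p ∈ n.primeFactors, ((n.factorization p : ℝ) + 1)
      ≤ ∏ p ∈ n.primeFactors, ((if p < P then K else 1) * ((p : ℝ) ^ n.factorization p) ^ ε) := by
        refine prod_le_prod (fun p _ => by positivity) fun p hp => ?_
        exact_mod_cast hlocal p _ (Nat.prime_of_mem_primeFactors hp)
    _ ≤ _ := by
        rw [prod_mul_distrib]
        gcongr

/-- Partial summation against a logarithmic weight. -/
lemma norm_sum_log_mul_le {F : ℕ → ℂ} {M : ℝ} {x y : ℕ} (hxy : x ≤ y)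
    (hF : ∀ t ≤ y, ‖∑ b ∈ Ioc x t, F b‖ ≤ M) :
    ‖∑ b ∈ Ioc x y, (Real.log b : ℂ) * F b‖ ≤ 2 * (M * Real.log y) := by
  have key : ∀ t, x ≤ t → t ≤ y →
      ‖∑ b ∈ Ioc x t, (Real.log b : ℂ) * F b - Real.log t * ∑ b ∈ Ioc x t, F b‖ ≤
        M * Real.log t := by
    intro t hxt
    induction t, hxt using Nat.le_induction with
    | base =>
      intro h
      have h0 := (norm_nonneg _).trans (hF x h)
      simpa using mul_nonneg h0 (Real.log_natCast_nonneg x)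
    | succ t hxt ih =>
      intro h
      have hlog : Real.log t ≤ Real.log (t + 1 : ℕ) := by
        rcases Nat.eq_zero_or_pos t with rfl | ht
        · simp
        · have ht' : (0 : ℝ) < t := by exact_mod_cast ht
          exact Real.log_le_log ht' (by push_cast; linarith)
      have hstep : ∑ b ∈ Ioc x (t + 1), (Real.log b : ℂ) * F b -
          Real.log (t + 1 : ℕ) * ∑ b ∈ Ioc x (t + 1), F b =
          (∑ b ∈ Ioc x t, (Real.log b : ℂ) * F b - Real.log t * ∑ b ∈ Ioc x t, F b) -
            ((Real.log (t + 1 : ℕ) - Real.log t : ℝ) : ℂ) * ∑ b ∈ Ioc x t, F b := by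
        rw [sum_Ioc_succ_top hxt, sum_Ioc_succ_top hxt]
        push_cast
        ring
      rw [hstep]
      refine (norm_sub_le _ _).trans ?_
      rw [norm_mul, Complex.norm_real, Real.norm_of_nonneg (sub_nonneg.2 hlog)]
      have h1 := mul_le_mul_of_nonneg_left (hF t (by omega)) (sub_nonneg.2 hlog)
      have h2 := ih (by omega)
      linarith
  have h1 := key y hxy le_rfl
  have h2 : ‖(Real.log y : ℂ) * ∑ b ∈ Ioc x y, F b‖ ≤ Real.log y * M := by
    rw [norm_mul, Complex.norm_real, Real.norm_of_nonneg (Real.log_natCast_nonneg y)]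
    exact mul_le_mul_of_nonneg_left (hF y le_rfl) (Real.log_natCast_nonneg y)
  have h3 := norm_add_le (∑ b ∈ Ioc x y, (Real.log b : ℂ) * F b - Real.log y * ∑ b ∈ Ioc x y, F b)
    (Real.log y * ∑ b ∈ Ioc x y, F b)
  rw [sub_add_cancel] at h3
  linarith

lemma sum_convolution_mul (A B : ArithmeticFunction ℝ) (g : ℕ → ℂ) (N N' : ℕ) :
    ∑ n ∈ Ioc N N', ((A * B) n : ℂ) * g n =
      ∑ a ∈ Ioc 0 N', (A a : ℂ) * ∑ b ∈ Ioc (N / a) (N' / a), (B b : ℂ) * g (a * b) := by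
  have h1 : ∀ n ∈ Ioc N N', ((A * B) n : ℂ) * g n =
      ∑ x ∈ Ioc 0 N' ×ˢ Ioc 0 N', if x.1 * x.2 = n then (A x.1 : ℂ) * (B x.2 * g (x.1 * x.2))
        else 0 := by
    intro n hn
    rw [mem_Ioc] at hn
    rw [ArithmeticFunction.mul_apply,
      Nat.divisorsAntidiagonal_eq_prod_filter_of_le (by omega) hn.2, ← sum_filter]
    push_cast
    rw [sum_mul]
    refine sum_congr rfl fun x hx => ?_
    rw [(mem_filter.1 hx).2]
    ring
  rw [sum_congr rfl h1, sum_comm, sum_product]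
  refine sum_congr rfl fun a ha => ?_
  rw [mem_Ioc] at ha
  simp_rw [sum_ite_eq, mul_sum]
  rw [← sum_filter]
  refine sum_congr ?_ fun _ _ => rfl
  ext b
  simp only [mem_filter, mem_Ioc, Nat.div_lt_iff_lt_mul ha.1, Nat.le_div_iff_mul_le ha.1]
  rw [mul_comm b a]
  constructor
  · rintro ⟨_, h⟩
    exact h
  · rintro ⟨h, h'⟩
    have : 0 < b := Nat.pos_of_ne_zero fun hb => by simp [hb] at h
    exact ⟨⟨this, by nlinarith⟩, h, h'⟩

lemma sum_one_div_le_one_add_log (U : ℕ) : ∑ a ∈ Ioc 0 U, (1 : ℝ) / a ≤ 1 + Real.log U := by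
  have h := harmonic_le_one_add_log U
  rw [harmonic_eq_sum_Icc] at h
  push_cast at h
  simpa [one_div] using! h

end VinogradovMean

namespace VinogradovMean

section Vaughan

open scoped ArithmeticFunction.Moebius ArithmeticFunction.zeta ArithmeticFunction.vonMangoldt

/-- The restriction of an arithmetic function to `[0, U]`. -/
def truncate (f : ArithmeticFunction ℝ) (U : ℕ) : ArithmeticFunction ℝ :=
  ⟨fun n => if n ≤ U then f n else 0, by simp⟩

lemma arithmeticFunction_sub_apply (f g : ArithmeticFunction ℝ) (n : ℕ) :
    (f - g) n = f n - g n := by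
  rw [sub_eq_add_neg, ArithmeticFunction.add_apply, sub_eq_add_neg]
  rfl

lemma truncate_apply (f : ArithmeticFunction ℝ) (U n : ℕ) :
    truncate f U n = if n ≤ U then f n else 0 := rfl

/-- Vaughan's identity with both cutoffs equal to `U`. -/
lemma vaughan_identity (U : ℕ) :
    Λ = truncate Λ U + truncate (μ : ArithmeticFunction ℝ) U * ArithmeticFunction.log
      - truncate (μ : ArithmeticFunction ℝ) U * truncate Λ U * (ζ : ArithmeticFunction ℝ)
      + (Λ - truncate Λ U) * (((μ : ArithmeticFunction ℝ) - truncate (μ : ArithmeticFunction ℝ) U) *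
        (ζ : ArithmeticFunction ℝ)) := by
  have h1 := ArithmeticFunction.vonMangoldt_mul_zeta
  have h2 : (μ : ArithmeticFunction ℝ) * (ζ : ArithmeticFunction ℝ) = 1 :=
    ArithmeticFunction.coe_moebius_mul_coe_zeta
  rw [← h1, sub_mul (μ : ArithmeticFunction ℝ), h2]
  ring

lemma abs_moebius_real_le_one (n : ℕ) : |(μ : ArithmeticFunction ℝ) n| ≤ 1 := by
  rw [ArithmeticFunction.intCoe_apply]
  exact_mod_cast ArithmeticFunction.abs_moebius_le_one

lemma abs_truncate_moebius_le (U n : ℕ) : |truncate (μ : ArithmeticFunction ℝ) U n| ≤ 1 := by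
  rw [truncate_apply]
  split_ifs
  · exact abs_moebius_real_le_one n
  · simp

lemma abs_truncate_mul_truncate_le_log (U n : ℕ) :
    |(truncate (μ : ArithmeticFunction ℝ) U * truncate Λ U) n| ≤ Real.log n := by
  rw [ArithmeticFunction.mul_apply, ← ArithmeticFunction.vonMangoldt_sum,
    ← Nat.sum_divisorsAntidiagonal' fun _ j => Λ j]
  refine (abs_sum_le_sum_abs _ _).trans (sum_le_sum fun x _ => ?_)
  have h : |truncate Λ U x.2| ≤ Λ x.2 := by
    rw [truncate_apply]
    split_ifs
    · rw [abs_of_nonneg ArithmeticFunction.vonMangoldt_nonneg]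
    · simp
  rw [abs_mul]
  calc _ ≤ 1 * Λ x.2 := by
        gcongr
        exact abs_truncate_moebius_le U _
    _ = _ := one_mul _

lemma truncate_mul_truncate_eq_zero {U n : ℕ} (hn : U * U < n) :
    (truncate (μ : ArithmeticFunction ℝ) U * truncate Λ U) n = 0 := by
  rw [ArithmeticFunction.mul_apply]
  refine sum_eq_zero fun x hx => ?_
  rw [Nat.mem_divisorsAntidiagonal] at hx
  rw [truncate_apply, truncate_apply]
  split_ifs with h1 h2
  · have := Nat.mul_le_mul h1 h2
    omega
  all_goals simp

lemma abs_vonMangoldt_sub_truncate_le_log (U n : ℕ) : |(Λ - truncate Λ U) n| ≤ Real.log n := by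
  rw [arithmeticFunction_sub_apply, truncate_apply]
  split_ifs
  · simpa using Real.log_natCast_nonneg n
  · rw [sub_zero, abs_of_nonneg ArithmeticFunction.vonMangoldt_nonneg]
    exact ArithmeticFunction.vonMangoldt_le_log

lemma vonMangoldt_sub_truncate_eq_zero {U n : ℕ} (hn : n ≤ U) : (Λ - truncate Λ U) n = 0 := by
  rw [arithmeticFunction_sub_apply, truncate_apply, if_pos hn, sub_self]

lemma abs_moebius_sub_truncate_mul_zeta_le (U n : ℕ) :
    |(((μ : ArithmeticFunction ℝ) - truncate (μ : ArithmeticFunction ℝ) U) *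
      (ζ : ArithmeticFunction ℝ)) n| ≤ n.divisors.card := by
  rw [ArithmeticFunction.coe_mul_zeta_apply]
  refine (abs_sum_le_sum_abs _ _).trans ?_
  rw [card_eq_sum_ones, Nat.cast_sum]
  refine sum_le_sum fun i _ => ?_
  rw [arithmeticFunction_sub_apply, truncate_apply]
  split_ifs
  · simp
  · rw [sub_zero, Nat.cast_one]
    exact abs_moebius_real_le_one i

lemma moebius_sub_truncate_mul_zeta_eq_zero {U n : ℕ} (hn : n ≤ U) :
    (((μ : ArithmeticFunction ℝ) - truncate (μ : ArithmeticFunction ℝ) U) *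
      (ζ : ArithmeticFunction ℝ)) n = 0 := by
  rw [ArithmeticFunction.coe_mul_zeta_apply]
  refine sum_eq_zero fun i hi => ?_
  rw [arithmeticFunction_sub_apply, truncate_apply, if_pos ((Nat.divisor_le hi).trans hn), sub_self]

lemma exists_cube_root_floor (N : ℕ) : ∃ U : ℕ, U ^ 3 ≤ N ∧ N < (U + 1) ^ 3 := by
  refine ⟨Nat.findGreatest (fun U => U ^ 3 ≤ N) N, ?_, ?_⟩
  · exact Nat.findGreatest_spec (P := fun U => U ^ 3 ≤ N) (Nat.zero_le N) (by simp)
  · by_contra! h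
    have h1 : Nat.findGreatest (fun U => U ^ 3 ≤ N) N + 1 ≤ N :=
      (Nat.le_self_pow (by norm_num) _).trans h
    have := Nat.le_findGreatest (P := fun U => U ^ 3 ≤ N) h1 h
    omega

/-- Bilinear sums with coefficients of arbitrary size. -/
lemma norm_bilinear_le {g : ℕ → ℂ} {N N' : ℕ} {T : ℝ}
    (hII : ∀ u w : ℕ → ℂ, (∀ n, ‖u n‖ ≤ 1) → (∀ n, ‖w n‖ ≤ 1) → (∀ n, u n ≠ 0 → N ≤ n ^ 3) →
      (∀ n, w n ≠ 0 → N ≤ n ^ 3) →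
      ‖∑ a ∈ Ioc 0 N', u a * ∑ b ∈ Ioc (N / a) (N' / a), w b * g (a * b)‖ ≤ T)
    {Ku Kw : ℝ} (hKu : 0 < Ku) (hKw : 0 < Kw) {u w : ℕ → ℝ}
    (hu : ∀ n ≤ N', |u n| ≤ Ku) (hw : ∀ n ≤ N', |w n| ≤ Kw)
    (hu0 : ∀ n ≤ N', u n ≠ 0 → N ≤ n ^ 3) (hw0 : ∀ n ≤ N', w n ≠ 0 → N ≤ n ^ 3) :
    ‖∑ a ∈ Ioc 0 N', (u a : ℂ) * ∑ b ∈ Ioc (N / a) (N' / a), (w b : ℂ) * g (a * b)‖ ≤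
      Ku * Kw * T := by
  have hbound : ∀ (K : ℝ) (v : ℕ → ℝ), 0 < K → (∀ n ≤ N', |v n| ≤ K) →
      ∀ n, ‖(if n ≤ N' then (v n / K : ℂ) else 0)‖ ≤ 1 := by
    intro K v hK hv n
    split_ifs with hn
    · rw [norm_div, Complex.norm_real, Complex.norm_real, Real.norm_of_nonneg hK.le,
        Real.norm_eq_abs]
      exact (div_le_one hK).2 (hv n hn)
    · simp
  have hsupp : ∀ (K : ℝ) (v : ℕ → ℝ), (∀ n ≤ N', v n ≠ 0 → N ≤ n ^ 3) →
      ∀ n, (if n ≤ N' then (v n / K : ℂ) else 0) ≠ 0 → N ≤ n ^ 3 := by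
    intro K v hv n hn
    split_ifs at hn with h
    · exact hv n h fun h0 => hn (by simp [h0])
    · exact absurd rfl hn
  have hKu' : (Ku : ℂ) ≠ 0 := by exact_mod_cast hKu.ne'
  have hKw' : (Kw : ℂ) ≠ 0 := by exact_mod_cast hKw.ne'
  have key := hII _ _ (hbound Ku u hKu hu) (hbound Kw w hKw hw) (hsupp Ku u hu0) (hsupp Kw w hw0)
  have heq : ∑ a ∈ Ioc 0 N', (u a : ℂ) * ∑ b ∈ Ioc (N / a) (N' / a), (w b : ℂ) * g (a * b) =
      (Ku * Kw : ℂ) * ∑ a ∈ Ioc 0 N', (if a ≤ N' then (u a / Ku : ℂ) else 0) *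
        ∑ b ∈ Ioc (N / a) (N' / a), (if b ≤ N' then (w b / Kw : ℂ) else 0) * g (a * b) := by
    rw [mul_sum]
    refine sum_congr rfl fun a ha => ?_
    rw [if_pos (mem_Ioc.1 ha).2, mul_sum, mul_sum, mul_sum]
    refine sum_congr rfl fun b hb => ?_
    rw [if_pos ((mem_Ioc.1 hb).2.trans (Nat.div_le_self _ _))]
    field_simp
  rw [heq, norm_mul, norm_mul, Complex.norm_real, Complex.norm_real, Real.norm_of_nonneg hKu.le,
    Real.norm_of_nonneg hKw.le]
  gcongr

/-- Vaughan's bound for sums over primes from Type I and Type II estimates. -/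
lemma norm_sum_vonMangoldt_mul_le {g : ℕ → ℂ} {N N' : ℕ} {T H D : ℝ} (hNN' : N ≤ N')
    (hI : ∀ a, 1 ≤ a → a ^ 3 ≤ N → ∀ M ≤ N', ‖∑ b ∈ Ioc (N / a) (M / a), g (a * b)‖ ≤ T / a)
    (hII : ∀ u w : ℕ → ℂ, (∀ n, ‖u n‖ ≤ 1) → (∀ n, ‖w n‖ ≤ 1) → (∀ n, u n ≠ 0 → N ≤ n ^ 3) →
      (∀ n, w n ≠ 0 → N ≤ n ^ 3) →
      ‖∑ a ∈ Ioc 0 N', u a * ∑ b ∈ Ioc (N / a) (N' / a), w b * g (a * b)‖ ≤ T)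
    (hT : 0 ≤ T) (hH : 1 ≤ H) (hH' : Real.log N' ≤ H) (hD : 0 < D)
    (hdiv : ∀ n ≤ N', (n.divisors.card : ℝ) ≤ D) :
    ‖∑ n ∈ Ioc N N', (Λ n : ℂ) * g n‖ ≤ T * (3 * H * (1 + H) + H + H * D) := by
  obtain ⟨U, hU, hNU⟩ := exists_cube_root_floor N
  have hUN : U ≤ N := (Nat.le_self_pow (by norm_num) U).trans hU
  have hlog : ∀ n ≤ N', Real.log n ≤ H := by
    intro n hn
    rcases Nat.eq_zero_or_pos n with rfl | h
    · simpa using by linarith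
    · have h' : (0 : ℝ) < n := by exact_mod_cast h
      exact (Real.log_le_log h' (by exact_mod_cast hn)).trans hH'
  have hlarge : ∀ n, U < n → N ≤ n ^ 3 := fun n hn =>
    hNU.le.trans (Nat.pow_le_pow_left hn 3)
  have hsum := (sum_one_div_le_one_add_log U).trans
    (add_le_add_right (hlog U (hUN.trans hNN')) 1)
  have hU3 : ∀ a ∈ Ioc 0 U, 1 ≤ a ∧ a ^ 3 ≤ N := fun a ha =>
    ⟨(mem_Ioc.1 ha).1, (Nat.pow_le_pow_left (mem_Ioc.1 ha).2 3).trans hU⟩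
  set c := truncate (μ : ArithmeticFunction ℝ) U * truncate Λ U with hc
  set v := ((μ : ArithmeticFunction ℝ) - truncate (μ : ArithmeticFunction ℝ) U) *
    (ζ : ArithmeticFunction ℝ) with hv
  have hS1 : ∑ n ∈ Ioc N N', (truncate Λ U n : ℂ) * g n = 0 := by
    refine sum_eq_zero fun n hn => ?_
    rw [truncate_apply, if_neg (by have := (mem_Ioc.1 hn).1; omega)]
    simp
  have hS2 : ‖∑ n ∈ Ioc N N',
      ((truncate (μ : ArithmeticFunction ℝ) U * ArithmeticFunction.log) n : ℂ) * g n‖ ≤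
      2 * T * H * (1 + H) := by
    rw [sum_convolution_mul, ← sum_subset (Ioc_subset_Ioc_right (hUN.trans hNN'))]
    · calc _ ≤ ∑ a ∈ Ioc 0 U, 2 * T * H * ((1 : ℝ) / a) := by
            refine norm_sum_le_of_le _ fun a ha => ?_
            obtain ⟨ha1, haN⟩ := hU3 a ha
            rw [norm_mul, Complex.norm_real, Real.norm_eq_abs]
            have h1 := norm_sum_log_mul_le (F := fun b => g (a * b)) (M := T / a)
              (Nat.div_le_div_right (c := a) hNN') fun t ht => by
                have := hI a ha1 haN (a * t)
                  ((Nat.mul_le_mul_left a ht).trans (Nat.mul_div_le N' a))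
                rwa [Nat.mul_div_cancel_left _ ha1] at this
            have h2 := hlog (N' / a) (Nat.div_le_self _ _)
            have h3 : T / a * Real.log (N' / a : ℕ) ≤ T / a * H := by gcongr
            calc _ ≤ 1 * (2 * (T / a * H)) := by
                  gcongr
                  · exact abs_truncate_moebius_le U a
                  · exact h1.trans (by linarith)
              _ = _ := by ring
        _ ≤ _ := by
            rw [← mul_sum]
            gcongr
    · intro a _ ha2
      rw [truncate_apply, if_neg (by simp_all)]
      simp
  have hS3 : ‖∑ n ∈ Ioc N N', ((c * (ζ : ArithmeticFunction ℝ)) n : ℂ) * g n‖ ≤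
      T * H * (1 + H) + H * 1 * T := by
    have hz : ∀ a ∈ Ioc 0 N', (c a : ℂ) * ∑ b ∈ Ioc (N / a) (N' / a),
        ((ζ : ArithmeticFunction ℝ) b : ℂ) * g (a * b) =
        (if a ≤ U then (c a : ℂ) * ∑ b ∈ Ioc (N / a) (N' / a), g (a * b) else 0) +
        ((if a ≤ U then 0 else c a : ℝ) : ℂ) * ∑ b ∈ Ioc (N / a) (N' / a),
          ((if U < b then 1 else 0 : ℝ) : ℂ) * g (a * b) := by
      intro a ha
      have hzeta : ∑ b ∈ Ioc (N / a) (N' / a), ((ζ : ArithmeticFunction ℝ) b : ℂ) * g (a * b) =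
          ∑ b ∈ Ioc (N / a) (N' / a), g (a * b) := by
        refine sum_congr rfl fun b hb => ?_
        have : b ≠ 0 := ((Nat.zero_le _).trans_lt (mem_Ioc.1 hb).1).ne'
        simp [ArithmeticFunction.natCoe_apply, ArithmeticFunction.zeta_apply, this]
      rw [hzeta]
      split_ifs with haU
      · simp
      · rw [zero_add]
        by_cases hca : c a = 0
        · simp [hca]
        · congr 1
          refine sum_congr rfl fun b hb => ?_
          have haUU : a ≤ U * U := by
            by_contra! h
            exact hca (truncate_mul_truncate_eq_zero h)
          have hb1 := (mem_Ioc.1 hb).1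
          rw [Nat.div_lt_iff_lt_mul (mem_Ioc.1 ha).1] at hb1
          have hUb : U < b := by
            by_contra! h
            have h1 := Nat.mul_le_mul h haUU
            have h2 : U * (U * U) = U ^ 3 := by ring
            omega
          simp [hUb]
    rw [sum_convolution_mul, sum_congr rfl hz, sum_add_distrib]
    refine (norm_add_le _ _).trans (add_le_add ?_ ?_)
    · rw [← sum_filter]
      have hfil : {a ∈ Ioc 0 N' | a ≤ U} = Ioc 0 U := by
        ext a
        simp only [mem_filter, mem_Ioc]
        omega
      rw [hfil]
      calc _ ≤ ∑ a ∈ Ioc 0 U, T * H * ((1 : ℝ) / a) := by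
            refine norm_sum_le_of_le _ fun a ha => ?_
            obtain ⟨ha1, haN⟩ := hU3 a ha
            rw [norm_mul, Complex.norm_real, Real.norm_eq_abs]
            calc _ ≤ H * (T / a) := by
                  gcongr
                  · exact (abs_truncate_mul_truncate_le_log U a).trans
                      (hlog a ((mem_Ioc.1 ha).2.trans (hUN.trans hNN')))
                  · exact hI a ha1 haN N' le_rfl
              _ = _ := by ring
        _ ≤ _ := by
            rw [← mul_sum]
            gcongr
    · refine norm_bilinear_le hII (by linarith) one_pos ?_ ?_ ?_ ?_
      · intro n hn
        split_ifs
        · simpa using by linarith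
        · exact (abs_truncate_mul_truncate_le_log U n).trans (hlog n hn)
      · intro n _
        split_ifs <;> simp
      · intro n _ hn0
        split_ifs at hn0 with h
        · exact absurd rfl hn0
        · exact hlarge n (by omega)
      · intro n _ hn0
        split_ifs at hn0 with h
        · exact hlarge n h
        · exact absurd rfl hn0
  have hS4 : ‖∑ n ∈ Ioc N N', (((Λ - truncate Λ U) * v) n : ℂ) * g n‖ ≤ H * D * T := by
    rw [sum_convolution_mul]
    refine norm_bilinear_le hII (by linarith) hD ?_ ?_ ?_ ?_
    · exact fun n hn => (abs_vonMangoldt_sub_truncate_le_log U n).trans (hlog n hn)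
    · exact fun n hn => (abs_moebius_sub_truncate_mul_zeta_le U n).trans (hdiv n hn)
    · intro n _ hn0
      refine hlarge n ?_
      by_contra! h
      exact hn0 (vonMangoldt_sub_truncate_eq_zero h)
    · intro n _ hn0
      refine hlarge n ?_
      by_contra! h
      exact hn0 (moebius_sub_truncate_mul_zeta_eq_zero h)
  have hsplit : ∑ n ∈ Ioc N N', (Λ n : ℂ) * g n =
      ∑ n ∈ Ioc N N', (truncate Λ U n : ℂ) * g n +
      ∑ n ∈ Ioc N N',
        ((truncate (μ : ArithmeticFunction ℝ) U * ArithmeticFunction.log) n : ℂ) * g n -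
      ∑ n ∈ Ioc N N', ((c * (ζ : ArithmeticFunction ℝ)) n : ℂ) * g n +
      ∑ n ∈ Ioc N N', (((Λ - truncate Λ U) * v) n : ℂ) * g n := by
    rw [← sum_add_distrib, ← sum_sub_distrib, ← sum_add_distrib]
    refine sum_congr rfl fun n _ => ?_
    have h := congrArg (fun F : ArithmeticFunction ℝ => F n) (vaughan_identity U)
    simp only [ArithmeticFunction.add_apply, arithmeticFunction_sub_apply _ (_ * _)] at h
    rw [h]
    push_cast
    ring
  rw [hsplit, hS1, zero_add]
  refine (norm_add_le _ _).trans ?_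
  have := norm_sub_le (∑ n ∈ Ioc N N',
      ((truncate (μ : ArithmeticFunction ℝ) U * ArithmeticFunction.log) n : ℂ) * g n)
    (∑ n ∈ Ioc N N', ((c * (ζ : ArithmeticFunction ℝ)) n : ℂ) * g n)
  linarith

end Vaughan

end VinogradovMean

namespace VinogradovMean

section PrimeSums

open scoped ArithmeticFunction.vonMangoldt

variable {d : ℕ}

lemma vonMangoldt_dyadic_sum (α θ : Fin (d + 1) → ℝ) (hα : ∀ i, 0 < α i) (hθ : StrictMono θ)
    (hz : ∀ z : ℤ, (z : ℝ) ≠ θ (Fin.last d)) (hΘ : 3 < θ (Fin.last d)) {ε ρ : ℝ} (hε : 0 < ε)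
    (hρ : ρ * (8 * θ (Fin.last d) ^ 2 + 12 * θ (Fin.last d) + 10) = 1) :
    ∃ C ≥ (1 : ℝ), ∀ N : ℕ, C ≤ N → ∀ τ ξ : ℝ, θ (Fin.last d) - 0.1 * ρ ≤ τ →
      τ ≤ θ (Fin.last d) + 3.2 * ρ → ξ = (N : ℝ) ^ (τ - ρ - θ (Fin.last d)) →
      ∀ N' : ℕ, N ≤ N' → N' ≤ 2 * N →
      ‖∑ n ∈ Ioc N N', (Λ n : ℂ) * e (ξ * ppoly α θ n)‖ ≤ C * (N : ℝ) ^ (1 - ρ + ε) := by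
  have hε4 : 0 < ε / 4 := by linarith
  obtain ⟨C₁, hC₁, h₁⟩ := typeOne_sum α θ hα hθ hz hΘ hε4 hρ
  obtain ⟨C₂, hC₂, h₂⟩ := typeTwo_hyperbolic α θ hα hθ hz hΘ hε4 hρ
  obtain ⟨D, hD, hdiv⟩ := card_divisors_le_rpow hε4
  set K : ℝ := 3 + 4 / ε with hK
  have hK0 : 0 < K := by positivity
  set B : ℝ := 3 * K * K + K + K * (D * 2 ^ (ε / 4)) with hB
  have hB0 : 0 ≤ B := by positivity
  refine ⟨C₁ + C₂ + (C₁ + C₂) * B, by nlinarith,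
    fun N hN τ ξ hτ1 hτ2 hξ N' hNN' hN' => ?_⟩
  have hCB : 0 ≤ (C₁ + C₂) * B := by positivity
  have hN1 : (1 : ℝ) ≤ N := by linarith
  have hN0 : (0 : ℝ) < N := by linarith
  have hN'0 : (0 : ℝ) < N' := hN0.trans_le (by exact_mod_cast hNN')
  have hN'R : (N' : ℝ) ≤ 2 * N := by exact_mod_cast hN'
  set x : ℝ := (N : ℝ) ^ (ε / 4) with hx
  have hx1 : 1 ≤ x := Real.one_le_rpow hN1 hε4.le
  set Q : ℝ := (N : ℝ) ^ (1 - ρ + ε / 4) with hQ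
  have hQ0 : 0 < Q := by positivity
  have hlogN := Real.log_le_rpow_div hN0.le hε4
  have hlogN0 := Real.log_nonneg hN1
  have hlog2 : Real.log (2 * N) ≤ 1 + Real.log N := by
    rw [Real.log_mul two_ne_zero hN0.ne']
    linarith [Real.log_two_lt_d9]
  have hlogN' : Real.log N' ≤ 1 + Real.log N :=
    (Real.log_le_log hN'0 hN'R).trans hlog2
  have hHx : 1 + (2 + Real.log N) ≤ K * x := by
    have h1 : x / (ε / 4) = 4 / ε * x := by field_simp
    rw [h1] at hlogN
    rw [hK]
    linarith
  have key := norm_sum_vonMangoldt_mul_le (g := fun n => e (ξ * ppoly α θ n)) (N := N) (N' := N')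
    (T := (C₁ + C₂) * Q) (H := 2 + Real.log N) (D := D * 2 ^ (ε / 4) * x) hNN' ?_ ?_
    (by positivity) (by linarith) (by linarith) (by positivity) ?_
  · refine key.trans ?_
    have h1 : 3 * (2 + Real.log N) * (1 + (2 + Real.log N)) + (2 + Real.log N) +
        (2 + Real.log N) * (D * 2 ^ (ε / 4) * x) ≤ B * x ^ 2 := by
      have h2 : 2 + Real.log N ≤ K * x := by linarith
      calc _ ≤ 3 * (K * x) * (K * x) + K * x * x + K * x * (D * 2 ^ (ε / 4) * x) := by
            gcongr
            exact h2.trans (le_mul_of_one_le_right (by positivity) hx1)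
        _ = _ := by rw [hB]; ring
    have h3 : Q * x ^ 2 ≤ (N : ℝ) ^ (1 - ρ + ε) := by
      rw [hQ, hx, ← Real.rpow_mul_natCast hN0.le, ← Real.rpow_add hN0]
      refine Real.rpow_le_rpow_of_exponent_le hN1 ?_
      push_cast
      linarith
    calc _ ≤ (C₁ + C₂) * Q * (B * x ^ 2) := by gcongr
      _ = (C₁ + C₂) * B * (Q * x ^ 2) := by ring
      _ ≤ (C₁ + C₂) * B * (N : ℝ) ^ (1 - ρ + ε) := by gcongr
      _ ≤ _ := by
        gcongr
        linarith
  · intro a ha haN M hM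
    have h := h₁ N (by linarith) τ ξ hτ1 hτ2 hξ M a (hM.trans hN') ha haN
    push_cast
    refine h.trans ?_
    gcongr
    linarith
  · intro u w hu hw hu0 hw0
    have h := h₂ N (by linarith) τ ξ hτ1 hτ2 hξ N' u w hN' hu hw hu0 hw0
    push_cast
    refine h.trans ?_
    gcongr
    linarith
  · intro n hn
    rcases Nat.eq_zero_or_pos n with rfl | h
    · simpa using by positivity
    · refine (hdiv n h.ne').trans ?_
      rw [mul_assoc, hx, ← Real.mul_rpow two_pos.le hN0.le]
      have : (n : ℝ) ≤ 2 * N := le_trans (by exact_mod_cast hn) hN'R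
      gcongr

lemma norm_sum_vonMangoldt_mul_le_trivial {g : ℕ → ℂ} (hg : ∀ n, ‖g n‖ ≤ 1) {M : ℕ} {Y : ℝ}
    (hM : (M : ℝ) ≤ Y) : ‖∑ n ∈ Ioc 0 M, (Λ n : ℂ) * g n‖ ≤ M * Real.log Y := by
  calc _ ≤ ∑ n ∈ Ioc 0 M, Real.log Y := by
        refine norm_sum_le_of_le _ fun n hn => ?_
        rw [mem_Ioc] at hn
        have hn0 : (0 : ℝ) < n := by exact_mod_cast hn.1
        rw [norm_mul, Complex.norm_real,
          Real.norm_of_nonneg ArithmeticFunction.vonMangoldt_nonneg]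
        calc Λ n * ‖g n‖ ≤ Λ n * 1 := by
              gcongr
              exact hg n
          _ ≤ Real.log n := by
              rw [mul_one]
              exact ArithmeticFunction.vonMangoldt_le_log
          _ ≤ _ := Real.log_le_log hn0 (le_trans (by exact_mod_cast hn.2) hM)
    _ = _ := by simp

lemma vonMangoldt_exponential_sum (α θ : Fin (d + 1) → ℝ) (hα : ∀ i, 0 < α i) (hθ : StrictMono θ)
    (hz : ∀ z : ℤ, (z : ℝ) ≠ θ (Fin.last d)) (hΘ : 3 < θ (Fin.last d)) {ε ρ : ℝ} (hε : 0 < ε)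
    (hρ : ρ * (8 * θ (Fin.last d) ^ 2 + 12 * θ (Fin.last d) + 10) = 1) :
    ∃ C ≥ (1 : ℝ), ∀ Y : ℝ, C ≤ Y → ∀ ξ : ℝ, Y ^ (-ρ) ≤ ξ → ξ ≤ Y ^ (2 * ρ) →
      ‖∑ n ∈ Ioc 0 ⌊Y⌋₊, (Λ n : ℂ) * e (ξ * ppoly α θ n)‖ ≤ C * Y ^ (1 - ρ + ε) := by
  have hε2 : 0 < ε / 2 := by linarith
  obtain ⟨C, hC, h⟩ := vonMangoldt_dyadic_sum α θ hα hθ hz hΘ hε2 hρ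
  obtain ⟨hρ0, hρ1, -⟩ := saving_small hΘ hρ
  refine ⟨2 * C ^ 2 + 2 / ε + (1 + 4 / ε) * C, ?_, fun Y hY ξ hξ1 hξ2 => ?_⟩
  · have : 0 ≤ 2 / ε + (1 + 4 / ε) * C := by positivity
    nlinarith
  have hpos : 0 ≤ 2 / ε + (1 + 4 / ε) * C := by positivity
  have hYC : C ^ 2 ≤ Y := by nlinarith
  have hY2 : 2 ≤ Y := by nlinarith
  have hY1 : 1 ≤ Y := by linarith
  have hY0 : 0 < Y := by linarith
  have hlogY : 0 < Real.log Y := Real.log_pos (by linarith)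
  have hξ0 : 0 < ξ := (Real.rpow_pos_of_pos hY0 _).trans_le hξ1
  have hlogξ1 : -ρ * Real.log Y ≤ Real.log ξ := by
    rw [← Real.log_rpow hY0]
    exact Real.log_le_log (by positivity) hξ1
  have hlogξ2 : Real.log ξ ≤ 2 * ρ * Real.log Y := by
    rw [← Real.log_rpow hY0]
    exact Real.log_le_log hξ0 hξ2
  set R : ℝ := Y ^ (1 - ρ) with hR
  have hR1 : 1 ≤ R := Real.one_le_rpow hY1 (by linarith)
  have hCR : C ≤ R := by
    have h1 : C ≤ Y ^ ((1 : ℝ) / 2) := by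
      rw [← Real.sqrt_eq_rpow]
      exact Real.le_sqrt_of_sq_le hYC
    exact h1.trans (Real.rpow_le_rpow_of_exponent_le hY1 (by linarith))
  set g : ℕ → ℂ := fun n => e (ξ * ppoly α θ n) with hg
  have hg1 : ∀ n, ‖g n‖ ≤ 1 := fun n => (norm_e _).le
  set M := ⌊Y⌋₊ with hM
  have hMY : (M : ℝ) ≤ Y := Nat.floor_le hY0.le
  set Q : ℝ := Y ^ (1 - ρ + ε / 2) with hQ
  have hQ0 : 0 < Q := by positivity
  have hlarge : ∀ N N' : ℕ, R ≤ N → N ≤ M → N ≤ N' → N' ≤ 2 * N →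
      ‖∑ n ∈ Ioc N N', (Λ n : ℂ) * g n‖ ≤ C * Q := by
    intro N N' hRN hNM hNN' hN'
    have hN0 : (0 : ℝ) < N := by linarith
    have hNY : (N : ℝ) ≤ Y := le_trans (by exact_mod_cast hNM) hMY
    have hl1 : (1 - ρ) * Real.log Y ≤ Real.log N := by
      rw [← Real.log_rpow hY0]
      exact Real.log_le_log (by positivity) hRN
    have hl0 : 0 < Real.log N := lt_of_lt_of_le (mul_pos (by linarith) hlogY) hl1
    have hb1 : -(1.1 * ρ) ≤ Real.log ξ / Real.log N := by
      rw [le_div_iff₀ hl0]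
      have h1 : 1.1 * ρ * ((1 - ρ) * Real.log Y) ≤ 1.1 * ρ * Real.log N := by gcongr
      have h2 : ρ * Real.log Y * 1 ≤ ρ * Real.log Y * (1.1 * (1 - ρ)) := by
        gcongr
        linarith
      linarith
    have hb2 : Real.log ξ / Real.log N ≤ 2.2 * ρ := by
      rw [div_le_iff₀ hl0]
      have h1 : 2.2 * ρ * ((1 - ρ) * Real.log Y) ≤ 2.2 * ρ * Real.log N := by gcongr
      have h2 : ρ * Real.log Y * 1 ≤ ρ * Real.log Y * (1.1 * (1 - ρ)) := by
        gcongr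
        linarith
      linarith
    refine (h N (by linarith) (Real.log ξ / Real.log N + ρ + θ (Fin.last d)) ξ (by linarith)
      (by linarith) ?_ N' hNN' hN').trans ?_
    · rw [Real.rpow_def_of_pos hN0]
      have : Real.log N * (Real.log ξ / Real.log N + ρ + θ (Fin.last d) - ρ - θ (Fin.last d)) =
          Real.log ξ := by
        field_simp
        ring
      rw [this, Real.exp_log hξ0]
    · rw [hQ]
      gcongr
      linarith
  have hind : ∀ j : ℕ, ‖∑ n ∈ Ioc 0 (min (2 ^ j) M), (Λ n : ℂ) * g n‖ ≤
      2 * R * Real.log Y + j * (C * Q) := by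
    have htriv : ∀ j : ℕ, (2 : ℝ) ^ j ≤ 2 * R →
        ‖∑ n ∈ Ioc 0 (min (2 ^ j) M), (Λ n : ℂ) * g n‖ ≤ 2 * R * Real.log Y + j * (C * Q) := by
      intro j hj
      have h1 : ((min (2 ^ j) M : ℕ) : ℝ) ≤ 2 * R :=
        le_trans (by exact_mod_cast min_le_left (2 ^ j) M) hj
      have h2 : ((min (2 ^ j) M : ℕ) : ℝ) ≤ Y :=
        le_trans (by exact_mod_cast min_le_right (2 ^ j) M) hMY
      have h3 : 0 ≤ (j : ℝ) * (C * Q) := by positivity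
      have h4 := norm_sum_vonMangoldt_mul_le_trivial hg1 h2
      have h5 := mul_le_mul_of_nonneg_right h1 hlogY.le
      linarith
    intro j
    induction j with
    | zero => exact htriv 0 (by norm_num; linarith)
    | succ j ih =>
      have hCQ : 0 ≤ C * Q := by positivity
      rcases lt_or_ge ((2 : ℝ) ^ j) R with hlt | hge
      · exact htriv (j + 1) (by rw [pow_succ]; linarith)
      · push_cast
        rcases le_or_gt M (2 ^ j) with hMj | hMj
        · rw [min_eq_right hMj] at ih
          rw [min_eq_right (hMj.trans (Nat.pow_le_pow_right two_pos (Nat.le_succ j)))]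
          linarith
        · rw [min_eq_left hMj.le] at ih
          have h1 : 2 ^ j ≤ min (2 ^ (j + 1)) M :=
            le_min (Nat.pow_le_pow_right two_pos (Nat.le_succ j)) hMj.le
          rw [← sum_Ioc_consecutive _ (Nat.zero_le _) h1]
          have h2 := hlarge (2 ^ j) (min (2 ^ (j + 1)) M) (by exact_mod_cast hge) hMj.le h1
            ((min_le_left _ _).trans (by rw [pow_succ]; omega))
          refine (norm_add_le _ _).trans ?_
          linarith
  have hM1 : 1 ≤ M := Nat.le_floor (by exact_mod_cast hY1)
  have hfin := hind (Nat.log 2 M + 1)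
  rw [min_eq_right (Nat.lt_pow_succ_log_self one_lt_two M).le] at hfin
  refine hfin.trans ?_
  have hx1 : 1 ≤ Y ^ (ε / 2) := Real.one_le_rpow hY1 hε2.le
  have hj : ((Nat.log 2 M + 1 : ℕ) : ℝ) ≤ (1 + 4 / ε) * Y ^ (ε / 2) := by
    have h1 := natLog_le_rpow hε2 hM1
    have h2 : 2 / (ε / 2) * (M : ℝ) ^ (ε / 2) ≤ 4 / ε * Y ^ (ε / 2) := by
      rw [show 2 / (ε / 2) = 4 / ε by field_simp; norm_num]
      gcongr
    push_cast
    linarith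
  have hlog := Real.log_le_rpow_div hY0.le hε
  have he1 : R * Y ^ ε = Y ^ (1 - ρ + ε) := by rw [hR, ← Real.rpow_add hY0]
  have he2 : Y ^ (ε / 2) * Q = Y ^ (1 - ρ + ε) := by
    rw [hQ, ← Real.rpow_add hY0]
    congr 1
    ring
  calc _ ≤ 2 * R * (Y ^ ε / ε) + (1 + 4 / ε) * Y ^ (ε / 2) * (C * Q) := by gcongr
    _ = 2 / ε * (R * Y ^ ε) + (1 + 4 / ε) * C * (Y ^ (ε / 2) * Q) := by ring
    _ = (2 / ε + (1 + 4 / ε) * C) * Y ^ (1 - ρ + ε) := by rw [he1, he2]; ring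
    _ ≤ _ := by
      gcongr
      nlinarith

end PrimeSums

end VinogradovMean

namespace VinogradovMean

/-- The periodic second Bernoulli function. -/
def periodicBernoulliTwo (y : ℝ) : ℝ := Int.fract y ^ 2 - Int.fract y + 1 / 6

lemma hasSum_periodicBernoulliTwo (y : ℝ) :
    HasSum (fun h : ℕ => 1 / (h : ℝ) ^ 2 * Real.cos (2 * Real.pi * h * y))
      (Real.pi ^ 2 * periodicBernoulliTwo y) := by
  have h := hasSum_one_div_nat_pow_mul_cos (k := 1) one_ne_zero (x := Int.fract y)
    ⟨Int.fract_nonneg y, (Int.fract_lt_one y).le⟩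
  have hB : (Polynomial.map (algebraMap ℚ ℝ) (Polynomial.bernoulli (2 * 1))).eval (Int.fract y) =
      periodicBernoulliTwo y := by
    simp_rw [Polynomial.bernoulli, mul_one, sum_range_succ, sum_range_zero,
      bernoulli_eq_bernoulli'_of_ne_one zero_ne_one,
      bernoulli'_zero, bernoulli_one, bernoulli_eq_bernoulli'_of_ne_one (show 2 ≠ 1 by norm_num),
      bernoulli'_two, periodicBernoulliTwo]
    simp
    ring
  rw [hB] at h
  convert h using 1
  · ext n
    rw [Int.fract, show 2 * Real.pi * n * (y - ⌊y⌋) =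
      2 * Real.pi * n * y - ((n * ⌊y⌋ : ℤ) : ℝ) * (2 * Real.pi) by push_cast; ring,
      Real.cos_sub_int_mul_two_pi]
  · rw [show Nat.factorial (2 * 1) = 2 from rfl]
    push_cast
    ring

lemma fract_sub_half_lower {Δ : ℝ} (hΔ0 : 0 < Δ) (hΔ1 : Δ < 1) (y : ℝ) :
    (periodicBernoulliTwo (y + Δ) - periodicBernoulliTwo y) / (2 * Δ) - Δ / 2 ≤
      Int.fract y - 1 / 2 := by
  rw [sub_le_iff_le_add, div_le_iff₀ (by positivity), periodicBernoulliTwo, periodicBernoulliTwo]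
  have h0 := Int.fract_nonneg y
  have h1 := Int.fract_lt_one y
  rcases lt_or_ge (Int.fract y + Δ) 1 with h | h
  · have : Int.fract (y + Δ) = Int.fract y + Δ := by
      rw [Int.fract_eq_iff]
      exact ⟨by linarith, h, ⌊y⌋, by rw [Int.fract]; ring⟩
    rw [this]
    nlinarith
  · have : Int.fract (y + Δ) = Int.fract y + Δ - 1 := by
      rw [Int.fract_eq_iff]
      exact ⟨by linarith, by linarith, ⌊y⌋ + 1, by rw [Int.fract]; push_cast; ring⟩
    rw [this]
    nlinarith

lemma fract_sub_half_upper {Δ : ℝ} (hΔ0 : 0 < Δ) (hΔ1 : Δ < 1) (y : ℝ) :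
    Int.fract y - 1 / 2 ≤
      (periodicBernoulliTwo y - periodicBernoulliTwo (y - Δ)) / (2 * Δ) + Δ / 2 := by
  rw [← sub_le_iff_le_add, le_div_iff₀ (by positivity), periodicBernoulliTwo, periodicBernoulliTwo]
  have h0 := Int.fract_nonneg y
  have h1 := Int.fract_lt_one y
  rcases lt_or_ge (Int.fract y) Δ with h | h
  · have : Int.fract (y - Δ) = Int.fract y - Δ + 1 := by
      rw [Int.fract_eq_iff]
      exact ⟨by linarith, by linarith, ⌊y⌋ - 1, by rw [Int.fract]; push_cast; ring⟩
    rw [this]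
    nlinarith
  · have : Int.fract (y - Δ) = Int.fract y - Δ := by
      rw [Int.fract_eq_iff]
      exact ⟨by linarith, by linarith, ⌊y⌋, by rw [Int.fract]; ring⟩
    rw [this]
    nlinarith

lemma indicator_fract_sub_eq {c : ℝ} (hc0 : 0 < c) (hc1 : c < 1) (x : ℝ) :
    (if Int.fract x < c then (1 : ℝ) else 0) - c =
      (Int.fract (x - c) - 1 / 2) - (Int.fract x - 1 / 2) := by
  have h0 := Int.fract_nonneg x
  have h1 := Int.fract_lt_one x
  split_ifs with h
  · have : Int.fract (x - c) = Int.fract x - c + 1 := by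
      rw [Int.fract_eq_iff]
      exact ⟨by linarith, by linarith, ⌊x⌋ - 1, by rw [Int.fract]; push_cast; ring⟩
    rw [this]
    ring
  · have : Int.fract (x - c) = Int.fract x - c := by
      rw [Int.fract_eq_iff]
      exact ⟨by linarith, by linarith, ⌊x⌋, by rw [Int.fract]; ring⟩
    rw [this]
    ring

lemma norm_e_sub_one_le (x : ℝ) : ‖e x - 1‖ ≤ 2 * Real.pi * |x| := by
  have h := Real.norm_exp_I_mul_ofReal_sub_one_le (x := 2 * Real.pi * x)
  have hx : e x = Complex.exp (Complex.I * (2 * Real.pi * x : ℝ)) := by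
    rw [e]
    congr 1
    push_cast
    ring
  rw [hx]
  refine h.trans (le_of_eq ?_)
  rw [Real.norm_eq_abs, abs_mul, abs_of_pos (by positivity)]

lemma cos_eq_re_e (h y : ℝ) : Real.cos (2 * Real.pi * h * y) = (e (h * y)).re := by
  rw [e, Complex.exp_ofReal_mul_I_re]
  ring_nf

/-- Truncated Fourier bound for increments of the second periodic Bernoulli function. -/
lemma abs_sum_periodicBernoulliTwo_sub_le {s : Finset ℕ} {w y : ℕ → ℝ} (hw : ∀ n ∈ s, 0 ≤ w n)
    {H : ℕ} {T Δ : ℝ} (hΔ : 0 < Δ) (hT0 : 0 ≤ T)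
    (hT : ∀ h : ℕ, 1 ≤ h → h ≤ H → ‖∑ n ∈ s, (w n : ℂ) * e (h * y n)‖ ≤ T) :
    |∑ n ∈ s, w n * (periodicBernoulliTwo (y n + Δ) - periodicBernoulliTwo (y n))| ≤
      2 * Δ * ((1 + Real.log H) * T + (∑ n ∈ s, w n) / (Δ * (H + 1))) := by
  set W := ∑ n ∈ s, w n with hW
  have hW0 : 0 ≤ W := sum_nonneg hw
  have hpi : (3 : ℝ) < Real.pi := Real.pi_gt_three
  set term : ℕ → ℝ := fun h => ∑ n ∈ s, w n * (1 / (h : ℝ) ^ 2 *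
    Real.cos (2 * Real.pi * h * (y n + Δ)) - 1 / (h : ℝ) ^ 2 * Real.cos (2 * Real.pi * h * y n))
    with hterm
  have hsum : HasSum term (Real.pi ^ 2 *
      ∑ n ∈ s, w n * (periodicBernoulliTwo (y n + Δ) - periodicBernoulliTwo (y n))) := by
    have h := hasSum_sum (s := s) fun n (_ : n ∈ s) =>
      ((hasSum_periodicBernoulliTwo (y n + Δ)).sub (hasSum_periodicBernoulliTwo (y n))).mul_left
        (w n)
    have heq : Real.pi ^ 2 *
        ∑ n ∈ s, w n * (periodicBernoulliTwo (y n + Δ) - periodicBernoulliTwo (y n)) =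
        ∑ n ∈ s, w n * (Real.pi ^ 2 * periodicBernoulliTwo (y n + Δ) -
          Real.pi ^ 2 * periodicBernoulliTwo (y n)) := by
      rw [mul_sum]
      exact sum_congr rfl fun n _ => by ring
    rw [heq]
    exact h
  have hterm_le : ∀ h : ℕ, |term h| ≤
      1 / (h : ℝ) ^ 2 * (‖∑ n ∈ s, (w n : ℂ) * e (h * y n)‖ * ‖e (h * Δ) - 1‖) := by
    intro h
    have heq : term h = 1 / (h : ℝ) ^ 2 *
        ((∑ n ∈ s, (w n : ℂ) * e (h * y n)) * (e (h * Δ) - 1)).re := by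
      rw [sum_mul, Complex.re_sum, mul_sum]
      refine sum_congr rfl fun n _ => ?_
      rw [cos_eq_re_e, cos_eq_re_e, mul_add, e_add,
        show (w n : ℂ) * e (h * y n) * (e (h * Δ) - 1) =
          (w n : ℂ) * (e (h * y n) * e (h * Δ) - e (h * y n)) by ring, Complex.re_ofReal_mul,
        Complex.sub_re]
      ring
    rw [heq, abs_mul, abs_of_nonneg (by positivity), ← norm_mul]
    gcongr
    exact Complex.abs_re_le_norm _
  have hSW : ∀ h : ℕ, ‖∑ n ∈ s, (w n : ℂ) * e (h * y n)‖ ≤ W := by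
    intro h
    refine norm_sum_le_of_le _ fun n hn => ?_
    rw [norm_mul, norm_e, mul_one, Complex.norm_real, Real.norm_of_nonneg (hw n hn)]
  have hsmall : ∀ h ∈ Ioc 0 H, |term h| ≤ 2 * Real.pi * Δ * T * (1 / h) := by
    intro h hh
    rw [mem_Ioc] at hh
    have hh0 : (0 : ℝ) < h := by exact_mod_cast hh.1
    have h1 := norm_e_sub_one_le (h * Δ)
    rw [abs_of_pos (by positivity)] at h1
    refine (hterm_le h).trans ?_
    calc _ ≤ 1 / (h : ℝ) ^ 2 * (T * (2 * Real.pi * (h * Δ))) := by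
          gcongr
          exact hT h hh.1 hh.2
      _ = _ := by field_simp
  have htail : ∀ h : ℕ, |term h| ≤ 2 * W * ((h : ℝ) ^ 2)⁻¹ := by
    intro h
    refine (hterm_le h).trans ?_
    have h1 : ‖e (h * Δ) - 1‖ ≤ 2 := by
      refine (norm_sub_le _ _).trans ?_
      rw [norm_e, norm_one]
      norm_num
    calc _ ≤ 1 / (h : ℝ) ^ 2 * (W * 2) := by
          gcongr
          exact hSW h
      _ = _ := by ring
  have hzero : term 0 = 0 := by simp [hterm]
  have hlogH : 0 ≤ 1 + Real.log H := by linarith [Real.log_natCast_nonneg H]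
  have hpart : ∀ N : ℕ, |∑ h ∈ range N, term h| ≤
      2 * Real.pi * Δ * T * (1 + Real.log H) + 2 * W * (2 / (H + 1)) := by
    intro N
    refine (abs_sum_le_sum_abs _ _).trans ?_
    rw [← sum_filter_add_sum_filter_not (range N) fun h => h ≤ H]
    refine add_le_add ?_ ?_
    · calc _ ≤ ∑ h ∈ Ioc 0 H, |term h| := by
            rw [← sum_filter_add_sum_filter_not ({h ∈ range N | h ≤ H}) fun h => h = 0]
            have h0 : ∑ h ∈ {h ∈ range N | h ≤ H} with h = 0, |term h| = 0 :=
              sum_eq_zero fun h hh => by rw [(mem_filter.1 hh).2, hzero, abs_zero]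
            rw [h0, zero_add]
            refine sum_le_sum_of_subset_of_nonneg (fun h hh => ?_) fun _ _ _ => abs_nonneg _
            simp only [mem_filter, mem_range] at hh
            rw [mem_Ioc]
            omega
        _ ≤ ∑ h ∈ Ioc 0 H, 2 * Real.pi * Δ * T * ((1 : ℝ) / h) := sum_le_sum hsmall
        _ ≤ _ := by
          rw [← mul_sum]
          gcongr
          exact sum_one_div_le_one_add_log H
    · calc _ ≤ ∑ h ∈ Ioo H N, |term h| := by
            refine sum_le_sum_of_subset_of_nonneg (fun h hh => ?_) fun _ _ _ => abs_nonneg _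
            simp only [mem_filter, mem_range] at hh
            rw [mem_Ioo]
            omega
        _ ≤ ∑ h ∈ Ioo H N, 2 * W * ((h : ℝ) ^ 2)⁻¹ := sum_le_sum fun h _ => htail h
        _ ≤ _ := by
          rw [← mul_sum]
          gcongr
          exact sum_Ioo_inv_sq_le H N
  have hlim := le_of_tendsto' hsum.tendsto_sum_nat.abs hpart
  rw [abs_mul, abs_of_pos (by positivity)] at hlim
  set A := |∑ n ∈ s, w n * (periodicBernoulliTwo (y n + Δ) - periodicBernoulliTwo (y n))|
  have hTL : 0 ≤ Δ * T * (1 + Real.log H) := by positivity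
  have hWH : 0 ≤ W / (H + 1) := by positivity
  have hgoal : 2 * Δ * ((1 + Real.log H) * T + W / (Δ * (H + 1))) =
      2 * (Δ * T * (1 + Real.log H)) + 2 * (W / (H + 1)) := by
    field_simp
  have hlim' : Real.pi ^ 2 * A ≤
      2 * Real.pi * (Δ * T * (1 + Real.log H)) + 4 * (W / (H + 1)) := by
    refine hlim.trans (le_of_eq ?_)
    ring
  rw [hgoal]
  have h1 : 2 * Real.pi * (Δ * T * (1 + Real.log H)) ≤
      Real.pi ^ 2 * (2 * (Δ * T * (1 + Real.log H))) := by
    have h4 : Real.pi * 1 ≤ Real.pi * Real.pi := by gcongr; linarith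
    have h5 := mul_le_mul_of_nonneg_right h4 hTL
    linarith
  have h2 : 4 * (W / (H + 1)) ≤ Real.pi ^ 2 * (2 * (W / (H + 1))) := by
    have h4 : (2 : ℝ) ≤ Real.pi ^ 2 := by nlinarith
    have h5 := mul_le_mul_of_nonneg_right h4 hWH
    linarith
  have h3 : Real.pi ^ 2 * A ≤ Real.pi ^ 2 *
      (2 * (Δ * T * (1 + Real.log H)) + 2 * (W / (H + 1))) := by linarith
  exact le_of_mul_le_mul_left h3 (by positivity)

/-- An Erdős–Turán type inequality for the sawtooth function. -/
lemma abs_sum_fract_sub_half_le {s : Finset ℕ} {w y : ℕ → ℝ} (hw : ∀ n ∈ s, 0 ≤ w n)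
    {H : ℕ} {T Δ : ℝ} (hΔ0 : 0 < Δ) (hΔ1 : Δ < 1) (hT0 : 0 ≤ T)
    (hT : ∀ h : ℕ, 1 ≤ h → h ≤ H → ‖∑ n ∈ s, (w n : ℂ) * e (h * y n)‖ ≤ T) :
    |∑ n ∈ s, w n * (Int.fract (y n) - 1 / 2)| ≤
      (1 + Real.log H) * T + (∑ n ∈ s, w n) / (Δ * (H + 1)) + (∑ n ∈ s, w n) * Δ / 2 := by
  have hshift : ∀ h : ℕ, 1 ≤ h → h ≤ H → ‖∑ n ∈ s, (w n : ℂ) * e (h * (y n - Δ))‖ ≤ T := by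
    intro h h1 h2
    have heq : ∑ n ∈ s, (w n : ℂ) * e (h * (y n - Δ)) =
        (∑ n ∈ s, (w n : ℂ) * e (h * y n)) * e (-(h * Δ)) := by
      rw [sum_mul]
      refine sum_congr rfl fun n _ => ?_
      rw [mul_sub, sub_eq_add_neg, e_add, mul_assoc]
    rw [heq, norm_mul, norm_e, mul_one]
    exact hT h h1 h2
  have hlow := abs_sum_periodicBernoulliTwo_sub_le hw hΔ0 hT0 hT
  have hup := abs_sum_periodicBernoulliTwo_sub_le (y := fun n => y n - Δ) hw hΔ0 hT0 hshift
  simp only [sub_add_cancel] at hup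
  set E := (1 + Real.log H) * T + (∑ n ∈ s, w n) / (Δ * (H + 1))
  have h1 : ∑ n ∈ s, w n * (Int.fract (y n) - 1 / 2) ≤
      (∑ n ∈ s, w n * (periodicBernoulliTwo (y n) - periodicBernoulliTwo (y n - Δ))) / (2 * Δ) +
        (∑ n ∈ s, w n) * Δ / 2 := by
    rw [sum_div, mul_div_assoc, sum_mul, ← sum_add_distrib]
    refine sum_le_sum fun n hn => ?_
    have := mul_le_mul_of_nonneg_left (fract_sub_half_upper hΔ0 hΔ1 (y n)) (hw n hn)
    refine this.trans (le_of_eq ?_)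
    ring
  have h2 : (∑ n ∈ s, w n * (periodicBernoulliTwo (y n + Δ) - periodicBernoulliTwo (y n))) /
      (2 * Δ) - (∑ n ∈ s, w n) * Δ / 2 ≤ ∑ n ∈ s, w n * (Int.fract (y n) - 1 / 2) := by
    rw [sum_div, mul_div_assoc, sum_mul, ← sum_sub_distrib]
    refine sum_le_sum fun n hn => ?_
    have := mul_le_mul_of_nonneg_left (fract_sub_half_lower hΔ0 hΔ1 (y n)) (hw n hn)
    refine le_trans (le_of_eq ?_) this
    ring
  have h3 : (∑ n ∈ s, w n * (periodicBernoulliTwo (y n) - periodicBernoulliTwo (y n - Δ))) /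
      (2 * Δ) ≤ E := by
    rw [div_le_iff₀ (by positivity), mul_comm E]
    exact (le_abs_self _).trans hup
  have h4 : -E ≤ (∑ n ∈ s, w n * (periodicBernoulliTwo (y n + Δ) - periodicBernoulliTwo (y n))) /
      (2 * Δ) := by
    rw [le_div_iff₀ (by positivity), neg_mul, mul_comm E]
    exact (abs_le.1 hlow).1
  rw [abs_le]
  constructor <;> linarith

end VinogradovMean

namespace VinogradovMean

section Sawtooth

open scoped ArithmeticFunction.vonMangoldt

variable {d : ℕ}

lemma vonMangoldt_sawtooth_sum (α θ : Fin (d + 1) → ℝ) (hα : ∀ i, 0 < α i) (hθ : StrictMono θ)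
    (hz : ∀ z : ℤ, (z : ℝ) ≠ θ (Fin.last d)) (hΘ : 3 < θ (Fin.last d)) {ε ρ : ℝ} (hε : 0 < ε)
    (hρ : ρ * (8 * θ (Fin.last d) ^ 2 + 12 * θ (Fin.last d) + 10) = 1) :
    ∃ C ≥ (1 : ℝ), ∀ Y : ℝ, C < Y → ∀ m : ℕ, 1 ≤ m → (m : ℝ) ≤ Y ^ ρ → ∀ t : ℝ,
      |∑ n ∈ Ioc 0 ⌊Y⌋₊, Λ n * (Int.fract (ppoly α θ n / m - t) - 1 / 2)| ≤
        C * Y ^ (1 - ρ + ε) := by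
  have hε2 : 0 < ε / 2 := by linarith
  obtain ⟨C, hC, h⟩ := vonMangoldt_exponential_sum α θ hα hθ hz hΘ hε2 hρ
  obtain ⟨hρ0, hρ1, -⟩ := saving_small hΘ hρ
  have hε' : 0 < 2 / ε := by positivity
  refine ⟨(1 + 2 / ε) * C + 2 / ε + 2 / ε, by nlinarith, fun Y hY m hm hmY t => ?_⟩
  have hCY : C ≤ Y := by nlinarith
  have hY1 : 1 < Y := by nlinarith
  have hY0 : 0 < Y := by linarith
  have hm0 : (0 : ℝ) < m := by exact_mod_cast hm
  have hm1 : (1 : ℝ) ≤ m := by exact_mod_cast hm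
  have hlogY : 0 < Real.log Y := Real.log_pos hY1
  set T : ℝ := C * Y ^ (1 - ρ + ε / 2) with hT
  have hT0 : 0 ≤ T := by positivity
  set H := ⌊Y ^ (2 * ρ)⌋₊ with hH
  have hHY : (H : ℝ) ≤ Y ^ (2 * ρ) := Nat.floor_le (by positivity)
  have hHY' : Y ^ (2 * ρ) ≤ H + 1 := (Nat.lt_floor_add_one _).le
  set M := ⌊Y⌋₊ with hM
  have hMY : (M : ℝ) ≤ Y := Nat.floor_le hY0.le
  have hexp : ∀ h : ℕ, 1 ≤ h → h ≤ H →
      ‖∑ n ∈ Ioc 0 M, (Λ n : ℂ) * e (h * (ppoly α θ n / m - t))‖ ≤ T := by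
    intro k hk1 hkH
    have hk : (1 : ℝ) ≤ k := by exact_mod_cast hk1
    have heq : ∑ n ∈ Ioc 0 M, (Λ n : ℂ) * e (k * (ppoly α θ n / m - t)) =
        (∑ n ∈ Ioc 0 M, (Λ n : ℂ) * e (k / m * ppoly α θ n)) * e (-(k * t)) := by
      rw [sum_mul]
      refine sum_congr rfl fun n _ => ?_
      rw [mul_assoc, ← e_add]
      congr 2
      ring
    rw [heq, norm_mul, norm_e, mul_one]
    refine h Y hCY (k / m) ?_ ?_
    · rw [Real.rpow_neg hY0.le, ← one_div]
      gcongr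
    · calc (k : ℝ) / m ≤ k := div_le_self (by linarith) hm1
        _ ≤ _ := le_trans (by exact_mod_cast hkH) hHY
  have hΔ1 : Y ^ (-ρ) < 1 := Real.rpow_lt_one_of_one_lt_of_neg hY1 (by linarith)
  have key := abs_sum_fract_sub_half_le (fun n _ => ArithmeticFunction.vonMangoldt_nonneg)
    (Real.rpow_pos_of_pos hY0 (-ρ)) hΔ1 hT0 hexp
  refine key.trans ?_
  have hW : ∑ n ∈ Ioc 0 M, Λ n ≤ Y * Real.log Y := by
    have h1 := norm_sum_vonMangoldt_mul_le_trivial (g := fun _ => 1) (by simp) hMY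
    simp only [mul_one] at h1
    rw [← Complex.ofReal_sum, Complex.norm_real] at h1
    refine (le_abs_self _).trans (h1.trans ?_)
    gcongr
  have hlogH : Real.log H ≤ Real.log Y := by
    rcases Nat.eq_zero_or_pos H with h0 | h0
    · rw [h0]
      simpa using hlogY.le
    · have h0' : (0 : ℝ) < H := by exact_mod_cast h0
      refine Real.log_le_log h0' (hHY.trans ?_)
      calc Y ^ (2 * ρ) ≤ Y ^ (1 : ℝ) := Real.rpow_le_rpow_of_exponent_le hY1.le (by linarith)
        _ = Y := Real.rpow_one Y
  set x : ℝ := Y ^ (ε / 2) with hx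
  have hx1 : 1 ≤ x := Real.one_le_rpow hY1.le hε2.le
  have hlogx : Real.log Y ≤ 2 / ε * x := by
    refine (Real.log_le_rpow_div hY0.le hε2).trans (le_of_eq ?_)
    field_simp
    exact hx.symm
  set Q : ℝ := Y ^ (1 - ρ + ε) with hQ
  have hQ0 : 0 < Q := by positivity
  have hb1 : (1 + Real.log H) * T ≤ (1 + 2 / ε) * C * Q := by
    have h1 : x * Y ^ (1 - ρ + ε / 2) = Q := by
      rw [hx, hQ, ← Real.rpow_add hY0]
      congr 1
      ring
    calc _ ≤ ((1 + 2 / ε) * x) * T := by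
          gcongr
          linarith
      _ = (1 + 2 / ε) * C * (x * Y ^ (1 - ρ + ε / 2)) := by rw [hT]; ring
      _ = _ := by rw [h1]
  have hb : Y * Real.log Y * Y ^ (-ρ) ≤ 2 / ε * Q := by
    have h1 : Y * Y ^ (-ρ) * Y ^ (ε / 2) ≤ Q := by
      rw [hQ]
      nth_rewrite 1 [← Real.rpow_one Y]
      rw [← Real.rpow_add hY0, ← Real.rpow_add hY0]
      exact Real.rpow_le_rpow_of_exponent_le hY1.le (by linarith)
    calc _ ≤ Y * (2 / ε * x) * Y ^ (-ρ) := by gcongr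
      _ = 2 / ε * (Y * Y ^ (-ρ) * Y ^ (ε / 2)) := by rw [hx]; ring
      _ ≤ _ := by gcongr
  have hb2 : (∑ n ∈ Ioc 0 M, Λ n) / (Y ^ (-ρ) * (H + 1)) ≤ 2 / ε * Q := by
    refine le_trans ?_ hb
    rw [div_le_iff₀ (by positivity)]
    have h1 : Y ^ (-ρ) * Y ^ (-ρ) * Y ^ (2 * ρ) = 1 := by
      rw [← Real.rpow_add hY0, ← Real.rpow_add hY0, show -ρ + -ρ + 2 * ρ = 0 by ring,
        Real.rpow_zero]
    calc _ ≤ Y * Real.log Y * 1 := by rw [mul_one]; exact hW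
      _ = Y * Real.log Y * (Y ^ (-ρ) * Y ^ (-ρ) * Y ^ (2 * ρ)) := by rw [h1]
      _ ≤ Y * Real.log Y * (Y ^ (-ρ) * Y ^ (-ρ) * (H + 1)) := by gcongr
      _ = _ := by ring
  have hb3 : (∑ n ∈ Ioc 0 M, Λ n) * Y ^ (-ρ) / 2 ≤ 2 / ε * Q := by
    have h1 : (∑ n ∈ Ioc 0 M, Λ n) * Y ^ (-ρ) ≤ Y * Real.log Y * Y ^ (-ρ) := by gcongr
    have h2 : 0 < 2 / ε * Q := by positivity
    linarith
  linarith

end Sawtooth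

end VinogradovMean

theorem vonMangoldt_indicator_discrepancy_bound
    (f : ℝ → ℝ) (Θ : ℝ) (hf : IsDominantPseudoPoly f Θ) (hΘ : 3 < Θ)
    (ρt : ℝ) (hρt0 : 0 < ρt) (hρt : ρt < (1 / (8 * Θ ^ 2 + 12 * Θ + 10)) / 3) :
    ∃ δ₀ > (0 : ℝ), ∀ δ : ℝ, 0 < δ → δ ≤ δ₀ → ∀ ε > (0 : ℝ), ∃ C > (0 : ℝ),
      ∀ᶠ X : ℕ in atTop, ∀ m : ℕ, 2 ≤ m → (m : ℝ) ≤ (X : ℝ) ^ ρt →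
        |∑ n ∈ Finset.Icc 1 ⌊(X : ℝ) ^ ((1 : ℝ) / 3 + δ)⌋₊,
            ArithmeticFunction.vonMangoldt n *
              ((if Int.fract (f n / m) < 1 / (m : ℝ) then (1 : ℝ) else 0) - 1 / m)| ≤
          C * ((X : ℝ) ^ ((1 : ℝ) / 3 + δ)) ^
            (1 - 1 / (8 * Θ ^ 2 + 12 * Θ + 10) + ε) := by
  obtain ⟨d, α, θ, hα, hθ, -, rfl, hz, hf⟩ := hf
  set ρ : ℝ := 1 / (8 * θ (Fin.last d) ^ 2 + 12 * θ (Fin.last d) + 10) with hρdef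
  have hρ : ρ * (8 * θ (Fin.last d) ^ 2 + 12 * θ (Fin.last d) + 10) = 1 :=
    one_div_mul_cancel (by positivity)
  refine ⟨1, one_pos, fun δ hδ _ ε hε => ?_⟩
  obtain ⟨C, hC, h⟩ := VinogradovMean.vonMangoldt_sawtooth_sum α θ hα hθ hz hΘ hε hρ
  refine ⟨2 * C, by linarith, ?_⟩
  have hY : Tendsto (fun X : ℕ => (X : ℝ) ^ ((1 : ℝ) / 3 + δ)) atTop atTop :=
    (tendsto_rpow_atTop (by linarith)).comp tendsto_natCast_atTop_atTop
  filter_upwards [hY.eventually_gt_atTop C, eventually_ge_atTop 1] with X hX hX1 m hm hmX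
  have hX1' : (1 : ℝ) ≤ X := by exact_mod_cast hX1
  have hm2 : (2 : ℝ) ≤ m := by exact_mod_cast hm
  have hmY : (m : ℝ) ≤ ((X : ℝ) ^ ((1 : ℝ) / 3 + δ)) ^ ρ := by
    refine hmX.trans ?_
    rw [← Real.rpow_mul (by linarith)]
    refine Real.rpow_le_rpow_of_exponent_le hX1' ?_
    nlinarith
  have h₁ := h _ hX m (by omega) hmY (1 / m)
  have h₂ := h _ hX m (by omega) hmY 0
  have hsplit : ∑ n ∈ Finset.Icc 1 ⌊(X : ℝ) ^ ((1 : ℝ) / 3 + δ)⌋₊,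
      ArithmeticFunction.vonMangoldt n *
        ((if Int.fract (f n / m) < 1 / (m : ℝ) then (1 : ℝ) else 0) - 1 / m) =
      ∑ n ∈ Ioc 0 ⌊(X : ℝ) ^ ((1 : ℝ) / 3 + δ)⌋₊, ArithmeticFunction.vonMangoldt n *
        (Int.fract (VinogradovMean.ppoly α θ n / m - 1 / m) - 1 / 2) -
      ∑ n ∈ Ioc 0 ⌊(X : ℝ) ^ ((1 : ℝ) / 3 + δ)⌋₊, ArithmeticFunction.vonMangoldt n *
        (Int.fract (VinogradovMean.ppoly α θ n / m - 0) - 1 / 2) := by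
    rw [← sum_sub_distrib]
    refine sum_congr rfl fun n _ => ?_
    rw [VinogradovMean.indicator_fract_sub_eq (by positivity)
      ((div_lt_one (by linarith)).2 (by linarith)), hf, sub_zero, VinogradovMean.ppoly]
    ring
  rw [hsplit]
  refine (abs_sub _ _).trans ?_
  linarith
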